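/- arXiv:2209.09289 — 2 statements merged into one kernel-verified Lean document; each statement's English description precedes it below -/
import Mathlib

section
/- Let $\alpha\in(0,1)$ and let $n,m,\ell\ge 1$ be integers with $\ell\le\alpha^7 m/10^5$ and $\alpha^2 n\ge 8m$. Let $K$ be a bipartite graph with parts $A$ and $B$ where $|A|=m$, $|B|=n$, and every vertex $v\in A$ has degree at least $\alpha n$ in $K$. Then there are disjoint subsets $B_0,B_1\subseteq B$ with $|B_0|=m-\ell$ and $|B_1|\ge\alpha^7 n/10^5$ such that for any $U\subseteq B_1$ with $|U|=\ell$, the graph $K$ contains a perfect matching between $A$ and $B_0\cup U$. -/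
open scoped Classical

/-- Double counting, real-valued. -/
lemma absorb_dc {S T : Type*} (s : Finset S) (t : Finset T) (r : S → T → Prop)
    [∀ a b, Decidable (r a b)] :
    ∑ a ∈ s, ((t.filter (fun b => r a b)).card : ℝ)
      = ∑ b ∈ t, ((s.filter (fun a => r a b)).card : ℝ) := by
  have h := Finset.sum_card_bipartiteAbove_eq_sum_card_bipartiteBelow (s := s) (t := t) r
  simp only [Finset.bipartiteAbove, Finset.bipartiteBelow] at h
  exact_mod_cast h

/-- Dependent random choice: many length-three walks between all pairs of `W × B'`. -/
lemma absorb_drc {V : Type*} [DecidableEq V] (α : ℝ) (hα0 : 0 < α)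
    (n k : ℕ) (hn : 0 < n) (hk : 0 < k) (K : SimpleGraph V) (A B : Finset V)
    (hA : A.card = k) (hB : B.card = n)
    (hdeg : ∀ v ∈ A, α * n ≤ ((B.filter (fun u => K.Adj v u)).card : ℝ)) :
    ∃ W ⊆ A, ∃ B' ⊆ B, α * k / 4 ≤ (W.card : ℝ) ∧ α * n / 2 ≤ (B'.card : ℝ) ∧
      ∀ w ∈ W, ∀ u ∈ B', α ^ 2 * k / 8 ≤ ((A.filter (fun a => K.Adj a u ∧
        α ^ 3 * n / 16 ≤ ((B.filter (fun x => K.Adj w x ∧ K.Adj a x)).card : ℝ))).card : ℝ) := by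
  have hn' : (0:ℝ) < n := by exact_mod_cast hn
  have hk' : (0:ℝ) < k := by exact_mod_cast hk
  let cod : V → V → ℝ := fun w a => ((B.filter (fun x => K.Adj w x ∧ K.Adj a x)).card : ℝ)
  let P : Finset (V × V) := (A ×ˢ A).filter (fun p => cod p.1 p.2 < α ^ 3 * n / 16)
  let s : V → ℝ := fun b => ((A.filter (fun a => K.Adj a b)).card : ℝ)
  let bad : V → ℝ := fun b => ((P.filter (fun p => K.Adj p.1 b ∧ K.Adj p.2 b)).card : ℝ)
  have h1 : α * n * k ≤ ∑ b ∈ B, s b := by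
    rw [← absorb_dc A B K.Adj]
    have := Finset.card_nsmul_le_sum A _ _ hdeg
    rw [hA, nsmul_eq_mul] at this
    linarith
  have h2 : α ^ 2 * n * k ^ 2 ≤ ∑ b ∈ B, (s b) ^ 2 := by
    have hcs := sq_sum_le_card_mul_sum_sq (s := B) (f := s)
    rw [hB] at hcs
    have h3 : (α * n * k) ^ 2 ≤ (∑ b ∈ B, s b) ^ 2 := pow_le_pow_left₀ (by positivity) h1 2
    have h4 : (n:ℝ) * (α ^ 2 * n * k ^ 2) ≤ n * ∑ b ∈ B, (s b) ^ 2 := by nlinarith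
    exact le_of_mul_le_mul_left h4 hn'
  have h3 : ∑ b ∈ B, bad b ≤ k ^ 2 * (α ^ 3 * n / 16) := by
    change ∑ b ∈ B, ((P.filter (fun p => K.Adj p.1 b ∧ K.Adj p.2 b)).card : ℝ) ≤ _
    rw [← absorb_dc P B (fun p b => K.Adj p.1 b ∧ K.Adj p.2 b)]
    have h := Finset.sum_le_card_nsmul P
      (fun p => ((B.filter (fun b => K.Adj p.1 b ∧ K.Adj p.2 b)).card : ℝ)) (α ^ 3 * n / 16)
      (fun p hp => (Finset.mem_filter.1 hp).2.le)
    refine h.trans ?_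
    rw [nsmul_eq_mul]
    have hP : (P.card : ℝ) ≤ k ^ 2 := by
      have : P.card ≤ (A ×ˢ A).card := Finset.card_filter_le _ _
      rw [Finset.card_product, hA] at this
      have : (P.card : ℝ) ≤ ((k * k : ℕ) : ℝ) := by exact_mod_cast this
      push_cast at this; nlinarith
    gcongr
  have hBne : B.Nonempty := by rw [← Finset.card_pos, hB]; exact hn
  obtain ⟨b, hb, hbs⟩ : ∃ b ∈ B, α ^ 2 * k ^ 2 / 2 ≤ (s b) ^ 2 - (8 / α) * bad b := by
    apply Finset.exists_le_of_sum_le hBne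
    rw [Finset.sum_const, hB, nsmul_eq_mul, Finset.sum_sub_distrib, ← Finset.mul_sum]
    have : (8 / α) * ∑ b ∈ B, bad b ≤ (8 / α) * (k ^ 2 * (α ^ 3 * n / 16)) := by gcongr
    have e : (8 / α) * (k ^ 2 * (α ^ 3 * n / 16)) = α ^ 2 * n * k ^ 2 / 2 := by
      field_simp; ring
    linarith
  have hbad0 : 0 ≤ bad b := Nat.cast_nonneg _
  have hs0 : 0 ≤ s b := Nat.cast_nonneg _
  have hsk : α * k / 2 ≤ s b := by
    have : 0 ≤ (8 / α) * bad b := by positivity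
    apply (sq_le_sq₀ (by positivity) hs0).1
    nlinarith [mul_pos hα0 hk']
  have hspos : 0 < s b := lt_of_lt_of_le (by positivity) hsk
  have hbads : bad b ≤ α * (s b) ^ 2 / 8 := by
    have h5 : (8 / α) * bad b ≤ (s b) ^ 2 := by nlinarith [mul_pos hα0 hk']
    rw [div_mul_eq_mul_div, div_le_iff₀ hα0] at h5
    linarith
  let Ab := A.filter (fun a => K.Adj a b)
  have hAbs : (Ab.card : ℝ) = s b := rfl
  have hAbA : Ab ⊆ A := Finset.filter_subset _ _
  let bp : V → ℝ := fun w => ((Ab.filter (fun a => cod w a < α ^ 3 * n / 16)).card : ℝ)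
  have h6 : ∑ w ∈ Ab, bp w ≤ bad b := by
    have e : ∑ w ∈ Ab, (Ab.filter (fun a => cod w a < α ^ 3 * n / 16)).card
        = ((Ab ×ˢ Ab).filter (fun p => cod p.1 p.2 < α ^ 3 * n / 16)).card := by
      simp only [Finset.card_filter, Finset.sum_product]
    have e2 : ((Ab ×ˢ Ab).filter (fun p => cod p.1 p.2 < α ^ 3 * n / 16)).card ≤
        (P.filter (fun p => K.Adj p.1 b ∧ K.Adj p.2 b)).card := by
      apply Finset.card_le_card
      intro p hp
      simp only [Ab, P, Finset.mem_filter, Finset.mem_product] at hp ⊢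
      tauto
    rw [← e] at e2
    simp only [bp, bad]
    exact_mod_cast e2
  refine ⟨Ab.filter (fun w => bp w ≤ α * s b / 4), (Finset.filter_subset _ _).trans hAbA,
    B.filter (fun u => α * s b / 2 ≤ ((Ab.filter (fun a => K.Adj a u)).card : ℝ)),
    Finset.filter_subset _ _, ?_, ?_, ?_⟩
  · have hc := Finset.card_filter_add_card_filter_not (s := Ab) (fun w => bp w ≤ α * s b / 4)
    have hc' : ((Ab.filter (fun w => bp w ≤ α * s b / 4)).card : ℝ)
      + ((Ab.filter (fun w => ¬ bp w ≤ α * s b / 4)).card : ℝ) = s b := by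
      rw [← hAbs]; exact_mod_cast hc
    have h7 := Finset.card_nsmul_le_sum (Ab.filter (fun w => ¬ bp w ≤ α * s b / 4)) bp
      (α * s b / 4) (fun w hw => (not_le.1 (Finset.mem_filter.1 hw).2).le)
    have h8 : ∑ w ∈ Ab.filter (fun w => ¬ bp w ≤ α * s b / 4), bp w ≤ ∑ w ∈ Ab, bp w :=
      Finset.sum_le_sum_of_subset_of_nonneg (Finset.filter_subset _ _)
        (fun _ _ _ => Nat.cast_nonneg _)
    rw [nsmul_eq_mul] at h7
    have h9 : (α * s b / 4) * ((Ab.filter (fun w => ¬ bp w ≤ α * s b / 4)).card : ℝ)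
      ≤ (α * s b / 4) * (s b / 2) := by nlinarith
    have h10 := le_of_mul_le_mul_left h9 (by positivity)
    linarith
  · have h7 : α * n * s b ≤ ∑ u ∈ B, ((Ab.filter (fun a => K.Adj a u)).card : ℝ) := by
      rw [← absorb_dc Ab B K.Adj]
      have := Finset.card_nsmul_le_sum Ab _ _ (fun v hv => hdeg v (hAbA hv))
      rw [nsmul_eq_mul, hAbs] at this
      linarith
    have h8 : ∑ u ∈ B, ((Ab.filter (fun a => K.Adj a u)).card : ℝ) ≤
        ∑ u ∈ B, (α * s b / 2 +
          if α * s b / 2 ≤ ((Ab.filter (fun a => K.Adj a u)).card : ℝ) then s b else 0) := by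
      apply Finset.sum_le_sum
      intro u hu
      split_ifs with h
      · have : ((Ab.filter (fun a => K.Adj a u)).card : ℝ) ≤ s b := by
          rw [← hAbs]; exact_mod_cast Finset.card_filter_le _ _
        have : 0 ≤ α * s b / 2 := by positivity
        linarith
      · linarith
    rw [Finset.sum_add_distrib, Finset.sum_const, hB, nsmul_eq_mul, ← Finset.sum_filter,
      Finset.sum_const, nsmul_eq_mul] at h8
    have h9 : s b * (α * n / 2) ≤ s b *
      ((B.filter (fun u => α * s b / 2 ≤ ((Ab.filter (fun a => K.Adj a u)).card : ℝ))).card : ℝ) := by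
      linarith
    exact le_of_mul_le_mul_left h9 hspos
  · intro w hw u hu
    have hw2 := (Finset.mem_filter.1 hw).2
    have hu2 := (Finset.mem_filter.1 hu).2
    have hsub : Ab.filter (fun a => K.Adj a u) ⊆ (A.filter (fun a => K.Adj a u ∧
        α ^ 3 * n / 16 ≤ cod w a)) ∪ (Ab.filter (fun a => cod w a < α ^ 3 * n / 16)) := by
      intro a ha
      have ha' := Finset.mem_filter.1 ha
      by_cases h : cod w a < α ^ 3 * n / 16
      · exact Finset.mem_union_right _ (Finset.mem_filter.2 ⟨ha'.1, h⟩)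
      · exact Finset.mem_union_left _ (Finset.mem_filter.2 ⟨hAbA ha'.1, ha'.2, not_lt.1 h⟩)
    have hc := (Finset.card_le_card hsub).trans (Finset.card_union_le _ _)
    have hc' : ((Ab.filter (fun a => K.Adj a u)).card : ℝ) ≤ ((A.filter (fun a => K.Adj a u ∧
        α ^ 3 * n / 16 ≤ cod w a)).card : ℝ) + bp w := by
      simp only [bp]; exact_mod_cast hc
    have : α ^ 2 * k / 8 ≤ α * s b / 4 := by nlinarith
    change _ ≤ ((A.filter (fun a => K.Adj a u ∧ α ^ 3 * n / 16 ≤ cod w a)).card : ℝ)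
    linarith

/-- Derandomised random greedy injection. -/
lemma absorb_greedy {V I : Type*} [DecidableEq V] (J : Finset I) (N : V → Finset V)
    (T : I → V → Finset V) (k : ℕ) (n p : ℝ) (hp0 : 0 ≤ p) (D : Finset V) :
    D.card ≤ k → (∀ a ∈ D, k < (N a).card) → (∀ a ∈ D, ((N a).card : ℝ) ≤ n) →
    (∀ i ∈ J, ∀ a ∈ D, T i a ⊆ N a) →
    (∀ i ∈ J, ∀ a ∈ D, (T i a).Nonempty → p * n + k ≤ ((T i a).card : ℝ)) →
    ∀ c : I → ℝ, (∀ i, 0 ≤ c i) →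
    ∃ M : V → V, Set.InjOn M ↑D ∧ (∀ a ∈ D, M a ∈ N a) ∧
      ∑ i ∈ J, c i * (1 / 2 : ℝ) ^ (D.filter (fun a => M a ∈ T i a)).card ≤
      ∑ i ∈ J, c i * (1 - p / 2) ^ (D.filter (fun a => (T i a).Nonempty)).card := by
  induction D using Finset.induction_on with
  | empty => intro _ _ _ _ _ c _; exact ⟨id, by simp, by simp, by simp⟩
  | insert a D ha ih =>
    intro hDk hN hNn hTN hTc c hc
    have hDk' : D.card < k := by rw [Finset.card_insert_of_notMem ha] at hDk; omega
    by_cases hp1 : p ≤ 1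
    swap
    · -- then all the `T i a` are empty
      have hemp : ∀ i ∈ J, ∀ x ∈ insert a D, T i x = ∅ := by
        intro i hi x hx
        by_contra hne
        have h1 := hTc i hi x hx (Finset.nonempty_iff_ne_empty.2 hne)
        have h2 : ((T i x).card : ℝ) ≤ (N x).card := by
          exact_mod_cast Finset.card_le_card (hTN i hi x hx)
        have h3 := hNn x hx
        have h4 : (k:ℝ) < (N x).card := by exact_mod_cast hN x hx
        have h5 : (0:ℝ) ≤ k := Nat.cast_nonneg _
        nlinarith
      obtain ⟨M, hM1, hM2, -⟩ := ih hDk'.le (fun x hx => hN x (Finset.mem_insert_of_mem hx))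
        (fun x hx => hNn x (Finset.mem_insert_of_mem hx))
        (fun i hi x hx => hTN i hi x (Finset.mem_insert_of_mem hx))
        (fun i hi x hx => hTc i hi x (Finset.mem_insert_of_mem hx)) c hc
      obtain ⟨y, hy, hyD⟩ : ∃ y ∈ N a, y ∉ D.image M := by
        apply Finset.exists_mem_notMem_of_card_lt_card
        have := hN a (Finset.mem_insert_self _ _)
        have := Finset.card_image_le (s := D) (f := M)
        omega
      refine ⟨Function.update M a y, ?_, ?_, ?_⟩
      · rw [Finset.coe_insert, Set.injOn_insert (by simpa using ha)]
        refine ⟨fun x hx z hz h => ?_, ?_⟩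
        · rw [Function.update_of_ne (by rintro rfl; exact ha hx),
            Function.update_of_ne (by rintro rfl; exact ha hz)] at h
          exact hM1 hx hz h
        · rintro ⟨x, hx, hxy⟩
          rw [Function.update_self, Function.update_of_ne (by rintro rfl; exact ha hx)] at hxy
          exact hyD (Finset.mem_image.2 ⟨x, hx, hxy⟩)
      · intro x hx
        rcases Finset.mem_insert.1 hx with rfl | hx
        · simpa using hy
        · rw [Function.update_of_ne (by rintro rfl; exact ha ‹_›)]; exact hM2 x ‹_›
      · apply le_of_eq
        apply Finset.sum_congr rfl
        intro i hi
        rw [Finset.filter_false_of_mem, Finset.filter_false_of_mem]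
        · simp
        · intro x hx; simp [hemp i hi x hx]
        · intro x hx; simp [hemp i hi x hx]
    have hq0 : 0 ≤ 1 - p / 2 := by linarith
    obtain ⟨M, hM1, hM2, hM3⟩ := ih hDk'.le (fun x hx => hN x (Finset.mem_insert_of_mem hx))
        (fun x hx => hNn x (Finset.mem_insert_of_mem hx))
        (fun i hi x hx => hTN i hi x (Finset.mem_insert_of_mem hx))
        (fun i hi x hx => hTc i hi x (Finset.mem_insert_of_mem hx))
        (fun i => c i * (if (T i a).Nonempty then 1 - p / 2 else 1))
        (fun i => mul_nonneg (hc i) (by split_ifs <;> linarith))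
    let R := N a \ D.image M
    have hNa := hN a (Finset.mem_insert_self _ _)
    have himg := Finset.card_image_le (s := D) (f := M)
    have hRne : R.Nonempty := by
      rw [← Finset.card_pos]
      have := Finset.le_card_sdiff (D.image M) (N a)
      change 0 < (N a \ D.image M).card
      omega
    have hRn : (R.card : ℝ) ≤ n := by
      refine le_trans ?_ (hNn a (Finset.mem_insert_self _ _))
      exact_mod_cast Finset.card_le_card Finset.sdiff_subset
    let d : I → ℝ := fun i => c i * (1 / 2 : ℝ) ^ (D.filter (fun x => M x ∈ T i x)).card
    have hd : ∀ i, 0 ≤ d i := fun i => mul_nonneg (hc i) (by positivity)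
    obtain ⟨y, hyR, hy⟩ : ∃ y ∈ R, ∑ i ∈ J, d i * (if y ∈ T i a then (1/2 : ℝ) else 1) ≤
        ∑ i ∈ J, d i * (if (T i a).Nonempty then 1 - p / 2 else 1) := by
      apply Finset.exists_le_of_sum_le hRne
      rw [Finset.sum_comm, Finset.sum_const, nsmul_eq_mul, Finset.mul_sum]
      apply Finset.sum_le_sum
      intro i hi
      rw [← Finset.mul_sum, mul_left_comm]
      apply mul_le_mul_of_nonneg_left _ (hd i)
      have e : ∑ y ∈ R, (if y ∈ T i a then (1/2 : ℝ) else 1)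
          = R.card - (1/2) * ((R.filter (fun y => y ∈ T i a)).card : ℝ) := by
        have : ∀ y ∈ R, (if y ∈ T i a then (1/2 : ℝ) else 1)
          = 1 - (1/2) * (if y ∈ T i a then 1 else 0) := by
          intro y _; split_ifs <;> norm_num
        rw [Finset.sum_congr rfl this, Finset.sum_sub_distrib, ← Finset.mul_sum,
          Finset.sum_boole]
        simp
      rw [e]
      split_ifs with hne
      · have h1 := hTc i hi a (Finset.mem_insert_self _ _) hne
        have h2 : (T i a).card ≤ (R.filter (fun y => y ∈ T i a)).card + (D.image M).card := by
          rw [← tsub_le_iff_right]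
          refine (Finset.le_card_sdiff _ _).trans (Finset.card_le_card ?_)
          intro z hz
          have hz' := Finset.mem_sdiff.1 hz
          exact Finset.mem_filter.2 ⟨Finset.mem_sdiff.2
            ⟨hTN i hi a (Finset.mem_insert_self _ _) hz'.1, hz'.2⟩, hz'.1⟩
        have h3 : ((T i a).card : ℝ) ≤ (R.filter (fun y => y ∈ T i a)).card + k := by
          have : (T i a).card ≤ (R.filter (fun y => y ∈ T i a)).card + k := by omega
          exact_mod_cast this
        nlinarith
      · have : (0:ℝ) ≤ ((R.filter (fun y => y ∈ T i a)).card : ℝ) := Nat.cast_nonneg _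
        linarith
    have hyR' := Finset.mem_sdiff.1 hyR
    have hup : ∀ x ∈ D, Function.update M a y x = M x := fun x hx =>
      Function.update_of_ne (by rintro rfl; exact ha hx) _ _
    refine ⟨Function.update M a y, ?_, ?_, ?_⟩
    · rw [Finset.coe_insert, Set.injOn_insert (by simpa using ha)]
      refine ⟨fun x hx z hz h => ?_, ?_⟩
      · rw [hup x hx, hup z hz] at h
        exact hM1 hx hz h
      · rintro ⟨x, hx, hxy⟩
        rw [Function.update_self, hup x hx] at hxy
        exact hyR'.2 (Finset.mem_image.2 ⟨x, hx, hxy⟩)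
    · intro x hx
      rcases Finset.mem_insert.1 hx with rfl | hx
      · simpa using hyR'.1
      · rw [hup x hx]; exact hM2 x hx
    · calc _ = ∑ i ∈ J, d i * (if y ∈ T i a then (1/2 : ℝ) else 1) := by
            apply Finset.sum_congr rfl
            intro i hi
            rw [Finset.filter_insert, Function.update_self]
            have e : D.filter (fun x => Function.update M a y x ∈ T i x)
                = D.filter (fun x => M x ∈ T i x) :=
              Finset.filter_congr (fun x hx => by rw [hup x hx])
            rw [e]
            split_ifs with h
            · rw [Finset.card_insert_of_notMem (by simp [ha]), pow_succ]
              simp only [d]; ring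
            · simp [d]
        _ ≤ _ := hy
        _ = ∑ i ∈ J, c i * (if (T i a).Nonempty then 1 - p / 2 else 1) *
              (1 / 2 : ℝ) ^ (D.filter (fun x => M x ∈ T i x)).card := by
            apply Finset.sum_congr rfl
            intro i hi; simp only [d]; ring
        _ ≤ _ := hM3
        _ = _ := by
            apply Finset.sum_congr rfl
            intro i hi
            rw [Finset.filter_insert]
            split_ifs with h
            · rw [Finset.card_insert_of_notMem (by simp [ha]), pow_succ]; ring
            · simp

/-- Greedy extension of an injection. -/
lemma absorb_extend {V : Type*} [DecidableEq V] (N : V → Finset V) (D E : Finset V) (M : V → V)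
    (hM : Set.InjOn M ↑D) (hMN : ∀ a ∈ D, M a ∈ N a) (m : ℕ) :
    Disjoint E D → D.card + E.card ≤ m → (∀ a ∈ E, m < (N a).card) →
    ∃ M' : V → V, (∀ a ∈ D, M' a = M a) ∧ Set.InjOn M' ↑(D ∪ E) ∧ ∀ a ∈ D ∪ E, M' a ∈ N a := by
  induction E using Finset.induction_on with
  | empty => intro _ _ _; exact ⟨M, fun _ _ => rfl, by simpa using hM, by simpa using hMN⟩
  | insert a E ha ih =>
    intro hdis hcard hN
    rw [Finset.disjoint_insert_left] at hdis
    rw [Finset.card_insert_of_notMem ha] at hcard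
    obtain ⟨M', h1, h2, h3⟩ := ih hdis.2 (by omega)
      (fun x hx => hN x (Finset.mem_insert_of_mem hx))
    have haDE : a ∉ D ∪ E := by simp [ha, hdis.1]
    obtain ⟨y, hy, hyD⟩ : ∃ y ∈ N a, y ∉ (D ∪ E).image M' := by
      apply Finset.exists_mem_notMem_of_card_lt_card
      have := hN a (Finset.mem_insert_self _ _)
      have := Finset.card_image_le (s := D ∪ E) (f := M')
      have := Finset.card_union_le D E
      omega
    have hup : ∀ x ∈ D ∪ E, Function.update M' a y x = M' x := fun x hx =>
      Function.update_of_ne (by rintro rfl; exact haDE hx) _ _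
    refine ⟨Function.update M' a y, ?_, ?_, ?_⟩
    · intro x hx
      rw [hup x (Finset.mem_union_left _ hx), h1 x hx]
    · rw [Finset.union_insert, Finset.coe_insert, Set.injOn_insert (by exact_mod_cast haDE)]
      refine ⟨fun x hx z hz h => ?_, ?_⟩
      · rw [hup x hx, hup z hz] at h
        exact h2 hx hz h
      · rintro ⟨x, hx, hxy⟩
        rw [Function.update_self, hup x hx] at hxy
        exact hyD (Finset.mem_image.2 ⟨x, hx, hxy⟩)
    · intro x hx
      rw [Finset.union_insert] at hx
      rcases Finset.mem_insert.1 hx with rfl | hx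
      · simpa using hy
      · rw [hup x hx]; exact h3 x hx

/-- The Hall / Menger step. -/
lemma absorb_hall {V : Type*} [DecidableEq V] (K : SimpleGraph V) (A W B₀ U : Finset V) (ℓ : ℕ)
    (hW : W ⊆ A) (hWc : W.card = ℓ) (hUc : U.card = ℓ) (M : V → V)
    (hM : Set.InjOn M ↑(A \ W)) (hMK : ∀ a ∈ A \ W, K.Adj a (M a))
    (hB₀ : B₀ = (A \ W).image M) (hdis : Disjoint B₀ U)
    (hpath : ∀ w ∈ W, ∀ u ∈ U, ℓ ≤ ((A \ W).filter (fun a => K.Adj w (M a) ∧ K.Adj a u)).card) :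
    ∃ f : V → V, Set.InjOn f ↑A ∧ A.image f = B₀ ∪ U ∧ ∀ a ∈ A, K.Adj a (f a) := by
  let t : A → Finset V := fun a => (B₀ ∪ U).filter (fun x => K.Adj a x)
  have hB₀c : B₀.card = A.card - ℓ := by
    rw [hB₀, Finset.card_image_of_injOn hM, Finset.card_sdiff_of_subset hW, hWc]
  have hℓA : ℓ ≤ A.card := hWc ▸ Finset.card_le_card hW
  have hall : ∀ S : Finset A, S.card ≤ (S.biUnion t).card := by
    intro S'
    by_contra hlt
    push Not at hlt
    let S : Finset V := S'.map (Function.Embedding.subtype _)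
    have hSA : S ⊆ A := by
      intro x hx
      simp only [S, Finset.mem_map, Function.Embedding.subtype_apply] at hx
      obtain ⟨y, _, rfl⟩ := hx; exact y.2
    have hSc : S.card = S'.card := Finset.card_map _
    let NB := S'.biUnion t
    have hNB : ∀ s ∈ S, ∀ x ∈ B₀ ∪ U, K.Adj s x → x ∈ NB := by
      intro s hs x hx hsx
      simp only [S, Finset.mem_map, Function.Embedding.subtype_apply] at hs
      obtain ⟨y, hy, rfl⟩ := hs
      exact Finset.mem_biUnion.2 ⟨y, hy, Finset.mem_filter.2 ⟨hx, hsx⟩⟩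
    have hNBc : NB.card < S.card := by rw [hSc]; exact hlt
    -- split S
    have hsplit : S.card = (S \ W).card + (S ∩ W).card := by
      rw [Finset.card_sdiff_add_card_inter]
    have hSW : S \ W ⊆ A \ W := Finset.sdiff_subset_sdiff hSA le_rfl
    have hX : (S \ W).image M ⊆ NB ∩ B₀ := by
      intro x hx
      obtain ⟨a, ha, rfl⟩ := Finset.mem_image.1 hx
      have h0 : M a ∈ B₀ := by rw [hB₀]; exact Finset.mem_image_of_mem _ (hSW ha)
      exact Finset.mem_inter.2 ⟨hNB a (Finset.mem_sdiff.1 ha).1 _ (Finset.mem_union_left _ h0)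
        (hMK a (hSW ha)), h0⟩
    have hXc : ((S \ W).image M).card = (S \ W).card :=
      Finset.card_image_of_injOn (hM.mono (by exact_mod_cast hSW))
    have hdisj : Disjoint (NB ∩ B₀) (NB ∩ U) :=
      hdis.mono Finset.inter_subset_right Finset.inter_subset_right
    have hsum : (NB ∩ B₀).card + (NB ∩ U).card ≤ NB.card := by
      rw [← Finset.card_union_of_disjoint hdisj]
      exact Finset.card_le_card (Finset.union_subset Finset.inter_subset_left
        Finset.inter_subset_left)
    have h1 := Finset.card_le_card hX
    have h2 : (S ∩ W).card ≤ ℓ := hWc ▸ Finset.card_le_card Finset.inter_subset_right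
    have hne : (S ∩ W).Nonempty := by rw [← Finset.card_pos]; omega
    obtain ⟨w, hw⟩ := hne
    have hw' := Finset.mem_inter.1 hw
    obtain ⟨u, hu, huN⟩ : ∃ u ∈ U, u ∉ NB ∩ U := by
      apply Finset.exists_mem_notMem_of_card_lt_card; omega
    have huN' : u ∉ NB := fun h => huN (Finset.mem_inter.2 ⟨h, hu⟩)
    have huS : ∀ s ∈ S, ¬ K.Adj s u := fun s hs h =>
      huN' (hNB s hs u (Finset.mem_union_right _ hu) h)
    let Q := (A \ W).filter (fun a => K.Adj w (M a) ∧ K.Adj a u)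
    have hQ : ℓ ≤ Q.card := hpath w hw'.2 u hu
    have hQA : Q ⊆ A \ W := Finset.filter_subset _ _
    have hQS : Disjoint (S \ W) Q := by
      rw [Finset.disjoint_left]
      intro a ha haQ
      exact huS a (Finset.mem_sdiff.1 ha).1 (Finset.mem_filter.1 haQ).2.2
    have hun : ((S \ W) ∪ Q).image M ⊆ NB ∩ B₀ := by
      rw [Finset.image_union]
      apply Finset.union_subset hX
      intro x hx
      obtain ⟨a, ha, rfl⟩ := Finset.mem_image.1 hx
      have h0 : M a ∈ B₀ := by rw [hB₀]; exact Finset.mem_image_of_mem _ (hQA ha)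
      exact Finset.mem_inter.2 ⟨hNB w hw'.1 _ (Finset.mem_union_left _ h0)
        (Finset.mem_filter.1 ha).2.1, h0⟩
    have h3 := Finset.card_le_card hun
    rw [Finset.card_image_of_injOn (hM.mono (by exact_mod_cast Finset.union_subset hSW hQA)),
      Finset.card_union_of_disjoint hQS] at h3
    omega
  obtain ⟨f, hf, hft⟩ := (Finset.all_card_le_biUnion_card_iff_exists_injective t).1 hall
  have hF : ∀ a (ha : a ∈ A), (fun v => if h : v ∈ A then f ⟨v, h⟩ else v) a = f ⟨a, ha⟩ :=
    fun a ha => dif_pos ha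
  have hinj : Set.InjOn (fun v => if h : v ∈ A then f ⟨v, h⟩ else v) ↑A := by
    intro x hx y hy hxy
    rw [hF x hx, hF y hy] at hxy
    exact congrArg Subtype.val (hf hxy)
  refine ⟨fun v => if h : v ∈ A then f ⟨v, h⟩ else v, hinj, ?_, ?_⟩
  · apply Finset.eq_of_subset_of_card_le
    · intro x hx
      obtain ⟨a, ha, rfl⟩ := Finset.mem_image.1 hx
      have h := (Finset.mem_filter.1 (hft ⟨a, ha⟩)).1
      rw [← hF a ha] at h
      exact h
    · rw [Finset.card_image_of_injOn hinj, Finset.card_union_of_disjoint hdis]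
      omega
  · intro a ha
    have h := (Finset.mem_filter.1 (hft ⟨a, ha⟩)).2
    rw [← hF a ha] at h
    exact h

set_option maxHeartbeats 1000000 in
/-- Lemma 3.6 (lem:absorb, Lemma 3.3 in Montgomery–Müyesser–Pehova): a bipartite
absorption lemma for matchings. -/
theorem stmt_6 {V : Type*} [DecidableEq V] (α : ℝ) (hα0 : 0 < α) (hα1 : α < 1)
    (n m ℓ : ℕ) (hℓ1 : 1 ≤ ℓ)
    (hℓ : (ℓ : ℝ) ≤ α ^ 7 * m / 10 ^ 5) (hnm : 8 * (m : ℝ) ≤ α ^ 2 * n)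
    (K : SimpleGraph V) (A B : Finset V) (hAB : Disjoint A B)
    (hAcard : A.card = m) (hBcard : B.card = n)
    (hdeg : ∀ v ∈ A, α * n ≤ ((B.filter (fun u => K.Adj v u)).card : ℝ)) :
    ∃ B₀ B₁ : Finset V, B₀ ⊆ B ∧ B₁ ⊆ B ∧ Disjoint B₀ B₁ ∧
      B₀.card = m - ℓ ∧ α ^ 7 * n / 10 ^ 5 ≤ (B₁.card : ℝ) ∧
      ∀ U ⊆ B₁, U.card = ℓ →
        ∃ f : V → V, Set.InjOn f ↑A ∧ A.image f = B₀ ∪ U ∧ ∀ a ∈ A, K.Adj a (f a) := by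
  have hℓ' : (1:ℝ) ≤ ℓ := by exact_mod_cast hℓ1
  have hm0 : (0:ℝ) ≤ m := Nat.cast_nonneg _
  have hn0 : (0:ℝ) ≤ n := Nat.cast_nonneg _
  have pw : ∀ i : ℕ, i ≤ 7 → α ^ 7 * m ≤ α ^ i * m := fun i hi =>
    mul_le_mul_of_nonneg_right (pow_le_pow_of_le_one hα0.le hα1.le hi) hm0
  have pwn : ∀ i : ℕ, 1 ≤ i → α ^ i * n ≤ α * n := fun i hi => by
    have := mul_le_mul_of_nonneg_right (pow_le_pow_of_le_one hα0.le hα1.le hi) hn0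
    simpa using this
  have hbig : (10:ℝ) ^ 5 ≤ α ^ 7 * m := by
    have : (1:ℝ) ≤ α ^ 7 * m / 10 ^ 5 := hℓ'.trans hℓ
    rwa [le_div_iff₀ (by norm_num), one_mul] at this
  have pw0 : α ^ 7 * m ≤ m := by simpa using pw 0 (by norm_num)
  have pw1 : α ^ 7 * m ≤ α * m := by simpa using pw 1 (by norm_num)
  have pw2 := pw 2 (by norm_num)
  have pw3 := pw 3 (by norm_num)
  have pw6 := pw 6 (by norm_num)
  have hmpos : (0:ℝ) < m := by linarith
  have hαn : α ^ 2 * n ≤ α * n := pwn 2 (by norm_num)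
  have hnpos' : (0:ℝ) < n := by
    rcases hn0.lt_or_eq with h | h
    · exact h
    · rw [← h] at hnm; linarith
  have hnpos : 0 < n := by exact_mod_cast hnpos'
  let k := ⌊α * m / 4⌋₊
  have hk1 : (k:ℝ) ≤ α * m / 4 := Nat.floor_le (by positivity)
  have hk2 : α * m / 8 ≤ k := by
    have := Nat.lt_floor_add_one (α * m / 4)
    change α * m / 4 < k + 1 at this
    linarith
  have hkpos : 0 < k := by
    have : (0:ℝ) < k := lt_of_lt_of_le (by positivity) hk2
    exact_mod_cast this
  have hkm' : (k:ℝ) ≤ m := by nlinarith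
  have hkm : k ≤ m := by exact_mod_cast hkm'
  have hkn : (k:ℝ) ≤ α ^ 3 * n / 32 := by
    have : α * (8 * m) ≤ α * (α ^ 2 * n) := by gcongr
    nlinarith
  obtain ⟨A', hA'A, hA'c⟩ := Finset.exists_subset_card_eq (hAcard.symm ▸ hkm)
  obtain ⟨W, hWA', B', hB'B, hWc, hB'c, hgood⟩ := absorb_drc α hα0 n k hnpos hkpos K A' B hA'c
    hBcard (fun v hv => hdeg v (hA'A hv))
  have hkk : α ^ 2 * m / 8 ≤ α * k := by nlinarith
  have hkk3 : α ^ 3 * m / 8 ≤ α ^ 2 * k := by nlinarith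
  have hℓW : ℓ ≤ W.card := by
    have : (ℓ:ℝ) ≤ W.card := by linarith
    exact_mod_cast this
  obtain ⟨W₀, hW₀W, hW₀c⟩ := Finset.exists_subset_card_eq hℓW
  have hW₀A' : W₀ ⊆ A' := hW₀W.trans hWA'
  let D := A' \ W₀
  let N : V → Finset V := fun a => B.filter (fun x => K.Adj a x)
  let T : V × V → V → Finset V := fun i a =>
    if K.Adj a i.2 ∧ α ^ 3 * n / 16 ≤ ((B.filter (fun x => K.Adj i.1 x ∧ K.Adj a x)).card : ℝ)
    then B.filter (fun x => K.Adj i.1 x ∧ K.Adj a x) else ∅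
  have hDA : D ⊆ A := Finset.sdiff_subset.trans hA'A
  have hNm : ∀ a ∈ A, m < (N a).card := by
    intro a ha
    have h := hdeg a ha
    have : (m:ℝ) < (N a).card := by
      change _ < ((B.filter (fun u => K.Adj a u)).card : ℝ)
      linarith
    exact_mod_cast this
  obtain ⟨M₀, hM₀i, hM₀N, hM₀s⟩ := absorb_greedy (W₀ ×ˢ B') N T k n (α ^ 3 / 32) (by positivity) D
    (hA'c ▸ Finset.card_le_card Finset.sdiff_subset)
    (fun a ha => lt_of_le_of_lt hkm (hNm a (hDA ha)))
    (fun a _ => by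
      rw [← hBcard]; exact_mod_cast Finset.card_filter_le _ _)
    (fun i _ a _ => by
      simp only [T]
      split_ifs
      · intro x hx
        have := Finset.mem_filter.1 hx
        exact Finset.mem_filter.2 ⟨this.1, this.2.2⟩
      · simp)
    (fun i _ a _ hne => by
      simp only [T] at hne ⊢
      split_ifs at hne ⊢ with h
      · linarith [h.2]
      · simp at hne)
    (fun _ => 1) (fun _ => zero_le_one)
  obtain ⟨M, hM1, hM2, hM3⟩ := absorb_extend N D (A \ A') M₀ hM₀i hM₀N m
    (Finset.disjoint_left.2 fun x hx hxD =>
      (Finset.mem_sdiff.1 hx).2 (Finset.mem_sdiff.1 hxD).1)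
    (by
      have h1 : D.card ≤ A'.card := Finset.card_le_card Finset.sdiff_subset
      have h2 := Finset.card_sdiff_of_subset hA'A
      omega)
    (fun a ha => hNm a (Finset.mem_sdiff.1 ha).1)
  have hDE : D ∪ (A \ A') = A \ W₀ := by
    ext x
    simp only [D, Finset.mem_union, Finset.mem_sdiff]
    constructor
    · rintro (h | h)
      · exact ⟨hA'A h.1, h.2⟩
      · exact ⟨h.1, fun h' => h.2 (hW₀A' h')⟩
    · intro h
      by_cases hx : x ∈ A'
      · exact Or.inl ⟨hx, h.2⟩
      · exact Or.inr ⟨h.1, hx⟩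
  rw [hDE] at hM2 hM3
  let X : V × V → ℕ := fun i => (D.filter (fun a => M₀ a ∈ T i a)).card
  -- upper bound for the potential
  have hg : ∀ i ∈ W₀ ×ˢ B', (1 - α ^ 3 / 32 / 2) ^ (D.filter (fun a => (T i a).Nonempty)).card
      ≤ (1 / 2 : ℝ) ^ (3 * ℓ) := by
    intro i hi
    obtain ⟨hi1, hi2⟩ := Finset.mem_product.1 hi
    have h1 := hgood i.1 (hW₀W hi1) i.2 hi2
    let G := A'.filter (fun a => K.Adj a i.2 ∧
        α ^ 3 * n / 16 ≤ ((B.filter (fun x => K.Adj i.1 x ∧ K.Adj a x)).card : ℝ))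
    have hsub : G \ W₀ ⊆ D.filter (fun a => (T i a).Nonempty) := by
      intro a ha
      have ha1 := Finset.mem_sdiff.1 ha
      have ha2 := Finset.mem_filter.1 ha1.1
      refine Finset.mem_filter.2 ⟨Finset.mem_sdiff.2 ⟨ha2.1, ha1.2⟩, ?_⟩
      simp only [T]
      rw [if_pos ha2.2, ← Finset.card_pos]
      have : (0:ℝ) < ((B.filter (fun x => K.Adj i.1 x ∧ K.Adj a x)).card : ℝ) :=
        lt_of_lt_of_le (by positivity) ha2.2.2
      exact_mod_cast this
    have h2 := Finset.card_le_card hsub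
    have h3 := Finset.le_card_sdiff W₀ G
    have h4 : G.card ≤ (D.filter (fun a => (T i a).Nonempty)).card + ℓ := by omega
    have h5 : (G.card : ℝ) ≤ (D.filter (fun a => (T i a).Nonempty)).card + ℓ := by
      exact_mod_cast h4
    have h6 : α ^ 2 * k / 8 ≤ (G.card : ℝ) := h1
    generalize (D.filter (fun a => (T i a).Nonempty)).card = g at h5
    have h7 : α ^ 3 * m / 128 ≤ g := by linarith
    have h8 : 3 * (ℓ:ℝ) ≤ α ^ 3 / 64 * g := by
      have : α ^ 3 / 64 * (α ^ 3 * m / 128) ≤ α ^ 3 / 64 * g := by gcongr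
      have e : α ^ 3 / 64 * (α ^ 3 * m / 128) = α ^ 6 * m / 8192 := by ring
      linarith
    have hα3 : α ^ 3 ≤ 1 := pow_le_one₀ hα0.le hα1.le
    calc (1 - α ^ 3 / 32 / 2) ^ g ≤ (Real.exp (-(α ^ 3 / 64))) ^ g := by
          apply pow_le_pow_left₀
          · linarith
          · have := Real.add_one_le_exp (-(α ^ 3 / 64)); linarith
      _ = Real.exp (-(α ^ 3 / 64 * g)) := by rw [← Real.exp_nat_mul]; congr 1; ring
      _ ≤ Real.exp (((3 * ℓ : ℕ) : ℝ) * (-1)) := by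
          apply Real.exp_le_exp.2; push_cast; linarith
      _ = (Real.exp (-1)) ^ (3 * ℓ) := by rw [Real.exp_nat_mul]
      _ ≤ (1 / 2 : ℝ) ^ (3 * ℓ) := by
          apply pow_le_pow_left₀ (Real.exp_pos _).le
          rw [Real.exp_neg, one_div]
          apply inv_anti₀ (by norm_num)
          have := Real.add_one_le_exp (1:ℝ); linarith
  let Jb := (W₀ ×ˢ B').filter (fun i => X i < ℓ)
  have hJb : (Jb.card : ℝ) ≤ B'.card / 2 := by
    have h1 : (Jb.card : ℝ) * (1/2) ^ ℓ ≤ ∑ i ∈ W₀ ×ˢ B', (1/2 : ℝ) ^ (X i) := by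
      calc (Jb.card : ℝ) * (1/2) ^ ℓ = ∑ i ∈ Jb, (1/2 : ℝ) ^ ℓ := by simp
        _ ≤ ∑ i ∈ Jb, (1/2 : ℝ) ^ (X i) := by
            apply Finset.sum_le_sum
            intro i hi
            exact pow_le_pow_of_le_one (by norm_num) (by norm_num) (Finset.mem_filter.1 hi).2.le
        _ ≤ _ := Finset.sum_le_sum_of_subset_of_nonneg (Finset.filter_subset _ _)
            (fun _ _ _ => by positivity)
    simp only [one_mul] at hM₀s
    have h2 := h1.trans (hM₀s.trans (Finset.sum_le_sum hg))
    rw [Finset.sum_const, Finset.card_product, hW₀c, nsmul_eq_mul] at h2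
    push_cast at h2
    have e : (1/2 : ℝ) ^ (3 * ℓ) = (1/2) ^ ℓ * ((1/2) ^ ℓ * (1/2) ^ ℓ) := by ring
    rw [e] at h2
    have hpos : (0:ℝ) < (1/2) ^ ℓ := by positivity
    have h3 : (1/2 : ℝ) ^ ℓ * Jb.card ≤ (1/2) ^ ℓ * (ℓ * B'.card * ((1/2) ^ ℓ * (1/2) ^ ℓ)) := by
      linarith
    have h4 := le_of_mul_le_mul_left h3 hpos
    have h5 : (ℓ:ℝ) * (1/2) ^ ℓ ≤ 1 := by
      have : (ℓ:ℝ) ≤ 2 ^ ℓ := by exact_mod_cast Nat.lt_two_pow_self.le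
      rw [one_div, inv_pow, ← div_eq_mul_inv, div_le_one (by positivity)]
      exact this
    have h6 : (1/2 : ℝ) ^ ℓ ≤ 1/2 := by
      have := pow_le_pow_of_le_one (a := (1/2:ℝ)) (by norm_num) (by norm_num) hℓ1
      simpa using this
    calc (Jb.card : ℝ) ≤ B'.card * ((ℓ * (1/2) ^ ℓ) * (1/2) ^ ℓ) := by linarith
      _ ≤ B'.card * (1 * (1/2)) := by gcongr
      _ = _ := by ring
  let Bg := B'.filter (fun u => ∀ w ∈ W₀, ℓ ≤ X (w, u))
  have hBg : α * n / 4 ≤ (Bg.card : ℝ) := by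
    have hsub : B' ⊆ Bg ∪ Jb.image Prod.snd := by
      intro u hu
      by_cases h : ∀ w ∈ W₀, ℓ ≤ X (w, u)
      · exact Finset.mem_union_left _ (Finset.mem_filter.2 ⟨hu, h⟩)
      · push Not at h
        obtain ⟨w, hw, hX⟩ := h
        exact Finset.mem_union_right _ (Finset.mem_image.2 ⟨(w, u),
          Finset.mem_filter.2 ⟨Finset.mem_product.2 ⟨hw, hu⟩, hX⟩, rfl⟩)
    have h1 := (Finset.card_le_card hsub).trans (Finset.card_union_le _ _)
    have h2 := Finset.card_image_le (s := Jb) (f := Prod.snd)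
    have h3 : B'.card ≤ Bg.card + Jb.card := by omega
    have h4 : (B'.card : ℝ) ≤ Bg.card + Jb.card := by exact_mod_cast h3
    linarith
  let B₀ := (A \ W₀).image M
  have hB₀c : B₀.card = m - ℓ := by
    rw [Finset.card_image_of_injOn hM2, Finset.card_sdiff_of_subset (hW₀A'.trans hA'A), hW₀c, hAcard]
  refine ⟨B₀, Bg \ B₀, ?_, ?_, Finset.disjoint_sdiff, hB₀c, ?_, ?_⟩
  · intro x hx
    obtain ⟨a, ha, rfl⟩ := Finset.mem_image.1 hx
    exact (Finset.mem_filter.1 (hM3 a ha)).1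
  · exact Finset.sdiff_subset.trans ((Finset.filter_subset _ _).trans hB'B)
  · have h1 := Finset.le_card_sdiff B₀ Bg
    have h2 : Bg.card ≤ (Bg \ B₀).card + m := by omega
    have h3 : (Bg.card : ℝ) ≤ (Bg \ B₀).card + m := by exact_mod_cast h2
    have h4 := pwn 7 (by norm_num)
    have h5 : 0 < α * n := by positivity
    linarith
  · intro U hU hUc
    refine absorb_hall K A W₀ B₀ U ℓ (hW₀A'.trans hA'A) hW₀c hUc M hM2
      (fun a ha => (Finset.mem_filter.1 (hM3 a ha)).2) rfl
      (Finset.disjoint_of_subset_right hU Finset.disjoint_sdiff) ?_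
    intro w hw u hu
    have hu' := (Finset.mem_filter.1 (Finset.mem_sdiff.1 (hU hu)).1).2 w hw
    refine hu'.trans (Finset.card_le_card ?_)
    intro a ha
    obtain ⟨haD, haT⟩ := Finset.mem_filter.1 ha
    simp only [T] at haT
    split_ifs at haT with h
    · refine Finset.mem_filter.2 ⟨?_, ?_, h.1⟩
      · rw [← hDE]; exact Finset.mem_union_left _ haD
      · rw [hM1 a haD]; exact (Finset.mem_filter.1 haT).2.1
    · simp at haT
end

section
/- Let $1/n\ll 1/T\ll\omega,\alpha$, let $\mathcal{A}$ be an $\ell$-link of order $m$ and uniformity $k$, $d\in[k-1]$, and let $\delta$ be the minimum $d$-degree threshold for containment of a Hamilton $\mathcal{A}$-cycle. Let $(H_1,\dots,H_M)$ be a collection of $k$-uniform hypergraphs on $[n]$, each with minimum $d$-degree at least $(\delta+\alpha)n^{k-d}$, where $M\ge\frac{e(\mathcal{A})-e(\mathcal{A}_s)}{m-\ell}\,n$. Then the collection contains $T$ vertex-disjoint rainbow $\mathcal{A}$-chains, with pairwise disjoint colour sets, covering all but at most $\omega n$ vertices of $[n]$. -/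
/-- An ordered `k`-uniform hypergraph on `{0, …, m-1}` is an `ℓ`-link if the shift by
`m - ℓ` maps its start exactly onto its end. -/
def IsHyperLink (k ℓ m : ℕ) (A : Finset (Finset ℕ)) : Prop :=
  ℓ ≤ m ∧ (∀ e ∈ A, e ⊆ Finset.range m ∧ e.card = k) ∧
    ∀ e : Finset ℕ, e ⊆ Finset.range ℓ →
      (e ∈ A ↔ e.image (· + (m - ℓ)) ∈ A)

/-- The start of a link: its edges within the first `ℓ` vertices. -/
def linkStart (ℓ : ℕ) (A : Finset (Finset ℕ)) : Finset (Finset ℕ) :=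
  A.filter (· ⊆ Finset.range ℓ)

/-- `P` is an `𝒜`-chain of length `t` on `{0, …, (m-ℓ)t + ℓ - 1}`. -/
def IsHyperAChain (ℓ m t : ℕ) (A P : Finset (Finset ℕ)) : Prop :=
  (∀ f ∈ P, f ⊆ Finset.range ((m - ℓ) * t + ℓ)) ∧
  (∀ q < t, ∀ e : Finset ℕ, e ⊆ Finset.range m →
    (e ∈ A ↔ e.image (· + q * (m - ℓ)) ∈ P)) ∧
  (∀ f ∈ P, ∃ q < t, ∃ e ∈ A, f = e.image (· + q * (m - ℓ)))

/-- `C` is an `𝒜`-cycle with `t` links on `{0, …, (m-ℓ)t - 1}` (windows taken cyclically). -/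
def IsHyperACycle (ℓ m t : ℕ) (A C : Finset (Finset ℕ)) : Prop :=
  (∀ f ∈ C, f ⊆ Finset.range ((m - ℓ) * t)) ∧
  (∀ q < t, ∀ e : Finset ℕ, e ⊆ Finset.range m →
    (e ∈ A ↔ e.image (fun i => (i + q * (m - ℓ)) % ((m - ℓ) * t)) ∈ C)) ∧
  (∀ f ∈ C, ∃ q < t, ∃ e ∈ A, f = e.image (fun i => (i + q * (m - ℓ)) % ((m - ℓ) * t)))

/-- The `k`-uniform hypergraph `K` with vertex set `{0, …, n-1}` contains a Hamilton
`𝒜`-cycle: a spanning copy of some `𝒜`-cycle. -/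
def ContainsHamACycle (ℓ m n : ℕ) (A K : Finset (Finset ℕ)) : Prop :=
  ∃ (t : ℕ) (C : Finset (Finset ℕ)) (f : ℕ → ℕ),
    IsHyperACycle ℓ m t A C ∧ (m - ℓ) * t = n ∧
    Set.InjOn f ↑(Finset.range n) ∧ (Finset.range n).image f = Finset.range n ∧
    ∀ e ∈ C, e.image f ∈ K

/-- `δ` satisfies the uncoloured minimum `d`-degree condition for Hamilton `𝒜`-cycles. -/
def HamThresholdProp (k ℓ m d : ℕ) (A : Finset (Finset ℕ)) (x : ℝ) : Prop :=
  ∀ α' : ℝ, 0 < α' → ∃ n₀ : ℕ, ∀ n : ℕ, n₀ ≤ n → (m - ℓ) ∣ n →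
    ∀ K : Finset (Finset ℕ), (∀ e ∈ K, e ⊆ Finset.range n ∧ e.card = k) →
      (∀ S ⊆ Finset.range n, S.card = d →
        (x + α') * (n : ℝ) ^ (k - d) ≤ ((K.filter (fun e => S ⊆ e)).card : ℝ)) →
      ContainsHamACycle ℓ m n A K


/-- exponential moment bound -/
lemma mcd_exp {V : Type*} [Fintype V] [Nonempty V] (c : ℝ) (hc0 : 0 ≤ c) (hc1 : c ≤ 1) :
    ∀ (N : ℕ) (g : (Fin N → V) → ℝ),
      (∀ x i v, |g (Function.update x i v) - g x| ≤ c) →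
      ∑ x, Real.exp (g x) ≤ (Fintype.card V : ℝ) ^ N *
        Real.exp ((∑ x, g x) / (Fintype.card V : ℝ) ^ N + N * c ^ 2) := by
  intro N
  induction N with
  | zero => intro g hg; simp
  | succ N ih =>
    intro g hg
    set q : ℝ := (Fintype.card V : ℝ) with hq
    have hqpos : 0 < q := by rw [hq]; exact_mod_cast Fintype.card_pos
    have hsplit : ∀ F : (Fin (N+1) → V) → ℝ,
        ∑ x, F x = ∑ v : V, ∑ x : Fin N → V, F (Fin.cons v x) := by
      intro F
      rw [← (Fin.consEquiv (fun _ : Fin (N+1) => V)).sum_comp, Fintype.sum_prod_type]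
      rfl
    set μ : V → ℝ := fun v => (∑ x : Fin N → V, g (Fin.cons v x)) / q ^ N with hμ
    have hμd : ∀ v w, |μ v - μ w| ≤ c := by
      intro v w
      rw [hμ]
      simp only
      rw [← sub_div, ← Finset.sum_sub_distrib, abs_div, abs_of_pos (pow_pos hqpos N),
        div_le_iff₀ (pow_pos hqpos N)]
      refine (Finset.abs_sum_le_sum_abs _ _).trans ?_
      have : ∀ x ∈ (Finset.univ : Finset (Fin N → V)),
          |g (Fin.cons v x) - g (Fin.cons w x)| ≤ c := by
        intro x _
        have := hg (Fin.cons w x) 0 v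
        rwa [Fin.update_cons_zero] at this
      refine (Finset.sum_le_card_nsmul _ _ _ this).trans ?_
      simp [hq, mul_comm]
    set ν : ℝ := (∑ v, μ v) / q with hν
    have hνd : ∀ v, |μ v - ν| ≤ c := by
      intro v
      have h1 : μ v - ν = (∑ w, (μ v - μ w)) / q := by
        rw [Finset.sum_sub_distrib, hν, sub_div]
        simp [← hq]
        field_simp
      rw [h1, abs_div, abs_of_pos hqpos, div_le_iff₀ hqpos]
      refine (Finset.abs_sum_le_sum_abs _ _).trans ?_
      refine (Finset.sum_le_card_nsmul _ _ c (fun w _ => hμd v w)).trans ?_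
      simp [hq, mul_comm]
    have hmean : (∑ x, g x) / q ^ (N+1) = ν := by
      rw [hsplit, hν, hμ]
      simp only
      rw [← Finset.sum_div, div_div, pow_succ]
    rw [hmean, hsplit]
    have hin : ∀ v, ∑ x : Fin N → V, Real.exp (g (Fin.cons v x)) ≤
        q ^ N * Real.exp (μ v + N * c ^ 2) := by
      intro v
      apply ih (fun x => g (Fin.cons v x))
      intro x i w
      have := hg (Fin.cons v x) i.succ w
      rwa [← Fin.cons_update] at this
    calc ∑ v, ∑ x : Fin N → V, Real.exp (g (Fin.cons v x))
        ≤ ∑ v, q ^ N * Real.exp (μ v + N * c ^ 2) := Finset.sum_le_sum fun v _ => hin v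
      _ = q ^ N * Real.exp (ν + N * c ^ 2) * ∑ v, Real.exp (μ v - ν) := by
          rw [Finset.mul_sum]
          refine Finset.sum_congr rfl fun v _ => ?_
          rw [mul_assoc, ← Real.exp_add]; congr 2; ring
      _ ≤ q ^ N * Real.exp (ν + N * c ^ 2) * (q * Real.exp (c ^ 2)) := by
          gcongr
          have : ∀ v, Real.exp (μ v - ν) ≤ 1 + (μ v - ν) + c ^ 2 := by
            intro v
            have h1 := Real.abs_exp_sub_one_sub_id_le ((hνd v).trans hc1)
            have h2 := (abs_le.1 h1).2
            have h3 : (μ v - ν) ^ 2 ≤ c ^ 2 := sq_le_sq' (abs_le.1 (hνd v)).1 (abs_le.1 (hνd v)).2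
            linarith
          calc ∑ v, Real.exp (μ v - ν) ≤ ∑ v, (1 + (μ v - ν) + c ^ 2) :=
                Finset.sum_le_sum fun v _ => this v
            _ = q * (1 + c ^ 2) + ((∑ v, μ v) - q * ν) := by
                simp only [Finset.sum_add_distrib, Finset.sum_sub_distrib]
                simp [← hq]; ring
            _ = q * (1 + c ^ 2) := by rw [hν]; field_simp; ring
            _ ≤ q * Real.exp (c ^ 2) := by
                gcongr; linarith [Real.add_one_le_exp (c ^ 2)]
      _ = q ^ (N+1) * Real.exp (ν + ((N+1 : ℕ) : ℝ) * c ^ 2) := by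
          have : Real.exp (ν + ((N+1 : ℕ) : ℝ) * c ^ 2) =
            Real.exp (ν + N * c ^ 2) * Real.exp (c ^ 2) := by
              rw [← Real.exp_add]; push_cast; congr 1; ring
          rw [this]; ring

/-- lower tail -/
lemma mcd_tail {V : Type*} [Fintype V] [Nonempty V] (N : ℕ) (hN : 0 < N)
    (g : (Fin N → V) → ℝ) (c τ B : ℝ) (hc : 0 < c) (hτ : 0 < τ) (hτN : τ ≤ 2 * N * c)
    (hg : ∀ x i v, |g (Function.update x i v) - g x| ≤ c)
    (hB : B * (Fintype.card V : ℝ) ^ N ≤ ∑ x, g x) :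
    ((Finset.univ.filter (fun x => g x < B - τ)).card : ℝ) ≤
      (Fintype.card V : ℝ) ^ N * Real.exp (-(τ ^ 2 / (4 * N * c ^ 2))) := by
  have hN' : (0:ℝ) < N := by exact_mod_cast hN
  set q : ℝ := (Fintype.card V : ℝ) with hq
  have hqpos : 0 < q := by rw [hq]; exact_mod_cast Fintype.card_pos
  set lam : ℝ := τ / (2 * N * c ^ 2) with hl
  have hl0 : 0 < lam := by positivity
  have hlc : lam * c ≤ 1 := by
    rw [hl, div_mul_eq_mul_div, div_le_one (by positivity)]
    nlinarith
  have key := mcd_exp (V := V) (lam * c) (by positivity) hlc N (fun x => - (lam * g x)) (by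
    intro x i v
    have : -(lam * g (Function.update x i v)) - -(lam * g x) =
      -(lam * (g (Function.update x i v) - g x)) := by ring
    rw [this, abs_neg, abs_mul, abs_of_pos hl0]
    exact mul_le_mul_of_nonneg_left (hg x i v) hl0.le)
  rw [← hq] at key
  have h1 : ((Finset.univ.filter (fun x => g x < B - τ)).card : ℝ) * Real.exp (-(lam * (B - τ)))
      ≤ ∑ x, Real.exp (-(lam * g x)) := by
    calc _ = ∑ x ∈ Finset.univ.filter (fun x => g x < B - τ), Real.exp (-(lam * (B - τ))) := by
            simp
      _ ≤ ∑ x ∈ Finset.univ.filter (fun x => g x < B - τ), Real.exp (-(lam * g x)) := by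
            refine Finset.sum_le_sum fun x hx => ?_
            have := (Finset.mem_filter.1 hx).2
            apply Real.exp_le_exp.2
            nlinarith
      _ ≤ _ := Finset.sum_le_sum_of_subset_of_nonneg (Finset.subset_univ _)
            (fun _ _ _ => (Real.exp_pos _).le)
  have h2 : (∑ x, -(lam * g x)) / q ^ N ≤ -(lam * B) := by
    rw [div_le_iff₀ (pow_pos hqpos N), Finset.sum_neg_distrib, ← Finset.mul_sum]
    nlinarith
  have h3 : ((Finset.univ.filter (fun x => g x < B - τ)).card : ℝ) * Real.exp (-(lam * (B - τ)))
      ≤ q ^ N * Real.exp (-(lam * B) + N * (lam * c) ^ 2) :=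
    (h1.trans key).trans (by gcongr)
  have h4 : (-(lam * B) + N * (lam * c) ^ 2) = (-(τ ^ 2 / (4 * N * c ^ 2))) + (-(lam * (B - τ))) := by
    rw [hl]; field_simp; ring
  rw [h4, Real.exp_add, ← mul_assoc] at h3
  exact le_of_mul_le_mul_right h3 (Real.exp_pos _)

open Classical in
/-- number of `G`-tuples in a box -/
noncomputable def boxCnt {ι E : Type*} [Fintype ι] (G : (ι → E) → Prop) (B : ι → Finset E) : ℕ :=
  ((Fintype.piFinset B).filter G).card

/-- density of `G` in a box -/
noncomputable def boxDens {ι E : Type*} [Fintype ι] (G : (ι → E) → Prop) (B : ι → Finset E) : ℝ :=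
  (boxCnt G B : ℝ) / ∏ i, ((B i).card : ℝ)

lemma boxCnt_le {ι E : Type*} [Fintype ι] (G : (ι → E) → Prop) (B : ι → Finset E) :
    (boxCnt G B : ℝ) ≤ ∏ i, ((B i).card : ℝ) := by
  classical
  have h : boxCnt G B ≤ ∏ i, (B i).card := by
    unfold boxCnt
    refine (Finset.card_filter_le _ _).trans ?_
    rw [show (Fintype.piFinset B).card = ∏ i, (B i).card by
      convert Fintype.card_piFinset B]
  exact_mod_cast h

lemma boxDens_nonneg {ι E : Type*} [Fintype ι] (G : (ι → E) → Prop) (B : ι → Finset E) :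
    0 ≤ boxDens G B := by unfold boxDens; positivity

lemma boxDens_le_one {ι E : Type*} [Fintype ι] (G : (ι → E) → Prop) (B : ι → Finset E) :
    boxDens G B ≤ 1 := by
  unfold boxDens
  exact div_le_one_of_le₀ (boxCnt_le G B) (by positivity)

lemma exists_equi {E : Type*} [DecidableEq E] (w : ℕ) : ∀ (K : ℕ) (B : Finset E), B.card = K * w →
    ∃ P : Fin K → Finset E, (∀ a, (P a).card = w) ∧ (∀ a b, a ≠ b → Disjoint (P a) (P b)) ∧
      Finset.univ.biUnion P = B := by
  intro K
  induction K with
  | zero =>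
    intro B hB
    refine ⟨fun _ => ∅, fun a => a.elim0, fun a => a.elim0, ?_⟩
    have : B = ∅ := by simpa using hB
    simp [this]
  | succ K ih =>
    intro B hB
    obtain ⟨U, hUB, hU⟩ := Finset.exists_subset_card_eq (s := B) (n := w) (by rw [hB]; nlinarith)
    obtain ⟨P, h1, h2, h3⟩ := ih (B \ U) (by
      rw [Finset.card_sdiff_of_subset hUB, hB, hU, Nat.succ_mul]; simp)
    have hd : ∀ a, Disjoint U (P a) := by
      intro a
      have : P a ⊆ B \ U := by
        rw [← h3]; exact Finset.subset_biUnion_of_mem P (Finset.mem_univ a)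
      exact Finset.disjoint_of_subset_right this Finset.disjoint_sdiff
    refine ⟨Fin.cons U P, ?_, ?_, ?_⟩
    · intro a; refine Fin.cases ?_ (fun a => ?_) a <;> simp [hU, h1]
    · intro a b
      refine Fin.cases ?_ (fun a => ?_) a <;> refine Fin.cases ?_ (fun b => ?_) b
      · simp
      · intro _; simpa using hd b
      · intro _; simpa using (hd a).symm
      · intro h; simpa using h2 a b (fun h' => h (by rw [h']))
    · ext x
      simp only [Finset.mem_biUnion, Finset.mem_univ, true_and, Fin.exists_fin_succ, Fin.cons_zero,
        Fin.cons_succ]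
      have : (∃ i, x ∈ P i) ↔ x ∈ B \ U := by rw [← h3]; simp
      rw [this, Finset.mem_sdiff]
      constructor
      · rintro (h | h)
        · exact hUB h
        · exact h.1
      · intro h; by_cases hx : x ∈ U <;> simp [hx, h]

lemma exists_equi' {E : Type*} [DecidableEq E] (w K : ℕ) (B U : Finset E)
    (hB : B.card = (K + 1) * w) (hUB : U ⊆ B) (hU : U.card = w) :
    ∃ P : Fin (K + 1) → Finset E, (∀ a, (P a).card = w) ∧
      (∀ a b, a ≠ b → Disjoint (P a) (P b)) ∧ Finset.univ.biUnion P = B ∧ P 0 = U := by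
  obtain ⟨P, h1, h2, h3⟩ := exists_equi w K (B \ U) (by
      rw [Finset.card_sdiff_of_subset hUB, hB, hU, Nat.succ_mul]; simp)
  have hd : ∀ a, Disjoint U (P a) := by
    intro a
    have : P a ⊆ B \ U := by
      rw [← h3]; exact Finset.subset_biUnion_of_mem P (Finset.mem_univ a)
    exact Finset.disjoint_of_subset_right this Finset.disjoint_sdiff
  refine ⟨Fin.cons U P, ?_, ?_, ?_, by simp⟩
  · intro a; refine Fin.cases ?_ (fun a => ?_) a <;> simp [hU, h1]
  · intro a b
    refine Fin.cases ?_ (fun a => ?_) a <;> refine Fin.cases ?_ (fun b => ?_) b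
    · simp
    · intro _; simpa using hd b
    · intro _; simpa using (hd a).symm
    · intro h; simpa using h2 a b (fun h' => h (by rw [h']))
  · ext x
    simp only [Finset.mem_biUnion, Finset.mem_univ, true_and, Fin.exists_fin_succ, Fin.cons_zero,
      Fin.cons_succ]
    have : (∃ i, x ∈ P i) ↔ x ∈ B \ U := by rw [← h3]; simp
    rw [this, Finset.mem_sdiff]
    constructor
    · rintro (h | h)
      · exact hUB h
      · exact h.1
    · intro h; by_cases hx : x ∈ U <;> simp [hx, h]

lemma boxCnt_partition {ι E : Type*} [Fintype ι] [DecidableEq ι] [DecidableEq E] {K : ℕ}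
    (G : (ι → E) → Prop)
    (B : ι → Finset E) (P : ι → Fin K → Finset E)
    (h2 : ∀ i a b, a ≠ b → Disjoint (P i a) (P i b)) (h3 : ∀ i, Finset.univ.biUnion (P i) = B i) :
    boxCnt G B = ∑ a : ι → Fin K, boxCnt G (fun i => P i (a i)) := by
  classical
  unfold boxCnt
  rw [← Finset.card_biUnion]
  · congr 1
    ext x
    simp only [Finset.mem_filter, Fintype.mem_piFinset, Finset.mem_biUnion, Finset.mem_univ,
      true_and]
    constructor
    · rintro ⟨hx, hG⟩
      have : ∀ i, ∃ a, x i ∈ P i a := by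
        intro i
        have := hx i
        rw [← h3 i] at this
        simpa using this
      choose a ha using this
      exact ⟨a, ha, hG⟩
    · rintro ⟨a, ha, hG⟩
      refine ⟨fun i => ?_, hG⟩
      rw [← h3 i]
      exact Finset.mem_biUnion.2 ⟨a i, Finset.mem_univ _, ha i⟩
  · intro a _ b _ hab
    obtain ⟨i, hi⟩ := Function.ne_iff.1 hab
    rw [Function.onFun, Finset.disjoint_left]
    intro x hx hx'
    simp only [Finset.mem_filter, Fintype.mem_piFinset] at hx hx'
    exact Finset.disjoint_left.1 (h2 i _ _ hi) (hx.1 i) (hx'.1 i)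

/-- A box is bad: dense but with a sparse equal-sized sub-box. -/
def BadBox {ι E : Type*} [Fintype ι] (G : (ι → E) → Prop) (w : ι → ℕ) (u : ℕ)
    (B : ι → Finset E) : Prop :=
  1 / 2 ≤ boxDens G B ∧ ∃ U : ι → Finset E, (∀ i, U i ⊆ B i ∧ (U i).card = w i * u) ∧
    boxDens G U < 1 / 4

open Classical in
lemma split_box {ι E : Type*} [Fintype ι] [DecidableEq ι] [DecidableEq E] (K : ℕ)
    (G : (ι → E) → Prop) (w : ι → ℕ) (hw : ∀ i, 0 < w i) (u : ℕ) (hu : 0 < u)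
    (B : ι → Finset E) (hB : ∀ i, (B i).card = w i * ((K + 1) * u)) :
    ∃ S : Fin (K + 1) → ι → Finset E,
      (∀ j i, S j i ⊆ B i ∧ (S j i).card = w i * u) ∧
      (∀ j j' i, j ≠ j' → Disjoint (S j i) (S j' i)) ∧
      ((K : ℝ) + 1) * (boxDens G B ^ 2 +
        if BadBox G w u B then (1 / 16) / ((K : ℝ) + 1) ^ Fintype.card ι else 0) ≤
        ∑ j, boxDens G (S j) ^ 2 := by
  classical
  -- choose the special sub-box
  obtain ⟨U, hU, hUd⟩ : ∃ U : ι → Finset E, (∀ i, U i ⊆ B i ∧ (U i).card = w i * u) ∧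
      (BadBox G w u B → boxDens G U < 1 / 4) := by
    by_cases hb : BadBox G w u B
    · obtain ⟨_, U, h1, h2⟩ := hb
      exact ⟨U, h1, fun _ => h2⟩
    · have : ∀ i, ∃ U ⊆ B i, U.card = w i * u := fun i =>
        Finset.exists_subset_card_eq (by rw [hB]; nlinarith [Nat.zero_le (w i * (K * u))])
      choose U h1 h2 using this
      exact ⟨U, fun i => ⟨h1 i, h2 i⟩, fun h => absurd h hb⟩
  have hP : ∀ i, ∃ P : Fin (K + 1) → Finset E, (∀ a, (P a).card = w i * u) ∧
      (∀ a b, a ≠ b → Disjoint (P a) (P b)) ∧ Finset.univ.biUnion P = B i ∧ P 0 = U i := fun i =>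
    exists_equi' (w i * u) K (B i) (U i) (by rw [hB]; ring) (hU i).1 (hU i).2
  choose P hP1 hP2 hP3 hP4 using hP
  set D : (ι → Fin (K + 1)) → ℝ := fun a => boxDens G (fun i => P i (a i)) with hD
  set d := boxDens G B with hd
  set KI : ℝ := ((K : ℝ) + 1) ^ Fintype.card ι with hKI
  have hKpos : (0 : ℝ) < (K : ℝ) + 1 := by positivity
  have hKIpos : 0 < KI := by positivity
  set vol : ℝ := ∏ i, ((w i * u : ℕ) : ℝ) with hvol
  have hvolpos : 0 < vol := Finset.prod_pos fun i _ => by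
    have := hw i
    exact_mod_cast Nat.mul_pos this hu
  have hsum : ∑ a, D a = KI * d := by
    have h := boxCnt_partition G B P hP2 hP3
    have hb : (∏ i, ((B i).card : ℝ)) = KI * vol := by
      rw [hKI, hvol, ← Finset.card_univ, ← Finset.prod_const, ← Finset.prod_mul_distrib]
      refine Finset.prod_congr rfl fun i _ => ?_
      rw [hB]; push_cast; ring
    have hDa : ∀ a, D a = (boxCnt G (fun i => P i (a i)) : ℝ) / vol := by
      intro a
      simp only [hD, boxDens, hvol, hP1]
    simp_rw [hDa]
    rw [← Finset.sum_div, hd, boxDens, hb, h]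
    push_cast
    field_simp
  have hcardI : ((Fintype.card (ι → Fin (K+1)) : ℕ) : ℝ) = KI := by
    rw [Fintype.card_fun, Fintype.card_fin]; push_cast; rfl
  have hsq : KI * d ^ 2 + (D (fun _ => 0) - d) ^ 2 ≤ ∑ a, D a ^ 2 := by
    have h1 : ∑ a, (D a - d) ^ 2 = ∑ a, D a ^ 2 - KI * d ^ 2 := by
      have : ∀ a, (D a - d) ^ 2 = D a ^ 2 - 2 * d * D a + d ^ 2 := fun a => by ring
      simp_rw [this]
      rw [Finset.sum_add_distrib, Finset.sum_sub_distrib, ← Finset.mul_sum, hsum]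
      simp only [Finset.sum_const, Finset.card_univ, nsmul_eq_mul, hcardI]
      ring
    have h2 : (D (fun _ => 0) - d) ^ 2 ≤ ∑ a, (D a - d) ^ 2 :=
      Finset.single_le_sum (f := fun a => (D a - d) ^ 2) (fun _ _ => sq_nonneg _)
        (Finset.mem_univ (fun _ : ι => (0 : Fin (K+1))))
    linarith
  have hD0 : D (fun _ => 0) = boxDens G U := by
    simp only [hD, hP4]
  set c : ℝ := if BadBox G w u B then (1 / 16) / KI else 0 with hc
  have hc' : KI * (d ^ 2 + c) ≤ ∑ a, D a ^ 2 := by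
    refine le_trans ?_ hsq
    rw [mul_add]
    gcongr
    rw [hc]
    split_ifs with hb
    · have h1 := hUd hb
      have h2 := hb.1
      rw [hD0]
      have : KI * (1 / 16 / KI) = 1 / 16 := by field_simp
      rw [this]
      nlinarith
    · simp; positivity
  -- average over shifts
  have hshift : ∑ b : ι → Fin (K+1), ∑ j : Fin (K+1), D (fun i => b i + j) ^ 2
      = ((K : ℝ) + 1) * ∑ a, D a ^ 2 := by
    rw [Finset.sum_comm]
    have : ∀ j : Fin (K+1), ∑ b : ι → Fin (K+1), D (fun i => b i + j) ^ 2 = ∑ a, D a ^ 2 := by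
      intro j
      exact Equiv.sum_comp (Equiv.addRight (fun _ : ι => j)) (fun a => D a ^ 2)
    simp_rw [this]
    simp
  obtain ⟨b, hb⟩ : ∃ b : ι → Fin (K+1),
      ((K : ℝ) + 1) * (d ^ 2 + c) ≤ ∑ j : Fin (K+1), D (fun i => b i + j) ^ 2 := by
    by_contra hcon
    push Not at hcon
    have : ∑ b : ι → Fin (K+1), ∑ j : Fin (K+1), D (fun i => b i + j) ^ 2
        < ∑ b : ι → Fin (K+1), ((K : ℝ) + 1) * (d ^ 2 + c) :=
      Finset.sum_lt_sum_of_nonempty Finset.univ_nonempty (fun b _ => hcon b)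
    rw [hshift] at this
    simp only [Finset.sum_const, Finset.card_univ, nsmul_eq_mul, hcardI] at this
    nlinarith
  refine ⟨fun j i => P i (b i + j), ?_, ?_, hb⟩
  · intro j i
    refine ⟨?_, hP1 _ _⟩
    rw [← hP3 i]
    exact Finset.subset_biUnion_of_mem (P i) (Finset.mem_univ _)
  · intro j j' i hj
    apply hP2
    intro h
    exact hj (add_left_cancel h)

/-- family of `N` disjoint boxes -/
def BoxFam {ι E : Type*} (X : ι → Finset E) (w : ι → ℕ) (u N : ℕ)
    (B : Fin N → ι → Finset E) : Prop :=
  (∀ b i, B b i ⊆ X i ∧ (B b i).card = w i * u) ∧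
    ∀ b b' i, b ≠ b' → Disjoint (B b i) (B b' i)

open Classical in
lemma step_fam {ι E : Type*} [Fintype ι] [DecidableEq ι] [DecidableEq E] (K : ℕ)
    (G : (ι → E) → Prop) (w : ι → ℕ) (hw : ∀ i, 0 < w i) (u : ℕ) (hu : 0 < u)
    (X : ι → Finset E) (N : ℕ) (B : Fin N → ι → Finset E) (hB : BoxFam X w ((K + 1) * u) N B) :
    ∃ B' : Fin (N * (K + 1)) → ι → Finset E, BoxFam X w u (N * (K + 1)) B' ∧
      ((K : ℝ) + 1) * (∑ b, boxDens G (B b) ^ 2 +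
        ((Finset.univ.filter (fun b => BadBox G w u (B b))).card : ℝ) *
          ((1 / 16) / ((K : ℝ) + 1) ^ Fintype.card ι)) ≤ ∑ b, boxDens G (B' b) ^ 2 := by
  classical
  have := fun b => split_box K G w hw u hu (B b) (fun i => (hB.1 b i).2)
  choose S h1 h2 h3 using this
  refine ⟨fun b => S (finProdFinEquiv.symm b).1 (finProdFinEquiv.symm b).2, ⟨?_, ?_⟩, ?_⟩
  · intro b i
    exact ⟨(h1 _ _ i).1.trans (hB.1 _ i).1, (h1 _ _ i).2⟩
  · intro b b' i hbb
    have hne : finProdFinEquiv.symm b ≠ finProdFinEquiv.symm b' :=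
      fun h => hbb (finProdFinEquiv.symm.injective h)
    by_cases h : (finProdFinEquiv.symm b).1 = (finProdFinEquiv.symm b').1
    · have h' : (finProdFinEquiv.symm b).2 ≠ (finProdFinEquiv.symm b').2 :=
        fun h'' => hne (Prod.ext h h'')
      change Disjoint (S _ _ i) (S _ _ i)
      rw [h]
      exact h2 _ _ _ i h'
    · exact Disjoint.mono (h1 _ _ i).1 (h1 _ _ i).1 (hB.2 _ _ i h)
  · rw [finProdFinEquiv.symm.sum_comp (fun p : Fin N × Fin (K+1) => boxDens G (S p.1 p.2) ^ 2),
      Fintype.sum_prod_type]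
    refine le_trans (le_of_eq ?_) (Finset.sum_le_sum fun b _ => h3 b)
    rw [← Finset.mul_sum, Finset.sum_add_distrib, ← Finset.sum_filter]
    simp

open Classical in
/-- main regularity statement -/
lemma regularity {ι E : Type*} [Fintype ι] [DecidableEq ι] [DecidableEq E] (K : ℕ)
    (ε : ℝ) (hε : 0 < ε) : ∃ D : ℕ, ∀ (G : (ι → E) → Prop) (w : ι → ℕ) (_ : ∀ i, 0 < w i) (u : ℕ)
    (_ : 0 < u) (X : ι → Finset E) (_ : ∀ i, (X i).card = w i * (u * (K + 1) ^ D))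
    (_ : 1 - ε ≤ boxDens G X),
    ∃ j < D, ∃ B : Fin ((K + 1) ^ j) → ι → Finset E,
      BoxFam X w ((K + 1) * (u * (K + 1) ^ (D - j - 1))) ((K + 1) ^ j) B ∧
      (1 - 4 * ε) * ((K : ℝ) + 1) ^ j ≤ ((Finset.univ.filter (fun b =>
        ∀ U : ι → Finset E, (∀ i, U i ⊆ B b i ∧
          (U i).card = w i * (u * (K + 1) ^ (D - j - 1))) → 1 / 4 ≤ boxDens G U)).card : ℝ) := by
  classical
  have hKpos : (0 : ℝ) < (K : ℝ) + 1 := by positivity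
  set c : ℝ := (1 / 16) / ((K : ℝ) + 1) ^ Fintype.card ι with hc
  have hcpos : 0 < c := by positivity
  obtain ⟨D, hD⟩ := exists_nat_gt ((1 + 2 * ε) / (c * ε))
  refine ⟨D, ?_⟩
  intro G w hw u hu X hX hdens
  by_contra hcon
  push Not at hcon
  have key : ∀ j ≤ D, ∃ B : Fin ((K + 1) ^ j) → ι → Finset E,
      BoxFam X w (u * (K + 1) ^ (D - j)) ((K + 1) ^ j) B ∧
      (1 - 2 * ε + j * (c * ε)) * ((K : ℝ) + 1) ^ j ≤ ∑ b, boxDens G (B b) ^ 2 := by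
    intro j
    induction j with
    | zero =>
      intro _
      refine ⟨fun _ => X, ⟨?_, ?_⟩, ?_⟩
      · intro b i; exact ⟨subset_rfl, by simpa using hX i⟩
      · intro b b' i h; exact absurd (Subsingleton.elim (α := Fin 1) b b') h
      · rw [Finset.sum_const, Finset.card_univ, Fintype.card_fin]
        simp only [pow_zero, one_smul, mul_one, Nat.cast_zero, zero_mul, add_zero]
        have h0 := boxDens_nonneg G X
        have h1 := boxDens_le_one G X
        nlinarith [sq_nonneg (1 - boxDens G X)]
    | succ j ih =>
      intro hj
      obtain ⟨B, hB, hE⟩ := ih (by omega)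
      have hpow : u * (K + 1) ^ (D - j) = (K + 1) * (u * (K + 1) ^ (D - j - 1)) := by
        have : D - j = (D - j - 1) + 1 := by omega
        conv_lhs => rw [this, pow_succ]
        ring
      rw [hpow] at hB
      have hlt := hcon j (by omega) B hB
      set u' := u * (K + 1) ^ (D - j - 1) with hu'
      have hu'pos : 0 < u' := by positivity
      obtain ⟨B', hB', hE'⟩ := step_fam K G w hw u' hu'pos X _ B hB
      have hcardN : ((K + 1) ^ j * (K + 1)) = (K + 1) ^ (j + 1) := (pow_succ _ _).symm
      -- count
      have hbad : ε * ((K : ℝ) + 1) ^ j ≤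
          ((Finset.univ.filter (fun b => BadBox G w u' (B b))).card : ℝ) := by
        by_contra hb
        push Not at hb
        set Fb := Finset.univ.filter (fun b => BadBox G w u' (B b))
        set Fl := Finset.univ.filter (fun b => boxDens G (B b) < 1 / 2)
        set Fg := Finset.univ.filter (fun b =>
          ∀ U : ι → Finset E, (∀ i, U i ⊆ B b i ∧ (U i).card = w i * u') → 1 / 4 ≤ boxDens G U)
        have hcov : (Finset.univ : Finset (Fin ((K + 1) ^ j))) ⊆ Fb ∪ (Fl ∪ Fg) := by
          intro b _
          simp only [Fb, Fl, Fg, Finset.mem_union, Finset.mem_filter, Finset.mem_univ, true_and]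
          by_cases h1 : boxDens G (B b) < 1 / 2
          · exact Or.inr (Or.inl h1)
          · by_cases h2 : BadBox G w u' (B b)
            · exact Or.inl h2
            · refine Or.inr (Or.inr ?_)
              intro U hU
              by_contra h3
              exact h2 ⟨not_lt.1 h1, U, hU, not_le.1 h3⟩
        have hcc := Finset.card_le_card hcov
        have hcc2 := hcc.trans ((Finset.card_union_le _ _).trans
          (Nat.add_le_add_left (Finset.card_union_le _ _) _))
        rw [Finset.card_univ, Fintype.card_fin] at hcc2
        have hcc3 : ((K : ℝ) + 1) ^ j ≤ (Fb.card : ℝ) + (Fl.card + Fg.card) := by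
          exact_mod_cast hcc2
        have hl : ∑ b, boxDens G (B b) ^ 2 ≤ ((K : ℝ) + 1) ^ j - (3 / 4) * Fl.card := by
          have : ∀ b, boxDens G (B b) ^ 2 ≤ 1 - (3 / 4) * (if boxDens G (B b) < 1 / 2 then 1 else 0) := by
            intro b
            have h0 := boxDens_nonneg G (B b)
            have h1 := boxDens_le_one G (B b)
            split_ifs with h
            · nlinarith
            · nlinarith
          refine (Finset.sum_le_sum fun b _ => this b).trans (le_of_eq ?_)
          rw [Finset.sum_sub_distrib, ← Finset.mul_sum, ← Finset.sum_filter]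
          simp [Fl]
        have hp : (0:ℝ) < ((K : ℝ) + 1) ^ j := by positivity
        have hjc : 0 ≤ (j : ℝ) * (c * ε) := by positivity
        have hjc2 := mul_nonneg hjc hp.le
        have h9 : (Fl.card : ℝ) ≤ (8 / 3) * ε * ((K : ℝ) + 1) ^ j := by nlinarith
        nlinarith
      have hcast : ∀ (N N' : ℕ) (_ : N = N') (B' : Fin N → ι → Finset E) , BoxFam X w u' N B' →
          ∃ B'' : Fin N' → ι → Finset E, BoxFam X w u' N' B'' ∧
            ∑ b, boxDens G (B'' b) ^ 2 = ∑ b, boxDens G (B' b) ^ 2 := by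
        intro N N' h B' hB'; subst h; exact ⟨B', hB', rfl⟩
      obtain ⟨B'', hB'', hs⟩ := hcast _ _ hcardN B' hB'
      refine ⟨B'', ?_, ?_⟩
      · have : D - (j + 1) = D - j - 1 := by omega
        rw [this]; exact hB''
      · rw [hs]
        refine le_trans ?_ hE'
        rw [pow_succ]
        push_cast
        have hh : ε * ((K : ℝ) + 1) ^ j * c ≤
          ((Finset.univ.filter (fun b => BadBox G w u' (B b))).card : ℝ) * c := by gcongr
        calc (1 - 2 * ε + ((j:ℝ) + 1) * (c * ε)) * (((K:ℝ) + 1) ^ j * ((K:ℝ) + 1))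
            = ((K:ℝ) + 1) * ((1 - 2 * ε + j * (c * ε)) * ((K : ℝ) + 1) ^ j
                + ε * ((K : ℝ) + 1) ^ j * c) := by ring
          _ ≤ _ := by gcongr
  obtain ⟨B, hB, hE⟩ := key D le_rfl
  have h1 : ∑ b, boxDens G (B b) ^ 2 ≤ ((K : ℝ) + 1) ^ D := by
    have : ∀ b, boxDens G (B b) ^ 2 ≤ 1 := fun b => by
      have h0 := boxDens_nonneg G (B b)
      have h1 := boxDens_le_one G (B b)
      nlinarith
    refine (Finset.sum_le_sum fun b _ => this b).trans (le_of_eq ?_)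
    simp
  rw [div_lt_iff₀ (by positivity)] at hD
  have hp : (0:ℝ) < ((K : ℝ) + 1) ^ D := by positivity
  have : (1 : ℝ) * ((K : ℝ) + 1) ^ D < (1 - 2 * ε + D * (c * ε)) * ((K : ℝ) + 1) ^ D := by
    apply mul_lt_mul_of_pos_right _ hp
    linarith
  linarith

lemma cleanup {s : ℕ} (hs : 0 < s) (Z : Fin s → Finset ℕ) (u : ℕ) (hu : 0 < u)
    (hZ : ∀ i, (Z i).card = u) (G : Finset (Fin s → ℕ)) (hG : G ⊆ Fintype.piFinset Z)
    (η : ℝ) (hη : 0 < η) (hcard : η * (u : ℝ) ^ s ≤ (G.card : ℝ)) :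
    ∃ F ⊆ G, F.Nonempty ∧ ∀ x ∈ F, ∀ i, η / (2 * s) * u ≤
      (((Z i).filter (fun v => Function.update x i v ∈ F)).card : ℝ) := by
  classical
  have hs' : (0:ℝ) < s := by exact_mod_cast hs
  have hu' : (0:ℝ) < u := by exact_mod_cast hu
  set θ : ℝ := η / (2 * s) * u with hθ
  have hθpos : 0 < θ := by positivity
  set proj : Fin s → Finset (Fin s → ℕ) → Finset (Fin s → ℕ) :=
    fun i F => F.image (fun x => Function.update x i 0) with hproj
  set Φ : Finset (Fin s → ℕ) → ℝ := fun F => (F.card : ℝ) - ∑ i, θ * ((proj i F).card : ℝ) with hΦ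
  have hprojcard : ∀ i, ((proj i G).card : ℝ) * u ≤ (u : ℝ) ^ s := by
    intro i
    have h1 : proj i G ⊆ Fintype.piFinset (Function.update Z i {0}) := by
      intro y hy
      simp only [hproj, Finset.mem_image] at hy
      obtain ⟨x, hx, rfl⟩ := hy
      have hx' := Fintype.mem_piFinset.1 (hG hx)
      rw [Fintype.mem_piFinset]
      intro j
      by_cases hj : j = i
      · subst hj; simp
      · simp [hj, hx' j]
    have h2 := Finset.card_le_card h1
    rw [Fintype.card_piFinset] at h2
    have h3 : ∏ j, (Function.update Z i {0} j).card = u ^ (s - 1) := by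
      have : (fun j => (Function.update Z i {0} j).card) = Function.update (fun _ => u) i 1 := by
        funext j
        by_cases hj : j = i
        · subst hj; simp
        · simp [hj, hZ]
      rw [this, Finset.prod_update_of_mem (Finset.mem_univ i)]
      simp [Finset.card_sdiff]
    rw [h3] at h2
    have h4 : (proj i G).card * u ≤ u ^ s := by
      calc (proj i G).card * u ≤ u ^ (s-1) * u := Nat.mul_le_mul_right _ h2
        _ = u ^ s := by rw [← pow_succ]; congr 1; omega
    exact_mod_cast h4
  have hΦG : 0 < Φ G := by
    have h1 : ∑ i, θ * ((proj i G).card : ℝ) ≤ ∑ _i : Fin s, η / (2 * s) * (u : ℝ) ^ s := by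
      refine Finset.sum_le_sum fun i _ => ?_
      rw [hθ, mul_assoc, mul_comm (u:ℝ)]
      exact mul_le_mul_of_nonneg_left (hprojcard i) (by positivity)
    have h2 : ∑ _i : Fin s, η / (2 * s) * (u : ℝ) ^ s = η * (u : ℝ) ^ s / 2 := by
      simp; field_simp
    have h3 : 0 < η * (u : ℝ) ^ s := by positivity
    simp only [hΦ]
    linarith
  obtain ⟨F, hF, hmax⟩ := Finset.exists_max_image G.powerset Φ ⟨G, Finset.mem_powerset_self G⟩
  have hFG := Finset.mem_powerset.1 hF
  refine ⟨F, hFG, ?_, ?_⟩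
  · rw [Finset.nonempty_iff_ne_empty]
    rintro rfl
    have := hmax G (Finset.mem_powerset_self G)
    simp [hΦ, hproj] at this
    simp [hΦ, hproj] at hΦG
    linarith
  · intro x hx i
    set Fb := F.filter (fun y => Function.update y i 0 = Function.update x i 0) with hFb
    have h1 := hmax (F \ Fb) (Finset.mem_powerset.2 (Finset.sdiff_subset.trans hFG))
    have hsub : Fb ⊆ F := Finset.filter_subset _ _
    have hc : ((F \ Fb).card : ℝ) = F.card - Fb.card := by
      rw [Finset.card_sdiff_of_subset hsub, Nat.cast_sub (Finset.card_le_card hsub)]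
    have hpi : ∀ j, ((proj j (F \ Fb)).card : ℝ) ≤ (proj j F).card - (if j = i then 1 else 0) := by
      intro j
      have hm : proj j (F \ Fb) ⊆ proj j F := Finset.image_subset_image Finset.sdiff_subset
      split_ifs with hj
      · subst hj
        have hss : proj j (F \ Fb) ⊆ (proj j F).erase (Function.update x j 0) := by
          intro y hy
          refine Finset.mem_erase.2 ⟨?_, hm hy⟩
          rintro rfl
          simp only [hproj, Finset.mem_image] at hy
          obtain ⟨z, hz, hz'⟩ := hy
          exact (Finset.mem_sdiff.1 hz).2 (Finset.mem_filter.2 ⟨(Finset.mem_sdiff.1 hz).1, hz'⟩)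
        have hmem : Function.update x j 0 ∈ proj j F := Finset.mem_image_of_mem _ hx
        have h2 := Finset.card_le_card hss
        have h3 := Finset.card_erase_add_one hmem
        have h4 : (proj j (F \ Fb)).card + 1 ≤ (proj j F).card := by omega
        have h5 : ((proj j (F \ Fb)).card : ℝ) + 1 ≤ (proj j F).card := by exact_mod_cast h4
        linarith
      · simpa using Finset.card_le_card hm
    have hsum : ∑ j, θ * ((proj j (F \ Fb)).card : ℝ) ≤ ∑ j, θ * ((proj j F).card : ℝ) - θ := by
      calc ∑ j, θ * ((proj j (F \ Fb)).card : ℝ)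
          ≤ ∑ j, θ * ((proj j F).card - (if j = i then 1 else 0)) :=
            Finset.sum_le_sum fun j _ => mul_le_mul_of_nonneg_left (hpi j) hθpos.le
        _ = _ := by
            simp_rw [mul_sub]
            rw [Finset.sum_sub_distrib]
            simp
    simp only [hΦ] at h1
    rw [hc] at h1
    have h2 : θ ≤ Fb.card := by linarith
    refine h2.trans ?_
    have h3 : Fb.card ≤ ((Z i).filter (fun v => Function.update x i v ∈ F)).card := by
      have hrec : ∀ y ∈ Fb, y = Function.update x i (y i) := by
        intro y hy
        have hy' := (Finset.mem_filter.1 hy).2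
        funext j
        by_cases hj : j = i
        · subst hj; simp
        · have := congrFun hy' j
          simpa [hj] using this
      refine Finset.card_le_card_of_injOn (fun y => y i) ?_ ?_
      · intro y hy
        have hyF := (Finset.mem_filter.1 hy).1
        refine Finset.mem_filter.2 ⟨Fintype.mem_piFinset.1 (hG (hFG hyF)) i, ?_⟩
        rw [← hrec y hy]; exact hyF
      · intro y hy y' hy' h
        rw [hrec y hy, hrec y' hy', show y i = y' i from h]
    exact_mod_cast h3

lemma path_build {s : ℕ} (Z : Fin s → Finset ℕ) (F : Finset (Fin s → ℕ)) (hne : F.Nonempty)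
    (hFZ : F ⊆ Fintype.piFinset Z)
    (θ : ℝ) (hF : ∀ x ∈ F, ∀ i, θ ≤
      (((Z i).filter (fun v => Function.update x i v ∈ F)).card : ℝ)) (ord : ℕ → Fin s) :
    ∀ L : ℕ, (L : ℝ) ≤ θ → ∃ (y : ℕ → ℕ) (x : ℕ → Fin s → ℕ),
      (∀ j ≤ L, x j ∈ F) ∧ (∀ j < L, x (j + 1) = Function.update (x j) (ord j) (y j)) ∧
      Set.InjOn y (Finset.range L) := by
  classical
  intro L
  induction L with
  | zero =>
    intro _
    obtain ⟨x, hx⟩ := hne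
    exact ⟨fun _ => 0, fun _ => x, fun _ _ => hx, by simp, by simp⟩
  | succ L ih =>
    intro hL
    push_cast at hL
    obtain ⟨y, x, h1, h2, h3⟩ := ih (by linarith)
    have h4 := hF (x L) (h1 L le_rfl) (ord L)
    set S := (Z (ord L)).filter (fun v => Function.update (x L) (ord L) v ∈ F) with hS
    have h5 : ((Finset.range L).image y).card < S.card := by
      have : ((Finset.range L).image y).card ≤ L := by
        simpa using Finset.card_image_le (s := Finset.range L) (f := y)
      have h6 : (L : ℝ) + 1 ≤ S.card := by linarith
      have h7 : L + 1 ≤ S.card := by exact_mod_cast h6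
      omega
    obtain ⟨v, hvS, hv⟩ := Finset.exists_mem_notMem_of_card_lt_card h5
    have hvF := (Finset.mem_filter.1 hvS).2
    refine ⟨Function.update y L v, Function.update x (L + 1) (Function.update (x L) (ord L) v),
      ?_, ?_, ?_⟩
    · intro j hj
      by_cases hj' : j = L + 1
      · subst hj'; simpa using hvF
      · rw [Function.update_of_ne hj']; exact h1 j (by omega)
    · intro j hj
      by_cases hj' : j = L
      · subst hj'
        rw [Function.update_self, Function.update_self, Function.update_of_ne (by omega)]
      · rw [Function.update_of_ne (by omega), Function.update_of_ne (by omega),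
          Function.update_of_ne hj']
        exact h2 j (by omega)
    · intro a ha b hb hab
      simp only [Finset.coe_range, Set.mem_Iio] at ha hb
      by_cases ha' : a = L <;> by_cases hb' : b = L
      · omega
      · subst ha'
        rw [Function.update_self, Function.update_of_ne hb'] at hab
        exact absurd (Finset.mem_image.2 ⟨b, Finset.mem_range.2 (by omega), hab.symm⟩) hv
      · subst hb'
        rw [Function.update_self, Function.update_of_ne ha'] at hab
        exact absurd (Finset.mem_image.2 ⟨a, Finset.mem_range.2 (by omega), hab⟩) hv
      · rw [Function.update_of_ne ha', Function.update_of_ne hb'] at hab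
        exact h3 (by simp; omega) (by simp; omega) hab

/-- path with windows -/
lemma tight_path {s : ℕ} (hs : 0 < s) (Z : Fin s → Finset ℕ) (u : ℕ) (hu : 0 < u)
    (hZ : ∀ i, (Z i).card = u) (G : Finset (Fin s → ℕ)) (hG : G ⊆ Fintype.piFinset Z)
    (η : ℝ) (hη : 0 < η) (hcard : η * (u : ℝ) ^ s ≤ (G.card : ℝ)) (ord : ℕ → Fin s)
    (hord : ∀ q r, q < r → r < q + s → ord r ≠ ord q) (L : ℕ) (hL : (L : ℝ) ≤ η / (2 * s) * u) :
    ∃ y : ℕ → ℕ, Set.InjOn y (Finset.range L) ∧ (∀ p < L, y p ∈ Z (ord p)) ∧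
      ∀ p, p + s ≤ L → ∃ x ∈ G, ∀ q, p ≤ q → q < p + s → x (ord q) = y q := by
  obtain ⟨F, hFG, hne, hF⟩ := cleanup hs Z u hu hZ G hG η hη hcard
  obtain ⟨y, x, h1, h2, h3⟩ := path_build Z F hne (hFG.trans hG) _ hF ord L hL
  refine ⟨y, h3, ?_, ?_⟩
  · intro p hp
    have := Fintype.mem_piFinset.1 (hG (hFG (h1 (p+1) (by omega)))) (ord p)
    rw [h2 p hp] at this
    simpa using this
  · intro p hp
    refine ⟨x (p + s), hFG (h1 _ hp), ?_⟩
    intro q hq hq'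
    have key : ∀ r, q + 1 + r ≤ q + s → q + 1 + r ≤ L → x (q + 1 + r) (ord q) = y q := by
      intro r
      induction r with
      | zero => intro _ hl; rw [Nat.add_zero, h2 q (by omega)]; simp
      | succ r ih =>
        intro ha hb
        rw [show q + 1 + (r + 1) = (q + 1 + r) + 1 by ring, h2 (q+1+r) (by omega),
          Function.update_of_ne (hord q (q+1+r) (by omega) (by omega)).symm]
        exact ih (by omega) (by omega)
    have := key (p + s - (q + 1)) (by omega) (by omega)
    rwa [show q + 1 + (p + s - (q + 1)) = p + s by omega] at this
/-- the canonical chain -/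
def chainP (g t : ℕ) (A : Finset (Finset ℕ)) : Finset (Finset ℕ) :=
  (Finset.range t).biUnion (fun q => A.image (fun e => e.image (· + q * g)))

lemma image_shift_shift (e : Finset ℕ) (a b : ℕ) :
    (e.image (· + a)).image (· + b) = e.image (· + (a + b)) := by
  rw [Finset.image_image]; congr 1; funext i; simp [add_assoc]

lemma image_shift_inj {e e' : Finset ℕ} {a : ℕ} (h : e.image (· + a) = e'.image (· + a)) : e = e' :=
  Finset.image_injective (add_left_injective a) h

lemma image_shift_subset {e : Finset ℕ} {a b : ℕ} (h : e.image (· + a) ⊆ Finset.range b) :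
    e ⊆ Finset.range (b - a) := by
  intro i hi
  have := h (Finset.mem_image_of_mem _ hi)
  simp only [Finset.mem_range] at this ⊢
  omega

lemma link_shift {k ℓ m : ℕ} {A : Finset (Finset ℕ)} (hA : IsHyperLink k ℓ m A) (j : ℕ) :
    ∀ e : Finset ℕ, e ⊆ Finset.range m → e.image (· + j * (m - ℓ)) ⊆ Finset.range m →
      (e ∈ A ↔ e.image (· + j * (m - ℓ)) ∈ A) := by
  induction j with
  | zero => intro e _ _; simp
  | succ j ih =>
    intro e he hej
    have h1 : e ⊆ Finset.range ℓ := by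
      intro i hi
      have := hej (Finset.mem_image_of_mem _ hi)
      simp only [Finset.mem_range, Nat.succ_mul] at this ⊢
      omega
    have h2 : e.image (· + (j+1) * (m - ℓ)) =
        (e.image (· + (m - ℓ))).image (· + j * (m - ℓ)) := by
      rw [image_shift_shift]; congr 1; funext i; ring
    rw [h2] at hej ⊢
    rw [hA.2.2 e h1]
    apply ih _ _ hej
    intro i hi
    have := hej (Finset.mem_image_of_mem _ hi)
    simp only [Finset.mem_range] at this ⊢
    omega

lemma chainP_isChain {k ℓ m : ℕ} {A : Finset (Finset ℕ)} (hA : IsHyperLink k ℓ m A) (t : ℕ) :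
    IsHyperAChain ℓ m t A (chainP (m - ℓ) t A) := by
  have hlm := hA.1
  refine ⟨?_, ?_, ?_⟩
  · intro f hf
    simp only [chainP, Finset.mem_biUnion, Finset.mem_range, Finset.mem_image] at hf
    obtain ⟨q, hq, e, he, rfl⟩ := hf
    intro i hi
    obtain ⟨i, hi', rfl⟩ := Finset.mem_image.1 hi
    have := Finset.mem_range.1 ((hA.2.1 e he).1 hi')
    simp only [Finset.mem_range]
    have h2 : (q + 1) * (m - ℓ) ≤ t * (m - ℓ) := Nat.mul_le_mul_right _ hq
    rw [Nat.succ_mul] at h2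
    rw [mul_comm (m - ℓ) t]
    omega
  · intro q hq e he
    constructor
    · intro h
      simp only [chainP, Finset.mem_biUnion, Finset.mem_range, Finset.mem_image]
      exact ⟨q, hq, e, h, rfl⟩
    · intro h
      simp only [chainP, Finset.mem_biUnion, Finset.mem_range, Finset.mem_image] at h
      obtain ⟨q', hq', e', he', heq⟩ := h
      have he'm := (hA.2.1 e' he').1
      rcases le_total q q' with h | h
      · obtain ⟨j, rfl⟩ := Nat.exists_eq_add_of_le h
        have h1 : e'.image (· + j * (m - ℓ)) = e := by
          apply image_shift_inj (a := q * (m - ℓ))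
          rw [image_shift_shift, ← heq]; congr 1; funext i; ring
        have := link_shift hA j e' he'm (by rw [h1]; exact he)
        rw [h1] at this
        exact this.1 he'
      · obtain ⟨j, rfl⟩ := Nat.exists_eq_add_of_le h
        have h1 : e.image (· + j * (m - ℓ)) = e' := by
          apply image_shift_inj (a := q' * (m - ℓ))
          rw [image_shift_shift, heq]; congr 1; funext i; ring
        have := link_shift hA j e he (by rw [h1]; exact he'm)
        rw [h1] at this
        exact this.2 he'
  · intro f hf
    simp only [chainP, Finset.mem_biUnion, Finset.mem_range, Finset.mem_image] at hf
    obtain ⟨q, hq, e, he, rfl⟩ := hf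
    exact ⟨q, hq, e, he, rfl⟩

lemma chainP_card {k ℓ m : ℕ} {A : Finset (Finset ℕ)} (hA : IsHyperLink k ℓ m A) (t : ℕ) :
    (chainP (m - ℓ) t A).card ≤ t * (A.card - (linkStart ℓ A).card) + (linkStart ℓ A).card := by
  classical
  have hsub : chainP (m - ℓ) t A ⊆ ((Finset.range t).biUnion (fun q =>
      (A \ linkStart ℓ A).image (fun e => e.image (· + q * (m - ℓ))))) ∪ linkStart ℓ A := by
    have key : ∀ q < t, ∀ e ∈ A, e.image (· + q * (m - ℓ)) ∈ ((Finset.range t).biUnion (fun q =>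
      (A \ linkStart ℓ A).image (fun e => e.image (· + q * (m - ℓ))))) ∪ linkStart ℓ A := by
      intro q
      induction q with
      | zero =>
        intro hq e he
        by_cases h : e ∈ linkStart ℓ A
        · simp [h]
        · apply Finset.mem_union_left
          simp only [Finset.mem_biUnion, Finset.mem_range, Finset.mem_image]
          exact ⟨0, hq, e, by simp [he, h], rfl⟩
      | succ q ih =>
        intro hq e he
        by_cases h : e ∈ linkStart ℓ A
        · have h1 := (hA.2.2 e (Finset.mem_filter.1 h).2).1 he
          have := ih (by omega) _ h1
          rw [image_shift_shift] at this
          rwa [show m - ℓ + q * (m - ℓ) = (q+1) * (m - ℓ) by ring] at this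
        · apply Finset.mem_union_left
          simp only [Finset.mem_biUnion, Finset.mem_range, Finset.mem_image]
          exact ⟨q+1, hq, e, by simp [he, h], rfl⟩
    intro f hf
    simp only [chainP, Finset.mem_biUnion, Finset.mem_range, Finset.mem_image] at hf
    obtain ⟨q, hq, e, he, rfl⟩ := hf
    exact key q hq e he
  refine (Finset.card_le_card hsub).trans ((Finset.card_union_le _ _).trans ?_)
  gcongr
  refine Finset.card_biUnion_le.trans ?_
  have : ∀ q ∈ Finset.range t, ((A \ linkStart ℓ A).image
      (fun e => e.image (· + q * (m - ℓ)))).card ≤ A.card - (linkStart ℓ A).card := by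
    intro q _
    refine Finset.card_image_le.trans ?_
    rw [Finset.card_sdiff_of_subset (show linkStart ℓ A ⊆ A from Finset.filter_subset _ _)]
  refine (Finset.sum_le_card_nsmul _ _ _ this).trans ?_
  simp

lemma linkStart_lt {k ℓ m : ℕ} {A : Finset (Finset ℕ)} (hA : IsHyperLink k ℓ m A) (hk : 1 ≤ k)
    (hlm : ℓ < m) (hne : A.Nonempty) : (linkStart ℓ A).card < A.card := by
  apply Finset.card_lt_card
  refine ⟨Finset.filter_subset _ _, ?_⟩
  intro hsub
  obtain ⟨e, he, hmax⟩ := Finset.exists_max_image A (fun e => ∑ i ∈ e, i) hne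
  have h1 := (Finset.mem_filter.1 (hsub he)).2
  have h2 := hmax _ ((hA.2.2 e h1).1 he)
  rw [Finset.sum_image (fun a _ b _ h => Nat.add_right_cancel h), Finset.sum_add_distrib] at h2
  simp only [Finset.sum_const, smul_eq_mul, (hA.2.1 e he).2] at h2
  have : 0 < k * (m - ℓ) := Nat.mul_pos hk (by omega)
  omega

lemma A_nonempty {k ℓ m d : ℕ} {A : Finset (Finset ℕ)}
    {δ : ℝ} (hδ : IsLeast {x : ℝ | HamThresholdProp k ℓ m d A x} δ) : A.Nonempty := by
  rw [Finset.nonempty_iff_ne_empty]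
  rintro rfl
  have : HamThresholdProp k ℓ m d ∅ (δ - 1) := by
    intro α' _
    refine ⟨0, fun n _ hdvd K _ _ => ?_⟩
    refine ⟨n / (m - ℓ), ∅, id, ⟨by simp, by simp, by simp⟩, Nat.mul_div_cancel' hdvd,
      fun a _ b _ h => h, by simp, by simp⟩
  have := hδ.2 this
  linarith
/-- position modulo `s` -/
def posn (s : ℕ) (hs : 0 < s) (i : ℕ) : Fin s := ⟨i % s, Nat.mod_lt _ hs⟩

/-- the tuple `x` carries a closed chain in the order `f` -/
def HamT (s τ g : ℕ) (hs : 0 < s) (A H : Finset (Finset ℕ)) (f : Equiv.Perm (Fin s))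
    (x : Fin s → ℕ) : Prop :=
  ∀ j < τ, ∀ e ∈ A, e.image (fun i => x (f (posn s hs (i + j * g)))) ∈ H

/-- coloured version; coordinate zero is the colour -/
def GStar (s τ g : ℕ) (hs : 0 < s) (A : Finset (Finset ℕ)) (H : ℕ → Finset (Finset ℕ))
    (x : Fin (s + 1) → ℕ) : Prop :=
  ∃ f, HamT s τ g hs A (H (x 0)) f (Fin.tail x)

/-- rainbow chain inside a box -/
def RChain (s L : ℕ) (hs : 0 < s) (P : Finset (Finset ℕ)) (H : ℕ → Finset (Finset ℕ))
    (U : Fin (s + 1) → Finset ℕ) (φ : ℕ → ℕ) (c : Finset ℕ → ℕ) : Prop :=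
  Set.InjOn φ (Finset.range L) ∧
  (∃ f : Equiv.Perm (Fin s), ∀ p < L, φ p ∈ U (f (posn s hs p)).succ) ∧
  Set.InjOn c P ∧ ∀ e ∈ P, c e ∈ U 0 ∧ e.image φ ∈ H (c e)

lemma posn_ne {s : ℕ} (hs : 0 < s) (q r : ℕ) (h1 : q < r) (h2 : r < q + s) :
    posn s hs r ≠ posn s hs q := by
  intro h
  have h' : r % s = q % s := congrArg Fin.val h
  have : s ∣ r - q := (Nat.modEq_iff_dvd' h1.le).1 (h'.symm)
  have := Nat.le_of_dvd (by omega) this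
  omega

lemma extract {s τ g ℓ m h r u : ℕ} (hs : 0 < s) (hsg : s = g * τ) (hms : m ≤ s) (hlm : ℓ ≤ m)
    (hr : 0 < r) (hu : 0 < u) (hτ : 0 < τ)
    (A : Finset (Finset ℕ)) (hAm : ∀ e ∈ A, e ⊆ Finset.range m)
    (H : ℕ → Finset (Finset ℕ)) (U : Fin (s + 1) → Finset ℕ) (hU0 : (U 0).card = r * u)
    (hU : ∀ i : Fin s, (U i.succ).card = u)
    (hdens : 1 / 4 ≤ boxDens (GStar s τ g hs A H) U)
    (η : ℝ) (hη : η = 1 / (4 * (Fintype.card (Equiv.Perm (Fin s)) : ℝ)))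
    (hh : (s : ℝ) * (h + 1) ≤ (η / 2) / (2 * s) * u)
    (hP : ((chainP g (τ * h) A).card : ℝ) ≤ (η / 2) * (r * u)) :
    ∃ φ c, RChain s (s * h + ℓ) hs (chainP g (τ * h) A) H U φ c := by
  classical
  have hηpos : 0 < η := by rw [hη]; have : 0 < Fintype.card (Equiv.Perm (Fin s)) := Fintype.card_pos
                           positivity
  have hr' : (0:ℝ) < r := by exact_mod_cast hr
  have hu' : (0:ℝ) < u := by exact_mod_cast hu
  set Q := Fintype.card (Equiv.Perm (Fin s)) with hQ
  have hQpos : (0:ℝ) < Q := by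
    have : 0 < Fintype.card (Equiv.Perm (Fin s)) := Fintype.card_pos
    exact_mod_cast this
  set Cf : Equiv.Perm (Fin s) → Finset (Fin (s+1) → ℕ) := fun f =>
    (Fintype.piFinset U).filter (fun x => HamT s τ g hs A (H (x 0)) f (Fin.tail x)) with hCf
  have hvol : (∏ i, ((U i).card : ℝ)) = (r * u) * (u : ℝ) ^ s := by
    rw [Fin.prod_univ_succ, hU0]
    simp [hU]
  have hcnt : (1 / 4) * ((r * u) * (u : ℝ) ^ s) ≤ (boxCnt (GStar s τ g hs A H) U : ℝ) := by
    unfold boxDens at hdens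
    rw [hvol, le_div_iff₀ (by positivity)] at hdens
    exact hdens
  have hle : boxCnt (GStar s τ g hs A H) U ≤ ∑ f, (Cf f).card := by
    refine le_trans (Finset.card_le_card ?_) Finset.card_biUnion_le
    intro x hx
    obtain ⟨hx1, f, hf⟩ := Finset.mem_filter.1 hx
    refine Finset.mem_biUnion.2 ⟨f, Finset.mem_univ _, Finset.mem_filter.2 ⟨?_, hf⟩⟩
    convert hx1
  obtain ⟨f, hf⟩ : ∃ f, η * ((r * u) * (u : ℝ) ^ s) ≤ ((Cf f).card : ℝ) := by
    by_contra hcon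
    push Not at hcon
    have h1 : ∑ f, ((Cf f).card : ℝ) < ∑ _f : Equiv.Perm (Fin s), η * ((r * u) * (u : ℝ) ^ s) :=
      Finset.sum_lt_sum_of_nonempty Finset.univ_nonempty (fun f _ => hcon f)
    rw [Finset.sum_const, Finset.card_univ, nsmul_eq_mul, ← hQ, hη] at h1
    have h2 : (boxCnt (GStar s τ g hs A H) U : ℝ) ≤ ∑ f, ((Cf f).card : ℝ) := by exact_mod_cast hle
    have h3 : (Q : ℝ) * (1 / (4 * Q) * ((r * u) * (u : ℝ) ^ s)) = (1/4) * ((r * u) * (u : ℝ) ^ s) := by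
      field_simp
    linarith
  set Z : Fin s → Finset ℕ := fun i => U i.succ with hZ
  set nn : (Fin s → ℕ) → Finset ℕ := fun y => (U 0).filter (fun c => HamT s τ g hs A (H c) f y)
    with hnn
  have hsum : (Cf f).card ≤ ∑ y ∈ Fintype.piFinset Z, (nn y).card := by
    rw [Finset.card_eq_sum_card_fiberwise (f := Fin.tail) (t := Fintype.piFinset Z)]
    · refine Finset.sum_le_sum fun y _ => ?_
      refine Finset.card_le_card_of_injOn (fun x => x 0) ?_ ?_
      · intro x hx
        obtain ⟨hx1, hx2⟩ := Finset.mem_filter.1 hx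
        obtain ⟨hx3, hx4⟩ := Finset.mem_filter.1 hx1
        refine Finset.mem_filter.2 ⟨Fintype.mem_piFinset.1 hx3 0, ?_⟩
        rw [← hx2]; exact hx4
      · intro x hx x' hx' h0
        have e1 := (Finset.mem_filter.1 hx).2
        have e2 := (Finset.mem_filter.1 hx').2
        rw [← Fin.cons_self_tail x, ← Fin.cons_self_tail x', e1, e2, show x 0 = x' 0 from h0]
    · intro x hx
      have := Fintype.mem_piFinset.1 (Finset.mem_filter.1 hx).1
      exact Fintype.mem_piFinset.2 fun i => this i.succ
  set G := (Fintype.piFinset Z).filter (fun y => (η / 2) * (r * u) ≤ ((nn y).card : ℝ)) with hG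
  have hZc : ((Fintype.piFinset Z).card : ℝ) = (u : ℝ) ^ s := by
    rw [Fintype.card_piFinset]; simp [hZ, hU]
  have hGcard : (η / 2) * (u : ℝ) ^ s ≤ (G.card : ℝ) := by
    have h1 : ((Cf f).card : ℝ) ≤ ∑ y ∈ Fintype.piFinset Z, ((nn y).card : ℝ) := by
      exact_mod_cast hsum
    have h2 : ∑ y ∈ Fintype.piFinset Z, ((nn y).card : ℝ) ≤
        ∑ y ∈ Fintype.piFinset Z, ((if (η / 2) * (r * u) ≤ ((nn y).card : ℝ) then (r * u : ℝ) else 0)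
          + (η / 2) * (r * u)) := by
      refine Finset.sum_le_sum fun y _ => ?_
      split_ifs with hc
      · have : (nn y).card ≤ r * u := by rw [← hU0]; exact Finset.card_filter_le _ _
        have h3 : ((nn y).card : ℝ) ≤ r * u := by exact_mod_cast this
        have : 0 ≤ (η / 2) * (r * u) := by positivity
        linarith
      · linarith [not_le.1 hc]
    rw [Finset.sum_add_distrib, ← Finset.sum_filter, ← hG] at h2
    simp only [Finset.sum_const, nsmul_eq_mul, hZc] at h2
    have h4 := hf.trans (h1.trans h2)
    have hru : (0:ℝ) < r * u := by positivity
    have h5 : (η / 2) * (u : ℝ) ^ s * (r * u) ≤ (G.card : ℝ) * (r * u) := by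
      nlinarith
    exact le_of_mul_le_mul_right h5 hru
  obtain ⟨y, hy1, hy2, hy3⟩ := tight_path hs Z u hu (fun i => hU i) G (Finset.filter_subset _ _)
    (η / 2) (by positivity) hGcard (fun p => f (posn s hs p))
    (fun q r h1 h2 h => posn_ne hs q r h1 h2 (f.injective h)) (s * (h + 1)) (by
      push_cast; exact hh)
  have hlL : s * h + ℓ ≤ s * (h + 1) := by rw [mul_add]; omega
  -- colours available
  have hcol : ∀ e' ∈ chainP g (τ * h) A, (chainP g (τ * h) A).card ≤
      ((U 0).filter (fun c => e'.image y ∈ H c)).card := by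
    intro e' he'
    simp only [chainP, Finset.mem_biUnion, Finset.mem_range, Finset.mem_image] at he'
    obtain ⟨q, hq, e, he, rfl⟩ := he'
    have hqs : q * g + s ≤ s * (h + 1) := by
      have h1 : q * g ≤ (τ * h) * g := Nat.mul_le_mul_right _ hq.le
      have h2 : (τ * h) * g = s * h := by rw [hsg]; ring
      rw [mul_add]; omega
    obtain ⟨x, hx, hxy⟩ := hy3 (q * g) hqs
    have hx2 := (Finset.mem_filter.1 hx).2
    have h3 : ((chainP g (τ * h) A).card : ℝ) ≤ ((nn x).card : ℝ) := hP.trans hx2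
    have h4 : (chainP g (τ * h) A).card ≤ (nn x).card := by exact_mod_cast h3
    refine h4.trans (Finset.card_le_card ?_)
    intro c hc
    obtain ⟨hc1, hc2⟩ := Finset.mem_filter.1 hc
    refine Finset.mem_filter.2 ⟨hc1, ?_⟩
    have h5 := hc2 (q % τ) (Nat.mod_lt _ hτ) e he
    rw [Finset.image_image]
    convert h5 using 1
    refine Finset.image_congr ?_
    intro i hi
    have him := Finset.mem_range.1 (hAm e he hi)
    have h6 := hxy (i + q * g) (by omega) (by omega)
    simp only [Function.comp]
    rw [← h6]
    congr 2
    apply Fin.ext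
    simp only [posn]
    have : i + q * g = i + q % τ * g + s * (q / τ) := by
      rw [hsg]
      have := Nat.mod_add_div q τ
      calc i + q * g = i + (q % τ + τ * (q / τ)) * g := by rw [this]
        _ = _ := by ring
    rw [this, Nat.add_mul_mod_self_left]
  have hall := (Finset.all_card_le_biUnion_card_iff_exists_injective
    (fun e' : {e' // e' ∈ chainP g (τ * h) A} =>
      (U 0).filter (fun c => e'.1.image y ∈ H c))).1 (by
      intro S
      rcases S.eq_empty_or_nonempty with rfl | ⟨e0, he0⟩
      · simp
      · have h1 : S.card ≤ (chainP g (τ * h) A).card := by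
          have := Finset.card_le_univ S
          simpa using this
        refine h1.trans ((hcol e0.1 e0.2).trans (Finset.card_le_card ?_))
        exact Finset.subset_biUnion_of_mem
          (fun e' : {e' // e' ∈ chainP g (τ * h) A} =>
            (U 0).filter (fun c => e'.1.image y ∈ H c)) he0)
  obtain ⟨c, hc1, hc2⟩ := hall
  refine ⟨y, fun e => if he : e ∈ chainP g (τ * h) A then c ⟨e, he⟩ else 0, ?_, ⟨f, ?_⟩, ?_, ?_⟩
  · intro a ha b hb hab
    simp only [Finset.coe_range, Set.mem_Iio] at ha hb
    exact hy1 (by simp; omega) (by simp; omega) hab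
  · intro p hp
    exact hy2 p (by omega)
  · intro a ha b hb hab
    have ha' : a ∈ chainP g (τ * h) A := ha
    have hb' : b ∈ chainP g (τ * h) A := hb
    simp only [ha', hb', dif_pos] at hab
    exact congrArg Subtype.val (hc1 hab)
  · intro e he
    simp only [he, dif_pos]
    exact Finset.mem_filter.1 (hc2 ⟨e, he⟩)

lemma rchain_mono {s L : ℕ} {hs : 0 < s} {P : Finset (Finset ℕ)} {H : ℕ → Finset (Finset ℕ)}
    {U B : Fin (s + 1) → Finset ℕ} (hUB : ∀ i, U i ⊆ B i) {φ : ℕ → ℕ} {c : Finset ℕ → ℕ}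
    (h : RChain s L hs P H U φ c) : RChain s L hs P H B φ c := by
  obtain ⟨h1, ⟨f, h2⟩, h3, h4⟩ := h
  exact ⟨h1, ⟨f, fun p hp => hUB _ (h2 p hp)⟩, h3, fun e he => ⟨hUB _ (h4 e he).1, (h4 e he).2⟩⟩

lemma rchain_side {s L h : ℕ} {hs : 0 < s} {P : Finset (Finset ℕ)} {H : ℕ → Finset (Finset ℕ)}
    {B : Fin (s + 1) → Finset ℕ} {φ : ℕ → ℕ} {c : Finset ℕ → ℕ}
    (hdisj : ∀ i j : Fin s, i ≠ j → Disjoint (B i.succ) (B j.succ)) (hL : L ≤ s * (h + 1))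
    (hc : RChain s L hs P H B φ c) (i : Fin s) :
    (B i.succ ∩ (Finset.range L).image φ).card ≤ h + 1 := by
  classical
  obtain ⟨h1, ⟨f, h2⟩, h3, h4⟩ := hc
  have : B i.succ ∩ (Finset.range L).image φ ⊆
      (Finset.range (h + 1)).image (fun j => φ ((f.symm i).val + s * j)) := by
    intro x hx
    obtain ⟨hx1, hx2⟩ := Finset.mem_inter.1 hx
    obtain ⟨p, hp, rfl⟩ := Finset.mem_image.1 hx2
    have hp := Finset.mem_range.1 hp
    have h5 : f (posn s hs p) = i := by
      by_contra hne
      exact Finset.disjoint_left.1 (hdisj _ _ hne) (h2 p hp) hx1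
    have h6 : f.symm i = posn s hs p := by rw [← h5]; simp
    refine Finset.mem_image.2 ⟨p / s, ?_, ?_⟩
    · rw [Finset.mem_range]
      exact Nat.div_lt_of_lt_mul (by omega)
    · show φ _ = φ p
      rw [h6]; simp only [posn]; rw [Nat.mod_add_div]
  exact (Finset.card_le_card this).trans (Finset.card_image_le.trans (by simp))

lemma greedy {s τ g ℓ m h r u K c₀ : ℕ} (hs : 0 < s) (hsg : s = g * τ) (hms : m ≤ s) (hlm : ℓ ≤ m)
    (hr : 0 < r) (hu : 0 < u) (hτ : 0 < τ) (hc₀ : 1 ≤ c₀)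
    (A : Finset (Finset ℕ)) (hAm : ∀ e ∈ A, e ⊆ Finset.range m)
    (H : ℕ → Finset (Finset ℕ)) (B : Fin (s + 1) → Finset ℕ)
    (hB0 : (B 0).card = r * ((K + 1) * u))
    (hB : ∀ i : Fin s, (B i.succ).card = (K + 1) * u)
    (hdisj : ∀ i j : Fin s, i ≠ j → Disjoint (B i.succ) (B j.succ))
    (hreg : ∀ U : Fin (s + 1) → Finset ℕ, (∀ i, U i ⊆ B i) → (U 0).card = r * u →
      (∀ i : Fin s, (U i.succ).card = u) → 1 / 4 ≤ boxDens (GStar s τ g hs A H) U)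
    (η : ℝ) (hη : η = 1 / (4 * (Fintype.card (Equiv.Perm (Fin s)) : ℝ)))
    (hh : (s : ℝ) * (h + 1) ≤ (η / 2) / (2 * s) * u)
    (hP : ((chainP g (τ * h) A).card : ℝ) ≤ (η / 2) * (r * u))
    (hPc : (chainP g (τ * h) A).card ≤ r * (h + c₀)) (Q : ℕ) (hQ : Q * (h + c₀) ≤ K * u) :
    ∃ (φ : ℕ → ℕ → ℕ) (c : ℕ → Finset ℕ → ℕ),
      (∀ q < Q, RChain s (s * h + ℓ) hs (chainP g (τ * h) A) H B (φ q) (c q)) ∧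
      ∀ q < Q, ∀ q' < Q, q ≠ q' →
        Disjoint ((Finset.range (s * h + ℓ)).image (φ q)) ((Finset.range (s * h + ℓ)).image (φ q')) ∧
        Disjoint ((chainP g (τ * h) A).image (c q)) ((chainP g (τ * h) A).image (c q')) := by
  classical
  set L := s * h + ℓ with hL
  set P := chainP g (τ * h) A with hPdef
  have hLs : L ≤ s * (h + 1) := by rw [hL, mul_add]; omega
  induction Q with
  | zero => exact ⟨fun _ _ => 0, fun _ _ => 0, by simp, by simp⟩
  | succ Q ih =>
    have hQ' : Q * (h + c₀) ≤ K * u := le_trans (Nat.mul_le_mul_right _ (Nat.le_succ Q)) hQ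
    obtain ⟨φ, c, h1, h2⟩ := ih hQ'
    set UV := (Finset.range Q).biUnion (fun q => (Finset.range L).image (φ q)) with hUV
    set UC := (Finset.range Q).biUnion (fun q => P.image (c q)) with hUC
    have hv : ∀ i : Fin s, u ≤ (B i.succ \ UV).card := by
      intro i
      have e1 : (B i.succ ∩ UV).card ≤ Q * (h + 1) := by
        rw [hUV, Finset.inter_biUnion]
        refine Finset.card_biUnion_le.trans ?_
        refine (Finset.sum_le_card_nsmul _ _ (h + 1) ?_).trans (by simp)
        intro q hq
        exact rchain_side hdisj hLs (h1 q (Finset.mem_range.1 hq)) i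
      have e2 := Finset.card_sdiff_add_card_inter (B i.succ) UV
      rw [hB i] at e2
      have e3 : Q * (h + 1) ≤ Q * (h + c₀) := Nat.mul_le_mul_left _ (by omega)
      have e4 : (K + 1) * u = K * u + u := by ring
      omega
    have hcU : r * u ≤ (B 0 \ UC).card := by
      have e1 : UC.card ≤ Q * (r * (h + c₀)) := by
        rw [hUC]
        refine Finset.card_biUnion_le.trans ?_
        refine (Finset.sum_le_card_nsmul _ _ (r * (h + c₀)) ?_).trans (by simp)
        intro q hq
        exact Finset.card_image_le.trans hPc
      have e2 := Finset.le_card_sdiff UC (B 0)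
      rw [hB0] at e2
      have e3 : Q * (r * (h + c₀)) ≤ r * (K * u) := by
        calc Q * (r * (h + c₀)) = r * (Q * (h + c₀)) := by ring
          _ ≤ _ := Nat.mul_le_mul_left _ hQ'
      have e4 : r * ((K + 1) * u) = r * (K * u) + r * u := by ring
      omega
    choose V hV1 hV2 using fun i => Finset.exists_subset_card_eq (hv i)
    obtain ⟨C, hC1, hC2⟩ := Finset.exists_subset_card_eq hcU
    set U : Fin (s + 1) → Finset ℕ := Fin.cons C V with hU
    have hU0 : U 0 = C := rfl
    have hUs : ∀ i : Fin s, U i.succ = V i := fun i => rfl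
    have hUB : ∀ i, U i ⊆ B i := by
      intro i
      refine Fin.cases ?_ ?_ i
      · rw [hU0]; exact hC1.trans Finset.sdiff_subset
      · intro i; rw [hUs]; exact (hV1 i).trans Finset.sdiff_subset
    obtain ⟨φ', c', hr'⟩ := extract hs hsg hms hlm hr hu hτ A hAm H U (by rw [hU0, hC2])
      (fun i => by rw [hUs, hV2])
      (hreg U hUB (by rw [hU0, hC2]) (fun i => by rw [hUs, hV2])) η hη hh hP
    have hnV : ∀ q < Q, Disjoint ((Finset.range L).image φ') ((Finset.range L).image (φ q)) := by
      intro q hq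
      rw [Finset.disjoint_left]
      intro x hx hx'
      obtain ⟨p, hp, rfl⟩ := Finset.mem_image.1 hx
      obtain ⟨f, hf⟩ := hr'.2.1
      have h5 := hf p (Finset.mem_range.1 hp)
      rw [hUs] at h5
      exact (Finset.mem_sdiff.1 (hV1 _ h5)).2
        (Finset.mem_biUnion.2 ⟨q, Finset.mem_range.2 hq, hx'⟩)
    have hnC : ∀ q < Q, Disjoint (P.image c') (P.image (c q)) := by
      intro q hq
      rw [Finset.disjoint_left]
      intro x hx hx'
      obtain ⟨e, he, rfl⟩ := Finset.mem_image.1 hx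
      have h5 := (hr'.2.2.2 e he).1
      exact (Finset.mem_sdiff.1 (hC1 h5)).2
        (Finset.mem_biUnion.2 ⟨q, Finset.mem_range.2 hq, hx'⟩)
    refine ⟨Function.update φ Q φ', Function.update c Q c', ?_, ?_⟩
    · intro q hq
      by_cases hqQ : q = Q
      · subst hqQ; simp only [Function.update_self]; exact rchain_mono hUB hr'
      · simp only [Function.update_of_ne hqQ]; exact h1 q (by omega)
    · intro q hq q' hq' hne
      by_cases hqQ : q = Q
      · subst hqQ
        simp only [Function.update_self, Function.update_of_ne hne.symm]
        exact ⟨hnV q' (by omega), hnC q' (by omega)⟩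
      · by_cases hqQ' : q' = Q
        · subst hqQ'
          simp only [Function.update_self, Function.update_of_ne hne]
          exact ⟨(hnV q (by omega)).symm, (hnC q (by omega)).symm⟩
        · simp only [Function.update_of_ne hqQ, Function.update_of_ne hqQ']
          exact h2 q (by omega) q' (by omega) hne

/-- image of a position set -/
def imS {s n : ℕ} (x : Fin s → Fin n) (S : Finset (Fin s)) : Finset ℕ := S.image (fun i => (x i : ℕ))

/-- number of `q`-sets of positions outside `S` completing `Y` -/
def gcnt {s n : ℕ} (H : Finset (Finset ℕ)) (Y : Finset ℕ) (S : Finset (Fin s)) (q : ℕ)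
    (x : Fin s → Fin n) : ℕ :=
  ((Finset.powersetCard q (Finset.univ \ S)).filter (fun R => Y ∪ imS x R ∈ H)).card

lemma shift_mean {V : Type*} [AddCommGroup V] [Fintype V] [DecidableEq V] {s q : ℕ}
    (φ : Fin q ↪ Fin s) (F : (Fin q → V) → ℝ) :
    (Fintype.card V : ℝ) ^ q * ∑ x : Fin s → V, F (x ∘ φ) =
      (Fintype.card V : ℝ) ^ s * ∑ z, F z := by
  have h1 : ∀ z : Fin q → V, ∑ x : Fin s → V, F (x ∘ φ) = ∑ x : Fin s → V, F (x ∘ φ + z) := by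
    intro z
    rw [← Equiv.sum_comp (Equiv.addRight (Function.extend φ z 0)) (fun x : Fin s → V => F (x ∘ φ))]
    refine Finset.sum_congr rfl fun x _ => ?_
    congr 1
    funext i
    simp [φ.injective.extend_apply]
  have h2 : ∑ z : Fin q → V, ∑ x : Fin s → V, F (x ∘ φ) =
      ∑ x : Fin s → V, ∑ z : Fin q → V, F z := by
    rw [Finset.sum_congr rfl (fun z _ => h1 z), Finset.sum_comm]
    refine Finset.sum_congr rfl fun x _ => ?_
    exact Equiv.sum_comp (Equiv.addLeft (x ∘ φ)) F
  simpa using h2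

lemma ext_count {n k d q : ℕ} (H : Finset (Finset ℕ))
    (hH : ∀ e ∈ H, e ⊆ Finset.range n ∧ e.card = k) (Y : Finset ℕ) (hY : Y.card = d) (hq : q = k - d) :
    q.factorial * (H.filter (fun e => Y ⊆ e)).card ≤
      (Finset.univ.filter (fun z : Fin q → Fin n => Y ∪ imS z Finset.univ ∈ H)).card := by
  classical
  have h0 : ∀ e ∈ H.filter (fun e => Y ⊆ e), q.factorial ≤
      ((Finset.univ.filter (fun z : Fin q → Fin n => Y ∪ imS z Finset.univ ∈ H)).filter
        (fun z => Y ∪ imS z Finset.univ = e)).card := by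
    intro e he
    obtain ⟨he, hYe⟩ := Finset.mem_filter.1 he
    obtain ⟨hen, hek⟩ := hH e he
    have hc : (e \ Y).card = q := by rw [Finset.card_sdiff_of_subset hYe, hek, hY, hq]
    have hlt : ∀ i, (e \ Y).orderEmbOfFin hc i < n := fun i =>
      Finset.mem_range.1 (hen (Finset.sdiff_subset (Finset.orderEmbOfFin_mem _ hc i)))
    set f : Fin q → Fin n := fun i => ⟨(e \ Y).orderEmbOfFin hc i, hlt i⟩ with hf
    have hfinj : Function.Injective f := by
      intro i j hij
      have := congrArg Fin.val hij
      exact ((e \ Y).orderEmbOfFin hc).injective this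
    have him : ∀ σ : Equiv.Perm (Fin q), imS (f ∘ σ) Finset.univ = e \ Y := by
      intro σ
      unfold imS
      have : (fun i => ((f ∘ σ) i : ℕ)) = (fun i => (e \ Y).orderEmbOfFin hc i) ∘ σ := by
        funext i; rfl
      rw [this, ← Finset.image_image, Finset.image_univ_equiv]
      exact Finset.image_orderEmbOfFin_univ _ hc
    have hu : Y ∪ (e \ Y) = e := Finset.union_sdiff_of_subset hYe
    rw [show q.factorial = (Finset.univ : Finset (Equiv.Perm (Fin q))).card by
      rw [Finset.card_univ, Fintype.card_perm, Fintype.card_fin]]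
    refine Finset.card_le_card_of_injOn (fun σ => f ∘ σ) ?_ ?_
    · intro σ _
      simp only [Finset.coe_filter, Set.mem_setOf_eq, Finset.mem_filter, Finset.mem_univ, true_and]
      rw [him, hu]; exact ⟨he, rfl⟩
    · intro σ _ σ' _ h
      ext i
      exact congrArg Fin.val (hfinj (congrFun h i))
  rw [mul_comm, ← smul_eq_mul]
  refine (Finset.card_nsmul_le_sum _ _ _ h0).trans ?_
  rw [← Finset.card_eq_sum_card_fiberwise (f := fun z : Fin q → Fin n => Y ∪ imS z Finset.univ)]
  intro z hz
  have := (Finset.mem_filter.1 hz).2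
  exact Finset.mem_filter.2 ⟨this, Finset.subset_union_left⟩

lemma gcnt_mean {n k d q s : ℕ} (hn : 0 < n) (H : Finset (Finset ℕ))
    (hH : ∀ e ∈ H, e ⊆ Finset.range n ∧ e.card = k) (Y : Finset ℕ) (hY : Y.card = d) (hq : q = k - d)
    (S : Finset (Fin s)) (hS : S.card = d) (β : ℝ)
    (hdeg : β * (n : ℝ) ^ q ≤ ((H.filter (fun e => Y ⊆ e)).card : ℝ)) :
    ((s - d).descFactorial q : ℝ) * β * (n : ℝ) ^ s ≤ ∑ x : Fin s → Fin n, (gcnt H Y S q x : ℝ) := by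
  classical
  haveI : NeZero n := ⟨hn.ne'⟩
  have hn' : (0 : ℝ) < (n : ℝ) ^ q := by positivity
  set N := (Finset.univ.filter (fun z : Fin q → Fin n => Y ∪ imS z Finset.univ ∈ H)).card with hN
  have h1 : ∀ R ∈ Finset.powersetCard q (Finset.univ \ S),
      (n : ℝ) ^ q * ∑ x : Fin s → Fin n, (if Y ∪ imS x R ∈ H then (1:ℝ) else 0) = (n : ℝ) ^ s * N := by
    intro R hR
    have hRc := (Finset.mem_powersetCard.1 hR).2
    have := shift_mean (V := Fin n) (R.orderEmbOfFin hRc).toEmbedding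
      (fun z => if Y ∪ imS z Finset.univ ∈ H then (1:ℝ) else 0)
    rw [Fintype.card_fin] at this
    rw [hN, Finset.card_filter]
    push_cast
    rw [← this]
    congr 1
    refine Finset.sum_congr rfl fun x _ => ?_
    have e : imS (x ∘ (R.orderEmbOfFin hRc).toEmbedding) Finset.univ = imS x R := by
      unfold imS
      have e2 : (Finset.univ : Finset (Fin q)).image (R.orderEmbOfFin hRc) = R :=
        Finset.image_orderEmbOfFin_univ _ hRc
      conv_rhs => rw [← e2]
      rw [Finset.image_image]; rfl
    rw [e]
  have h2 : (n : ℝ) ^ q * ∑ x : Fin s → Fin n, (gcnt H Y S q x : ℝ) =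
      ((s - d).choose q : ℝ) * ((n : ℝ) ^ s * N) := by
    have : ∀ x : Fin s → Fin n, (gcnt H Y S q x : ℝ) =
        ∑ R ∈ Finset.powersetCard q (Finset.univ \ S), (if Y ∪ imS x R ∈ H then (1:ℝ) else 0) := by
      intro x; unfold gcnt; rw [Finset.card_filter]; push_cast; rfl
    simp only [this]
    rw [Finset.sum_comm, Finset.mul_sum, Finset.sum_congr rfl h1, Finset.sum_const,
      Finset.card_powersetCard, Finset.card_sdiff_of_subset (Finset.subset_univ _), hS, Finset.card_univ,
      Fintype.card_fin, nsmul_eq_mul]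
  have h3 : (q.factorial : ℝ) * (H.filter (fun e => Y ⊆ e)).card ≤ N := by
    exact_mod_cast ext_count (n := n) H hH Y hY hq
  refine le_of_mul_le_mul_left ?_ hn'
  rw [h2, Nat.descFactorial_eq_factorial_mul_choose]
  push_cast
  have h4 : (q.factorial : ℝ) * (β * (n : ℝ) ^ q) ≤ N :=
    (mul_le_mul_of_nonneg_left hdeg (by positivity)).trans h3
  have h5 : (0:ℝ) ≤ ((s - d).choose q : ℝ) * (n : ℝ) ^ s := by positivity
  nlinarith [mul_le_mul_of_nonneg_left h4 h5]

lemma gcnt_lip {n q s : ℕ} (hq : 1 ≤ q) (H : Finset (Finset ℕ)) (Y : Finset ℕ)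
    (S : Finset (Fin s)) (x : Fin s → Fin n) (i : Fin s) (v : Fin n) :
    |(gcnt H Y S q (Function.update x i v) : ℝ) - gcnt H Y S q x| ≤ (s : ℝ) ^ (q - 1) := by
  classical
  have key : ∀ x y : Fin s → Fin n, (∀ j, j ≠ i → x j = y j) →
      gcnt H Y S q x ≤ gcnt H Y S q y + s ^ (q - 1) := by
    intro x y hxy
    unfold gcnt
    have hb : ((Finset.powersetCard q (Finset.univ : Finset (Fin s))).filter (fun R => i ∈ R)).card
        ≤ s ^ (q - 1) := by
      calc _ ≤ (Finset.powersetCard (q - 1) (Finset.univ : Finset (Fin s))).card := by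
            refine Finset.card_le_card_of_injOn (fun R => R.erase i) ?_ ?_
            · intro R hR
              obtain ⟨h1, h2⟩ := Finset.mem_filter.1 hR
              refine Finset.mem_powersetCard.2 ⟨Finset.subset_univ _, ?_⟩
              show (R.erase i).card = _
              rw [Finset.card_erase_of_mem h2, (Finset.mem_powersetCard.1 h1).2]
            · intro R hR R' hR' h
              have h2 := (Finset.mem_filter.1 hR).2
              have h2' := (Finset.mem_filter.1 hR').2
              rw [← Finset.insert_erase h2, ← Finset.insert_erase h2']
              exact congrArg (insert i) h
        _ ≤ _ := by
            rw [Finset.card_powersetCard, Finset.card_univ, Fintype.card_fin]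
            exact Nat.choose_le_pow _ _
    refine le_trans ?_ (Nat.add_le_add_left hb _)
    refine le_trans (Finset.card_le_card ?_) (Finset.card_union_le _ _)
    intro R hR
    obtain ⟨h1, h2⟩ := Finset.mem_filter.1 hR
    rw [Finset.mem_union]
    by_cases hi : i ∈ R
    · right
      exact Finset.mem_filter.2 ⟨Finset.mem_powersetCard.2
        ⟨Finset.subset_univ _, (Finset.mem_powersetCard.1 h1).2⟩, hi⟩
    · left
      refine Finset.mem_filter.2 ⟨h1, ?_⟩
      have : imS y R = imS x R := by
        unfold imS
        refine Finset.image_congr ?_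
        intro j hj
        have : j ≠ i := fun h => hi (h ▸ hj)
        simp only [hxy j this]
      rw [this]; exact h2
  have a1 := key (Function.update x i v) x (fun j hj => Function.update_of_ne hj _ _)
  have a2 := key x (Function.update x i v) (fun j hj => (Function.update_of_ne hj _ _).symm)
  have a1' : (gcnt H Y S q (Function.update x i v) : ℝ) ≤ gcnt H Y S q x + (s:ℝ) ^ (q - 1) := by
    exact_mod_cast a1
  have a2' : (gcnt H Y S q x : ℝ) ≤ gcnt H Y S q (Function.update x i v) + (s:ℝ) ^ (q - 1) := by
    exact_mod_cast a2
  rw [abs_le]; constructor <;> linarith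

lemma gcnt_congr {n q s : ℕ} (H : Finset (Finset ℕ)) (Y : Finset ℕ)
    (S : Finset (Fin s)) (x y : Fin s → Fin n) (h : ∀ i, i ∉ S → x i = y i) :
    gcnt H Y S q x = gcnt H Y S q y := by
  classical
  unfold gcnt
  congr 1
  refine Finset.filter_congr ?_
  intro R hR
  have : imS x R = imS y R := by
    unfold imS
    refine Finset.image_congr ?_
    intro j hj
    have := (Finset.mem_powersetCard.1 hR).1 hj
    simp only [h j (Finset.mem_sdiff.1 this).2]
  rw [this]

open Classical in
lemma decouple {V : Type*} [Fintype V] {s : ℕ} (S : Finset (Fin s))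
    (P : (Fin s → V) → (Fin s → V) → Prop)
    (hP : ∀ y y' x x', (∀ i ∈ S, y i = y' i) → (∀ i, i ∉ S → x i = x' i) → (P y x ↔ P y' x'))
    (b : ℝ) (hb : ∀ y, ((Finset.univ.filter (fun x => P y x)).card : ℝ) ≤ b) [Nonempty V] :
    ((Finset.univ.filter (fun x => P x x)).card : ℝ) ≤ b := by
  have h1 : (Finset.univ.filter (fun w : (Fin s → V) × (Fin s → V) => P w.1 w.1)).card ≤
      (Finset.univ.filter (fun w : (Fin s → V) × (Fin s → V) => P w.1 w.2)).card := by
    refine Finset.card_le_card_of_injOn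
      (fun w => (S.piecewise w.1 w.2, S.piecewise w.2 w.1)) ?_ ?_
    · intro w hw
      simp only [Finset.coe_filter, Set.mem_setOf_eq, Finset.mem_univ, true_and] at hw ⊢
      refine (hP _ _ _ _ ?_ ?_).1 hw
      · intro i hi; simp [hi]
      · intro i hi; simp [hi]
    · intro w _ w' _ h
      have ha := congrArg Prod.fst h
      have hb := congrArg Prod.snd h
      refine Prod.ext ?_ ?_
      · funext i
        have a := congrFun ha i
        have b := congrFun hb i
        by_cases hi : i ∈ S <;> simp [hi] at a b <;> assumption
      · funext i
        have a := congrFun ha i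
        have b := congrFun hb i
        by_cases hi : i ∈ S <;> simp [hi] at a b <;> assumption
  have e1 : (Finset.univ.filter (fun w : (Fin s → V) × (Fin s → V) => P w.1 w.1)).card =
      (Finset.univ.filter (fun x => P x x)).card * Fintype.card (Fin s → V) := by
    rw [← Finset.card_univ, ← Finset.card_product]
    congr 1
    ext w; simp
  have e2 : (Finset.univ.filter (fun w : (Fin s → V) × (Fin s → V) => P w.1 w.2)).card =
      ∑ y, (Finset.univ.filter (fun x => P y x)).card := by
    simp only [Finset.card_filter]
    rw [Fintype.sum_prod_type]
  rw [e1, e2] at h1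
  have h2 : ((Finset.univ.filter (fun x => P x x)).card : ℝ) * Fintype.card (Fin s → V) ≤
      Fintype.card (Fin s → V) * b := by
    calc _ ≤ ∑ y, ((Finset.univ.filter (fun x => P y x)).card : ℝ) := by exact_mod_cast h1
      _ ≤ ∑ y : Fin s → V, b := Finset.sum_le_sum fun y _ => hb y
      _ = _ := by simp
  have h3 : (0:ℝ) < Fintype.card (Fin s → V) := by exact_mod_cast Fintype.card_pos
  rw [mul_comm] at h2
  exact le_of_mul_le_mul_left h2 h3

lemma ham_of_gcnt {k ℓ m d n s τ q : ℕ} (hs : 0 < s) (hlm : ℓ < m) (hdk : d ≤ k) (hq : q = k - d)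
    (hsτ : s = (m - ℓ) * τ) (A H : Finset (Finset ℕ)) (hA : IsHyperLink k ℓ m A) (θ : ℝ)
    (hthr : ∀ K : Finset (Finset ℕ), (∀ e ∈ K, e ⊆ Finset.range s ∧ e.card = k) →
      (∀ S ⊆ Finset.range s, S.card = d →
        θ * (s : ℝ) ^ (k - d) ≤ ((K.filter (fun e => S ⊆ e)).card : ℝ)) →
      ContainsHamACycle ℓ m s A K)
    (x : Fin s → Fin n)
    (hg : ∀ S : Finset (Fin s), S.card = d → θ * (s : ℝ) ^ q ≤ (gcnt H (imS x S) S q x : ℝ)) :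
    ∃ f, HamT s τ (m - ℓ) hs A H f (fun i => (x i : ℕ)) := by
  classical
  set K : Finset (Finset ℕ) :=
    ((Finset.powersetCard k (Finset.univ : Finset (Fin s))).filter (fun e => imS x e ∈ H)).image
      (fun e => e.map Fin.valEmbedding) with hK
  have hKmem : ∀ e, e ∈ K ↔ ∃ e' : Finset (Fin s), (e'.card = k ∧ imS x e' ∈ H) ∧
      e'.map Fin.valEmbedding = e := by
    intro e; simp [hK]
  obtain ⟨t, C, f, hcyc, hts, hfi, hfim, hfK⟩ := hthr K (by
    intro e he
    obtain ⟨e', ⟨h1, h2⟩, rfl⟩ := (hKmem e).1 he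
    refine ⟨?_, by rw [Finset.card_map, h1]⟩
    intro i hi
    obtain ⟨j, _, rfl⟩ := Finset.mem_map.1 hi
    exact Finset.mem_range.2 j.2) (by
    intro S0 hS0 hS0c
    set S : Finset (Fin s) := S0.attachFin (fun i hi => Finset.mem_range.1 (hS0 hi)) with hS
    have hSc : S.card = d := by rw [hS, Finset.card_attachFin, hS0c]
    have hSm : S.map Fin.valEmbedding = S0 := by
      ext i
      simp only [Finset.mem_map, hS, Finset.mem_attachFin, Fin.valEmbedding_apply]
      constructor
      · rintro ⟨a, ha, rfl⟩; exact ha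
      · intro hi; exact ⟨⟨i, Finset.mem_range.1 (hS0 hi)⟩, hi, rfl⟩
    rw [← hq]
    refine (hg S hSc).trans ?_
    norm_cast
    unfold gcnt
    refine Finset.card_le_card_of_injOn (fun R => (S ∪ R).map Fin.valEmbedding) ?_ ?_
    · intro R hR
      obtain ⟨hR1, hR2⟩ := Finset.mem_filter.1 hR
      obtain ⟨hR3, hR4⟩ := Finset.mem_powersetCard.1 hR1
      refine Finset.mem_filter.2 ⟨(hKmem _).2 ⟨S ∪ R, ⟨?_, ?_⟩, rfl⟩, ?_⟩
      · have hdj : Disjoint S R := by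
          rw [Finset.disjoint_right]
          intro i hi; exact (Finset.mem_sdiff.1 (hR3 hi)).2
        rw [Finset.card_union_of_disjoint hdj, hSc, hR4]; omega
      · unfold imS at hR2 ⊢; rw [Finset.image_union]; exact hR2
      · show S0 ⊆ (S ∪ R).map Fin.valEmbedding
        rw [Finset.map_union, hSm]; exact Finset.subset_union_left
    · intro R hR R' hR' h
      have h' : S ∪ R = S ∪ R' := Finset.map_injective _ h
      have e1 := (Finset.mem_powersetCard.1 (Finset.mem_filter.1 hR).1).1
      have e2 := (Finset.mem_powersetCard.1 (Finset.mem_filter.1 hR').1).1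
      ext i
      have := Finset.ext_iff.1 h' i
      simp only [Finset.mem_union] at this
      constructor
      · intro hi
        have := this.1 (Or.inr hi)
        exact this.resolve_left (Finset.mem_sdiff.1 (e1 hi)).2
      · intro hi
        have := this.2 (Or.inr hi)
        exact this.resolve_left (Finset.mem_sdiff.1 (e2 hi)).2)
  have hg0 : 0 < m - ℓ := by omega
  have htτ : t = τ := Nat.eq_of_mul_eq_mul_left hg0 (hts.trans hsτ)
  subst htτ
  have hflt : ∀ i : Fin s, f i < s := fun i => by
    have : f i ∈ (Finset.range s).image f := Finset.mem_image_of_mem _ (Finset.mem_range.2 i.2)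
    rw [hfim] at this; exact Finset.mem_range.1 this
  set σ0 : Fin s → Fin s := fun i => ⟨f i, hflt i⟩ with hσ0
  have hσi : Function.Injective σ0 := by
    intro i j hij
    have h1 : f i = f j := congrArg Fin.val hij
    exact Fin.ext (hfi (by simp) (by simp) h1)
  refine ⟨Equiv.ofBijective σ0 (Finite.injective_iff_bijective.1 hσi), ?_⟩
  intro j hj e he
  have hCe := (hcyc.2.1 j hj e (hA.2.1 e he).1).1 he
  obtain ⟨e', ⟨he1, he2⟩, he3⟩ := (hKmem _).1 (hfK _ hCe)
  have hee : e' = e.image (fun i => σ0 (posn s hs (i + j * (m - ℓ)))) := by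
    apply Finset.map_injective Fin.valEmbedding
    rw [he3, Finset.map_eq_image, Finset.image_image, Finset.image_image]
    refine Finset.image_congr ?_
    intro i _
    simp only [Function.comp, hσ0, posn, Fin.valEmbedding_apply]
    rw [hts]
  rw [hee] at he2
  unfold imS at he2
  rw [Finset.image_image] at he2
  exact he2

lemma bad_S {k d n s q : ℕ} (hn : 0 < n) (hs : 0 < s) (hq1 : 1 ≤ q) (hq : q = k - d)
    (H : Finset (Finset ℕ)) (hH : ∀ e ∈ H, e ⊆ Finset.range n ∧ e.card = k)
    (β α : ℝ) (hα : 0 < α) (hα1 : α ≤ 1) 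
    (hdeg : ∀ Y ⊆ Finset.range n, Y.card = d →
      β * (n : ℝ) ^ q ≤ ((H.filter (fun e => Y ⊆ e)).card : ℝ))
    (hsβ : (β - α / 6) * (s : ℝ) ^ q ≤ ((s - d).descFactorial q : ℝ) * β)
    (S : Finset (Fin s)) (hS : S.card = d) :
    ((Finset.univ.filter (fun x : Fin s → Fin n => Function.Injective x ∧
      (gcnt H (imS x S) S q x : ℝ) < (β - α / 2) * (s : ℝ) ^ q)).card : ℝ) ≤
      (n : ℝ) ^ s * Real.exp (-(α ^ 2 * s / 36)) := by
  classical
  have : Nonempty (Fin n) := ⟨⟨0, hn⟩⟩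
  have hspos : (0:ℝ) < s := by exact_mod_cast hs
  have key := decouple (V := Fin n) S
    (fun y x => Set.InjOn y S ∧ (gcnt H (imS y S) S q x : ℝ) < (β - α / 2) * (s : ℝ) ^ q)
    (by
      intro y y' x x' hy hx
      have e1 : imS y S = imS y' S := by
        unfold imS
        refine Finset.image_congr ?_
        intro i hi; simp only [hy i hi]
      have e2 : Set.InjOn y S ↔ Set.InjOn y' S := Set.EqOn.injOn_iff hy
      rw [e1, e2, gcnt_congr H (imS y' S) S x x' hx])
    ((n : ℝ) ^ s * Real.exp (-(α ^ 2 * s / 36)))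
    (by
      intro y
      by_cases hy : Set.InjOn y S
      · have hY : (imS y S).card = d := by
          unfold imS
          rw [Finset.card_image_of_injOn, hS]
          intro i hi j hj h
          exact hy hi hj (Fin.ext h)
        have hYn : imS y S ⊆ Finset.range n := by
          intro v hv
          unfold imS at hv
          obtain ⟨i, _, rfl⟩ := Finset.mem_image.1 hv
          exact Finset.mem_range.2 (y i).2
        have hmean := gcnt_mean hn H hH (imS y S) hY hq S hS β (hdeg _ hYn hY)
        have hpow : (s:ℝ) ^ q = s * (s:ℝ) ^ (q - 1) := by
          rw [← pow_succ']; congr 1; omega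
        have hp0 : (0:ℝ) < (s:ℝ) ^ (q - 1) := by positivity
        have := mcd_tail (V := Fin n) s hs (fun x => (gcnt H (imS y S) S q x : ℝ))
          ((s:ℝ) ^ (q - 1)) (α / 3 * (s:ℝ) ^ q) ((β - α / 6) * (s : ℝ) ^ q) hp0 (by positivity)
          (by
            rw [hpow]
            have : 0 ≤ (s:ℝ) * (s:ℝ) ^ (q - 1) := by positivity
            nlinarith)
          (fun x i v => gcnt_lip hq1 H _ S x i v)
          (by
            rw [Fintype.card_fin]
            refine le_trans ?_ hmean
            exact mul_le_mul_of_nonneg_right hsβ (by positivity))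
        rw [Fintype.card_fin] at this
        have e1 : (α / 3 * (s:ℝ) ^ q) ^ 2 / (4 * s * ((s:ℝ) ^ (q - 1)) ^ 2) = α ^ 2 * s / 36 := by
          rw [hpow]; field_simp; ring
        rw [e1] at this
        refine le_trans ?_ this
        refine Nat.cast_le.2 ?_
        refine Finset.card_le_card ?_
        intro x hx
        have := ((@Finset.mem_filter _ _ (_) _ _).1 hx).2.2
        refine Finset.mem_filter.2 ⟨Finset.mem_univ _, ?_⟩
        have e3 : (β - α / 6) * (s : ℝ) ^ q - α / 3 * (s:ℝ) ^ q = (β - α / 2) * (s : ℝ) ^ q := by ring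
        rw [e3]; exact this
      · have e0 := @Finset.filter_false_of_mem _ (fun x : Fin s → Fin n => Set.InjOn y S ∧
          (gcnt H (imS y S) S q x : ℝ) < (β - α / 2) * (s : ℝ) ^ q) (fun _ => Classical.propDecidable _)
          Finset.univ (fun x _ h => hy h.1)
        rw [e0]
        simp; positivity)
  refine le_trans ?_ key
  refine Nat.cast_le.2 ?_
  refine Finset.card_le_card ?_
  intro x hx
  have := (Finset.mem_filter.1 hx).2
  exact (@Finset.mem_filter _ _ (_) _ _).2 ⟨Finset.mem_univ _, this.1.injOn, this.2⟩

lemma bern (n c q : ℕ) (hc : c ≤ n) (hn : 0 < n) :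
    (1 - q * (c:ℝ) / n) * (n:ℝ) ^ q ≤ ((n - c : ℕ) : ℝ) ^ q := by
  have hn' : (0:ℝ) < n := by exact_mod_cast hn
  have hc' : (c:ℝ) / n ≤ 1 := by rw [div_le_one hn']; exact_mod_cast hc
  have h := one_add_mul_le_pow (R := ℝ) (a := -((c:ℝ) / n)) (by linarith) q
  have e : ((n - c : ℕ) : ℝ) = (1 + -((c:ℝ) / n)) * n := by
    rw [Nat.cast_sub hc]; field_simp; ring
  rw [e, mul_pow]
  refine mul_le_mul_of_nonneg_right ?_ (by positivity)
  refine le_trans (le_of_eq ?_) h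
  ring

lemma sampling {k ℓ m d : ℕ} (hd1 : 1 ≤ d) (hdk : d ≤ k - 1) (hlm : ℓ < m)
    (A : Finset (Finset ℕ)) (hA : IsHyperLink k ℓ m A) (δ : ℝ) (hδ : HamThresholdProp k ℓ m d A δ)
    (α ε : ℝ) (hα : 0 < α) (hε : 0 < ε) :
    ∃ τ s : ℕ, ∃ hs : 0 < s, 0 < τ ∧ s = (m - ℓ) * τ ∧ m ≤ s ∧ ∃ N : ℕ, ∀ n, N ≤ n →
      s ≤ n ∧ ∀ H : Finset (Finset ℕ), (∀ e ∈ H, e ⊆ Finset.range n ∧ e.card = k) →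
      (∀ S ⊆ Finset.range n, S.card = d →
        (δ + α) * (n : ℝ) ^ (k - d) ≤ ((H.filter (fun e => S ⊆ e)).card : ℝ)) →
      ∀ Bad : Finset (Fin s → Fin n), (∀ x ∈ Bad, Function.Injective x ∧
        ¬ ∃ f, HamT s τ (m - ℓ) hs A H f (fun i => (x i : ℕ))) →
      (Bad.card : ℝ) ≤ ε * (n.descFactorial s : ℝ) := by
  classical
  set a := min α 1 with ha
  have ha0 : 0 < a := lt_min hα one_pos
  have ha1 : a ≤ 1 := min_le_right _ _
  have haα : a ≤ α := min_le_left _ _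
  set q := k - d with hq
  have hq1 : 1 ≤ q := by omega
  obtain ⟨n₀, hn₀⟩ := hδ (a / 2) (by positivity)
  have hc : 0 < a ^ 2 / 36 := by positivity
  have hexp : ∀ᶠ s : ℕ in Filter.atTop, (s:ℝ) ^ d * Real.exp (-(a ^ 2 * s / 36)) ≤ ε / 2 := by
    have h1 := Real.tendsto_pow_mul_exp_neg_atTop_nhds_zero d
    have h2 : Filter.Tendsto (fun s : ℕ => (a ^ 2 / 36) * (s:ℝ)) Filter.atTop Filter.atTop :=
      Filter.Tendsto.const_mul_atTop hc tendsto_natCast_atTop_atTop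
    have h3 := h1.comp h2
    have h4 := h3.eventually (gt_mem_nhds (show (0:ℝ) < (a ^ 2 / 36) ^ d * (ε / 2) by positivity))
    filter_upwards [h4] with s hs
    simp only [Function.comp, mul_pow] at hs
    have e : a ^ 2 / 36 * (s:ℝ) = a ^ 2 * s / 36 := by ring
    rw [e, mul_assoc] at hs
    exact (lt_of_mul_lt_mul_left hs (by positivity)).le
  obtain ⟨s₀, hs₀⟩ := Filter.eventually_atTop.1 hexp
  obtain ⟨s₁, hs₁⟩ := exists_nat_gt (6 * q * k * (|δ| + 1) / a)
  set g := m - ℓ with hg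
  have hg0 : 0 < g := by omega
  set τ := n₀ + s₀ + s₁ + m + k + 1 with hτ
  set s := g * τ with hs
  have hsτ : τ ≤ s := Nat.le_mul_of_pos_left _ hg0
  have hs0 : 0 < s := by omega
  have hs0' : (0:ℝ) < s := by exact_mod_cast hs0
  refine ⟨τ, s, hs0, by omega, rfl, by omega, 2 * s ^ 2 + s, ?_⟩
  intro n hn
  have hsn : s ≤ n := by omega
  refine ⟨hsn, ?_⟩
  intro H hH hdeg Bad hBad
  have hn0 : 0 < n := by omega
  have hn0' : (0:ℝ) < n := by exact_mod_cast hn0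
  set β := δ + a with hβ
  have hdeg' : ∀ Y ⊆ Finset.range n, Y.card = d →
      β * (n : ℝ) ^ q ≤ ((H.filter (fun e => Y ⊆ e)).card : ℝ) := by
    intro Y hY hYc
    refine le_trans ?_ (hdeg Y hY hYc)
    refine mul_le_mul_of_nonneg_right (by linarith) (by positivity)
  -- bad for one set
  have hbadS : ∀ S : Finset (Fin s), S.card = d →
      ((Finset.univ.filter (fun x : Fin s → Fin n => Function.Injective x ∧
      (gcnt H (imS x S) S q x : ℝ) < (β - a / 2) * (s : ℝ) ^ q)).card : ℝ) ≤
      (n : ℝ) ^ s * Real.exp (-(a ^ 2 * s / 36)) := by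
    intro S hS
    by_cases hβ0 : β ≤ 0
    · rw [Finset.filter_false_of_mem]
      · simp; positivity
      · intro x _ h
        have h1 : (0:ℝ) ≤ gcnt H (imS x S) S q x := by positivity
        have h2 : (β - a / 2) * (s : ℝ) ^ q ≤ 0 :=
          mul_nonpos_of_nonpos_of_nonneg (by linarith) (by positivity)
        linarith [h.2]
    · push Not at hβ0
      refine bad_S hn0 hs0 hq1 hq H hH β a ha0 ha1 hdeg' ?_ S hS
      have h1 : (s - k) ^ q ≤ (s - d).descFactorial q := by
        refine le_trans (Nat.pow_le_pow_left (by omega) q) (Nat.pow_sub_le_descFactorial (s - d) q)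
      have h1' : ((s - k : ℕ) : ℝ) ^ q ≤ ((s - d).descFactorial q : ℝ) := by exact_mod_cast h1
      have h2 := bern s k q (by omega) hs0
      have h3 : q * (k:ℝ) / s * β ≤ a / 6 := by
        have hβ1 : β ≤ |δ| + 1 := by linarith [le_abs_self δ]
        have h4 : 6 * q * k * (|δ| + 1) / a ≤ s := by
          refine hs₁.le.trans ?_
          have : s₁ ≤ s := by omega
          exact_mod_cast this
        rw [div_le_iff₀ ha0] at h4
        rw [div_mul_eq_mul_div, div_le_iff₀ hs0']
        have h5 : (q:ℝ) * k * β ≤ q * k * (|δ| + 1) :=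
          mul_le_mul_of_nonneg_left hβ1 (by positivity)
        nlinarith
      calc (β - a / 6) * (s:ℝ) ^ q ≤ (1 - q * (k:ℝ) / s) * (s:ℝ) ^ q * β := by
            have : 0 ≤ (s:ℝ) ^ q := by positivity
            nlinarith
        _ ≤ _ := mul_le_mul_of_nonneg_right (h2.trans h1') hβ0.le
  have hcover : Bad ⊆ (Finset.powersetCard d (Finset.univ : Finset (Fin s))).biUnion (fun S =>
      Finset.univ.filter (fun x : Fin s → Fin n => Function.Injective x ∧
      (gcnt H (imS x S) S q x : ℝ) < (β - a / 2) * (s : ℝ) ^ q)) := by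
    intro x hx
    obtain ⟨hx1, hx2⟩ := hBad x hx
    by_contra hcon
    apply hx2
    refine ham_of_gcnt hs0 hlm (by omega) hq hs A H hA (δ + a / 2) ?_ x ?_
    · intro K hK1 hK2
      exact hn₀ s (by omega) (Dvd.intro _ rfl) K hK1 hK2
    · intro S hS
      by_contra hlt
      apply hcon
      refine Finset.mem_biUnion.2 ⟨S, Finset.mem_powersetCard.2 ⟨Finset.subset_univ _, hS⟩,
        Finset.mem_filter.2 ⟨Finset.mem_univ _, hx1, ?_⟩⟩
      have e : β - a / 2 = δ + a / 2 := by rw [hβ]; ring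
      rw [e]; exact not_le.1 hlt
  have hcard : (Bad.card : ℝ) ≤ (s:ℝ) ^ d * ((n : ℝ) ^ s * Real.exp (-(a ^ 2 * s / 36))) := by
    have h1 := (Finset.card_le_card hcover).trans Finset.card_biUnion_le
    have h1' : (Bad.card : ℝ) ≤ ∑ S ∈ Finset.powersetCard d (Finset.univ : Finset (Fin s)),
      ((Finset.univ.filter (fun x : Fin s → Fin n => Function.Injective x ∧
      (gcnt H (imS x S) S q x : ℝ) < (β - a / 2) * (s : ℝ) ^ q)).card : ℝ) := by exact_mod_cast h1
    refine h1'.trans ((Finset.sum_le_card_nsmul _ _ _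
      (fun S hS => hbadS S (Finset.mem_powersetCard.1 hS).2)).trans ?_)
    rw [Finset.card_powersetCard, Finset.card_univ, Fintype.card_fin, nsmul_eq_mul]
    refine mul_le_mul_of_nonneg_right ?_ (by positivity)
    exact_mod_cast Nat.choose_le_pow s d
  have hdesc : (n:ℝ) ^ s ≤ 2 * (n.descFactorial s : ℝ) := by
    have h1 : (n - s) ^ s ≤ n.descFactorial s :=
      le_trans (Nat.pow_le_pow_left (by omega) s) (Nat.pow_sub_le_descFactorial n s)
    have h1' : ((n - s : ℕ) : ℝ) ^ s ≤ (n.descFactorial s : ℝ) := by exact_mod_cast h1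
    have h2 := (bern n s s hsn hn0).trans h1'
    have h3 : (s:ℝ) * s / n ≤ 1 / 2 := by
      rw [div_le_iff₀ hn0']
      have : (2:ℝ) * s ^ 2 ≤ n := by
        have : 2 * s ^ 2 ≤ n := by omega
        exact_mod_cast this
      nlinarith
    have : 0 ≤ (n:ℝ) ^ s := by positivity
    nlinarith
  have hfin := hs₀ s (by omega)
  calc (Bad.card : ℝ) ≤ (s:ℝ) ^ d * ((n : ℝ) ^ s * Real.exp (-(a ^ 2 * s / 36))) := hcard
    _ = ((s:ℝ) ^ d * Real.exp (-(a ^ 2 * s / 36))) * (n : ℝ) ^ s := by ring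
    _ ≤ ε / 2 * (n:ℝ) ^ s := mul_le_mul_of_nonneg_right hfin (by positivity)
    _ ≤ ε / 2 * (2 * (n.descFactorial s : ℝ)) := mul_le_mul_of_nonneg_left hdesc (by positivity)
    _ = _ := by ring

lemma perm_avg {n s : ℕ} (Bad : Finset (Fin s → Fin n)) (hBad : ∀ x ∈ Bad, Function.Injective x)
    (p : Fin s ↪ Fin n) :
    n.descFactorial s * (Finset.univ.filter (fun π : Equiv.Perm (Fin n) => (fun i => π (p i)) ∈ Bad)).card
      = n.factorial * Bad.card := by
  classical
  have h1 : ∀ p' : Fin s ↪ Fin n,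
      (Finset.univ.filter (fun π : Equiv.Perm (Fin n) => (fun i => π (p' i)) ∈ Bad)).card =
      (Finset.univ.filter (fun π : Equiv.Perm (Fin n) => (fun i => π (p i)) ∈ Bad)).card := by
    intro p'
    have := Equiv.Perm.isMultiplyPretransitive (Fin n) s
    obtain ⟨ρ, hρ⟩ := MulAction.exists_smul_eq (Equiv.Perm (Fin n)) p' p
    have hρ' : ∀ i, ρ (p' i) = p i := by
      intro i; rw [← hρ]; rfl
    refine Finset.card_bij (fun π _ => π * ρ⁻¹) ?_ ?_ ?_
    · intro π hπ
      simp only [Finset.mem_filter, Finset.mem_univ, true_and] at hπ ⊢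
      convert hπ using 2
      rw [← hρ']; simp
    · intro π _ π' _ h; exact mul_right_cancel h
    · intro π hπ
      refine ⟨π * ρ, ?_, by simp⟩
      simp only [Finset.mem_filter, Finset.mem_univ, true_and] at hπ ⊢
      convert hπ using 2
      rw [← hρ']; simp
  have h2 : ∑ p' : Fin s ↪ Fin n,
      (Finset.univ.filter (fun π : Equiv.Perm (Fin n) => (fun i => π (p' i)) ∈ Bad)).card =
      n.factorial * Bad.card := by
    simp only [Finset.card_filter]
    rw [Finset.sum_comm]
    have h3 : ∀ π : Equiv.Perm (Fin n), ∑ p' : Fin s ↪ Fin n,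
        (if (fun i => π (p' i)) ∈ Bad then 1 else 0) = Bad.card := by
      intro π
      rw [← Finset.card_filter]
      refine Finset.card_bij (fun p' _ => fun i => π (p' i)) ?_ ?_ ?_
      · intro p' hp'; exact (Finset.mem_filter.1 hp').2
      · intro p' _ p'' _ h
        ext i
        exact congrArg Fin.val (π.injective (congrFun h i))
      · intro x hx
        refine ⟨⟨fun i => π.symm (x i), fun i j h => hBad x hx (π.symm.injective h)⟩, ?_, ?_⟩
        · refine Finset.mem_filter.2 ⟨Finset.mem_univ _, ?_⟩
          have : (fun i => π (π.symm (x i))) = x := by funext i; simp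
          exact this.symm ▸ hx
        · funext i; exact π.apply_symm_apply _
    rw [Finset.sum_congr rfl (fun π _ => h3 π)]
    simp [Fintype.card_perm]
  rw [← h2, Finset.sum_congr rfl (fun p' _ => h1 p'), Finset.sum_const, Finset.card_univ,
    Fintype.card_embedding_eq, Fintype.card_fin, Fintype.card_fin, smul_eq_mul]

lemma init_box {n s z : ℕ} (hz0 : 0 < z) (hz : s * z ≤ n) (G : (Fin (s + 1) → ℕ) → Prop)
    (W : Finset ℕ) (hW : 0 < W.card) (ε : ℝ)
    (hbad : ∀ c ∈ W, ∀ Bad : Finset (Fin s → Fin n), (∀ x ∈ Bad, Function.Injective x ∧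
      ¬ G (Fin.cons c (fun i => (x i : ℕ)))) → (Bad.card : ℝ) ≤ ε * (n.descFactorial s : ℝ)) :
    ∃ X : Fin (s + 1) → Finset ℕ, X 0 = W ∧
      (∀ i : Fin s, (X i.succ).card = z ∧ X i.succ ⊆ Finset.range n) ∧
      (∀ i j : Fin s, i ≠ j → Disjoint (X i.succ) (X j.succ)) ∧ 1 - ε ≤ boxDens G X := by
  classical
  have hlt : ∀ (i : Fin s) (b : Fin z), (i : ℕ) * z + b < n := by
    intro i b
    have h1 : ((i : ℕ) + 1) * z ≤ s * z := Nat.mul_le_mul_right _ i.2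
    have h2 := b.2
    rw [add_mul, one_mul] at h1
    omega
  set ps : Fin s → Fin z → Fin n := fun i b => ⟨i * z + b, hlt i b⟩ with hps
  have hpsinj : ∀ i b i' b', ps i b = ps i' b' → i = i' ∧ b = b' := by
    intro i b i' b' h
    have h' : (i : ℕ) * z + b = i' * z + b' := congrArg Fin.val h
    have e1 : ((i : ℕ) * z + b) / z = i := by
      rw [mul_comm, Nat.mul_add_div hz0, Nat.div_eq_of_lt b.2, add_zero]
    have e2 : ((i' : ℕ) * z + b') / z = i' := by
      rw [mul_comm, Nat.mul_add_div hz0, Nat.div_eq_of_lt b'.2, add_zero]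
    have e3 : (i : ℕ) = i' := by rw [← e1, h', e2]
    rw [e3] at h'
    exact ⟨Fin.ext e3, Fin.ext (by omega)⟩
  set BadC : ℕ → Finset (Fin s → Fin n) := fun c => Finset.univ.filter (fun x =>
    Function.Injective x ∧ ¬ G (Fin.cons c (fun i => (x i : ℕ)))) with hBadC
  have hBadc : ∀ c ∈ W, ((BadC c).card : ℝ) ≤ ε * (n.descFactorial s : ℝ) := fun c hc =>
    hbad c hc (BadC c) (fun x hx => (Finset.mem_filter.1 hx).2)
  set em : (Fin s → Fin z) → (Fin s ↪ Fin n) := fun y =>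
    ⟨fun i => ps i (y i), fun i j h => (hpsinj _ _ _ _ h).1⟩ with hem
  have hzn : s ≤ n := le_trans (Nat.le_mul_of_pos_right _ hz0) hz
  have hdf : (0:ℝ) < n.descFactorial s := by
    exact_mod_cast Nat.pos_of_ne_zero (fun h => absurd (Nat.descFactorial_eq_zero_iff_lt.1 h) (by omega))
  have h1 : ∀ c ∈ W, ∀ y, ((Finset.univ.filter (fun π : Equiv.Perm (Fin n) =>
      (fun i => π (em y i)) ∈ BadC c)).card : ℝ) ≤ ε * n.factorial := by
    intro c hc y
    have e := perm_avg (BadC c) (fun x hx => (Finset.mem_filter.1 hx).2.1) (em y)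
    have e' : (n.descFactorial s : ℝ) * ((Finset.univ.filter (fun π : Equiv.Perm (Fin n) =>
      (fun i => π (em y i)) ∈ BadC c)).card : ℝ) = n.factorial * (BadC c).card := by exact_mod_cast e
    have h2 : (n.factorial : ℝ) * (BadC c).card ≤ n.factorial * (ε * (n.descFactorial s : ℝ)) :=
      mul_le_mul_of_nonneg_left (hBadc c hc) (by positivity)
    refine le_of_mul_le_mul_left ?_ hdf
    rw [e']; linarith
  set pairs : Equiv.Perm (Fin n) → Finset (ℕ × (Fin s → Fin z)) := fun π =>
    (W ×ˢ Finset.univ).filter (fun w => (fun i => π (em w.2 i)) ∈ BadC w.1) with hpairs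
  have hsum : ∑ π, ((pairs π).card : ℝ) ≤ ∑ _π : Equiv.Perm (Fin n), ε * (W.card * (z:ℝ) ^ s) := by
    have e1 : ∀ π, ((pairs π).card : ℝ) = ∑ w ∈ W ×ˢ (Finset.univ : Finset (Fin s → Fin z)),
        (if (fun i => π (em w.2 i)) ∈ BadC w.1 then (1:ℝ) else 0) := by
      intro π; rw [hpairs]; simp only [Finset.card_filter]; push_cast; rfl
    simp only [e1]
    rw [Finset.sum_comm]
    have e2 : ∀ w ∈ W ×ˢ (Finset.univ : Finset (Fin s → Fin z)),
        ∑ π : Equiv.Perm (Fin n), (if (fun i => π (em w.2 i)) ∈ BadC w.1 then (1:ℝ) else 0) ≤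
          ε * n.factorial := by
      intro w hw
      have := h1 w.1 (Finset.mem_product.1 hw).1 w.2
      rw [Finset.card_filter] at this
      push_cast at this
      exact this
    refine (Finset.sum_le_card_nsmul _ _ _ e2).trans (le_of_eq ?_)
    rw [Finset.card_product, Finset.sum_const, nsmul_eq_mul, nsmul_eq_mul]
    simp [Fintype.card_perm]
    ring
  obtain ⟨π, _, hπ⟩ := Finset.exists_le_of_sum_le Finset.univ_nonempty hsum
  set X : Fin (s + 1) → Finset ℕ := Fin.cons W (fun i => Finset.univ.image (fun b => (π (ps i b) : ℕ)))
    with hX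
  have hX0 : X 0 = W := rfl
  have hXs : ∀ i : Fin s, X i.succ = Finset.univ.image (fun b => (π (ps i b) : ℕ)) := fun i => rfl
  have hXc : ∀ i : Fin s, (X i.succ).card = z := by
    intro i
    rw [hXs, Finset.card_image_of_injective, Finset.card_univ, Fintype.card_fin]
    intro b b' h
    exact (hpsinj _ _ _ _ (π.injective (Fin.ext h))).2
  refine ⟨X, hX0, fun i => ⟨hXc i, ?_⟩, ?_, ?_⟩
  · intro v hv
    rw [hXs] at hv
    obtain ⟨b, _, rfl⟩ := Finset.mem_image.1 hv
    exact Finset.mem_range.2 (π (ps i b)).2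
  · intro i j hij
    rw [Finset.disjoint_left]
    intro v hv hv'
    rw [hXs] at hv hv'
    obtain ⟨b, _, rfl⟩ := Finset.mem_image.1 hv
    obtain ⟨b', _, h⟩ := Finset.mem_image.1 hv'
    exact hij ((hpsinj _ _ _ _ (π.injective (Fin.ext h))).1).symm
  · have hvol : (∏ i, ((X i).card : ℝ)) = W.card * (z : ℝ) ^ s := by
      rw [Fin.prod_univ_succ, hX0]
      simp [hXc]
    have hW' : (0:ℝ) < W.card := by exact_mod_cast hW
    have hz' : (0:ℝ) < z := by exact_mod_cast hz0
    unfold boxDens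
    rw [hvol, le_div_iff₀ (by positivity)]
    have hcomp : (Fintype.piFinset X).card ≤ boxCnt G X + (pairs π).card := by
      unfold boxCnt
      have := Finset.card_filter_add_card_filter_not (s := Fintype.piFinset X) G
      rw [← this]
      refine Nat.add_le_add (le_of_eq (by congr!)) ?_
      refine le_trans (Finset.card_le_card ?_) (Finset.card_image_le
        (f := fun w : ℕ × (Fin s → Fin z) =>
          (Fin.cons w.1 (fun i => (π (em w.2 i) : ℕ)) : Fin (s + 1) → ℕ)) (s := pairs π))
      intro x hx
      obtain ⟨hx1, hx2⟩ := Finset.mem_filter.1 hx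
      have hx1 := Fintype.mem_piFinset.1 hx1
      have hex : ∀ i : Fin s, ∃ b, (π (ps i b) : ℕ) = x i.succ := by
        intro i
        have := hx1 i.succ
        rw [hXs] at this
        obtain ⟨b, _, hb⟩ := Finset.mem_image.1 this
        exact ⟨b, hb⟩
      choose y hy using hex
      have hxe : x = Fin.cons (x 0) (fun i => (π (em y i) : ℕ)) := by
        funext i
        refine Fin.cases rfl (fun i => ?_) i
        rw [Fin.cons_succ]; exact (hy i).symm
      refine Finset.mem_image.2 ⟨(x 0, y), Finset.mem_filter.2 ⟨Finset.mem_product.2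
        ⟨by simpa [hX0] using hx1 0, Finset.mem_univ _⟩, ?_⟩, hxe.symm⟩
      refine Finset.mem_filter.2 ⟨Finset.mem_univ _, fun i j h => (em y).injective (π.injective h), ?_⟩
      rw [← hxe]; exact hx2
    have hcomp' : ((Fintype.piFinset X).card : ℝ) ≤ boxCnt G X + (pairs π).card := by
      exact_mod_cast hcomp
    rw [Fintype.card_piFinset] at hcomp'
    push_cast at hcomp'
    rw [hvol] at hcomp'
    nlinarith

lemma assemble {s L NB Q T n : ℕ} (hs : 0 < s) (P : Finset (Finset ℕ)) (H : ℕ → Finset (Finset ℕ))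
    (X : Fin (s + 1) → Finset ℕ) (B : Fin NB → Fin (s + 1) → Finset ℕ)
    (hBX : ∀ b i, B b i ⊆ X i) (hBB : ∀ b b' i, b ≠ b' → Disjoint (B b i) (B b' i))
    (hX : ∀ i j : Fin s, i ≠ j → Disjoint (X i.succ) (X j.succ))
    (hXn : ∀ i : Fin s, X i.succ ⊆ Finset.range n) (Good : Finset (Fin NB))
    (hgood : ∀ b ∈ Good, ∃ (φ : ℕ → ℕ → ℕ) (c : ℕ → Finset ℕ → ℕ),
      (∀ q < Q, RChain s L hs P H (B b) (φ q) (c q)) ∧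
      ∀ q < Q, ∀ q' < Q, q ≠ q' →
        Disjoint ((Finset.range L).image (φ q)) ((Finset.range L).image (φ q')) ∧
        Disjoint (P.image (c q)) (P.image (c q')))
    (hT : T ≤ Good.card * Q) :
    ∃ (φ : Fin T → ℕ → ℕ) (c : Fin T → Finset ℕ → ℕ),
      (∀ j, Set.InjOn (φ j) ↑(Finset.range L)) ∧
      (∀ j, (Finset.range L).image (φ j) ⊆ Finset.range n) ∧
      (∀ j j', j ≠ j' → Disjoint ((Finset.range L).image (φ j)) ((Finset.range L).image (φ j'))) ∧
      (∀ j, ∀ e ∈ P, c j e ∈ X 0 ∧ e.image (φ j) ∈ H (c j e)) ∧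
      (∀ j j' e e', e ∈ P → e' ∈ P → c j e = c j' e' → j = j' ∧ e = e') := by
  classical
  choose! φ c h1 h2 using hgood
  have hcard : Fintype.card (Fin T) ≤ Fintype.card (Good ×ˢ Finset.range Q : Finset (Fin NB × ℕ)) := by
    simpa using hT
  obtain ⟨f⟩ := Function.Embedding.nonempty_of_card_le hcard
  have hf1 : ∀ j, (f j).1.1 ∈ Good := fun j => (Finset.mem_product.1 (f j).2).1
  have hf2 : ∀ j, (f j).1.2 < Q := fun j => Finset.mem_range.1 (Finset.mem_product.1 (f j).2).2
  have hR : ∀ j, RChain s L hs P H (B (f j).1.1) (φ (f j).1.1 (f j).1.2) (c (f j).1.1 (f j).1.2) :=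
    fun j => h1 _ (hf1 j) _ (hf2 j)
  have hne : ∀ j j', j ≠ j' → (f j).1.1 = (f j').1.1 → (f j).1.2 ≠ (f j').1.2 := by
    intro j j' hjj h h'
    exact hjj (f.injective (Subtype.ext (Prod.ext h h')))
  refine ⟨fun j => φ (f j).1.1 (f j).1.2, fun j => c (f j).1.1 (f j).1.2,
    fun j => (hR j).1, ?_, ?_, ?_, ?_⟩
  · intro j v hv
    obtain ⟨p, hp, rfl⟩ := Finset.mem_image.1 hv
    obtain ⟨σ, hσ⟩ := (hR j).2.1
    exact hXn _ (hBX _ _ (hσ p (Finset.mem_range.1 hp)))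
  · intro j j' hjj
    by_cases hb : (f j).1.1 = (f j').1.1
    · have h5 := (h2 _ (hf1 j) _ (hf2 j) _ (hf2 j') (hne j j' hjj hb)).1
      have e : φ (f j').1.1 = φ (f j).1.1 := by rw [hb]
      show Disjoint (Finset.image (φ (f j).1.1 (f j).1.2) _) (Finset.image (φ (f j').1.1 (f j').1.2) _)
      rw [e]; exact h5
    · rw [Finset.disjoint_left]
      intro v hv hv'
      obtain ⟨p, hp, rfl⟩ := Finset.mem_image.1 hv
      obtain ⟨p', hp', he⟩ := Finset.mem_image.1 hv'
      obtain ⟨σ, hσ⟩ := (hR j).2.1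
      obtain ⟨σ', hσ'⟩ := (hR j').2.1
      have a1 := hσ p (Finset.mem_range.1 hp)
      have a2 := hσ' p' (Finset.mem_range.1 hp')
      have he : φ (f j').1.1 (f j').1.2 p' = φ (f j).1.1 (f j).1.2 p := he
      rw [he] at a2
      by_cases hi : σ (posn s hs p) = σ' (posn s hs p')
      · rw [hi] at a1
        exact Finset.disjoint_left.1 (hBB _ _ _ hb) a1 a2
      · exact Finset.disjoint_left.1 (hX _ _ hi) (hBX _ _ a1) (hBX _ _ a2)
  · intro j e he
    have := (hR j).2.2.2 e he
    exact ⟨hBX _ _ this.1, this.2⟩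
  · intro j j' e e' he he' hc
    have hc : c (f j).1.1 (f j).1.2 e = c (f j').1.1 (f j').1.2 e' := hc
    by_cases hjj : j = j'
    · subst hjj
      exact ⟨rfl, (hR j).2.2.1 he he' hc⟩
    · exfalso
      by_cases hb : (f j).1.1 = (f j').1.1
      · have h5 := (h2 _ (hf1 j) _ (hf2 j) _ (hf2 j') (hne j j' hjj hb)).2
        have e0 : c (f j').1.1 = c (f j).1.1 := by rw [hb]
        rw [e0] at hc
        exact Finset.disjoint_left.1 h5 (Finset.mem_image_of_mem _ he)
          (hc ▸ Finset.mem_image_of_mem _ he')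
      · have a1 := ((hR j).2.2.2 e he).1
        have a2 := ((hR j').2.2.2 e' he').1
        rw [← hc] at a2
        exact Finset.disjoint_left.1 (hBB _ _ _ hb) a1 a2

/-- numerical bookkeeping: enough chains are obtained from the good boxes -/
lemma num_count {w n s T p K h c₀ z₀ J u good : ℝ} (hw : 0 < w) (hw2 : w ≤ 1 / 2) (hn : 0 < n)
    (hs : 0 < s) (hT : 0 < T) (hJ : 0 ≤ J) (hJp : J ≤ p) (hK : 8 / w ≤ K + 1)
    (hKu : J * ((K + 1) * u) = z₀ * p) (hz : n * (1 - w / 8) ≤ s * (z₀ * p))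
    (hh0 : 0 < h + c₀) (hh : (h + c₀) * (s * T) ≤ (1 - w + w / 8) * n) (hpT : p ≤ w / 8 * T)
    (hgood : (1 - w / 8) * J ≤ good) (q : ℝ) (hq : K * u / (h + c₀) - 1 ≤ q) (hq0 : 0 ≤ q) :
    T ≤ good * q := by
  have hK0 : 0 < K + 1 := lt_of_lt_of_le (by positivity) hK
  have hKw : 1 ≤ (K + 1) * (w / 8) := by
    rw [div_le_iff₀ hw] at hK; linarith
  have hzp : 0 < z₀ * p := by
    have : 0 < n * (1 - w / 8) := mul_pos hn (by linarith)
    exact pos_of_mul_pos_right (lt_of_lt_of_le this hz) hs.le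
  have hJu : (K + 1) * (J * u) = z₀ * p := by rw [← hKu]; ring
  have hJu0 : 0 < J * u := pos_of_mul_pos_right (hJu ▸ hzp) hK0.le
  -- J * K * u ≥ (1 - w/8) z
  have h1 : (1 - w / 8) * (z₀ * p) ≤ J * (K * u) := by
    have : J * u * 1 ≤ J * u * ((K + 1) * (w / 8)) := mul_le_mul_of_nonneg_left hKw hJu0.le
    rw [← hJu]; nlinarith
  have h2 : (1 - w / 8) ^ 2 * n ≤ s * (J * (K * u)) := by
    have a1 := mul_le_mul_of_nonneg_left h1 hs.le
    have a2 := mul_le_mul_of_nonneg_left hz (show 0 ≤ 1 - w / 8 by linarith)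
    nlinarith
  have h3 : (1 + w / 2) * (1 - w + w / 8) ≤ (1 - w / 8) ^ 2 := by nlinarith
  -- J * (K u/(h+c₀)) ≥ (1+w/2) T
  have h4 : (1 + w / 2) * T ≤ J * (K * u / (h + c₀)) := by
    rw [← mul_div_assoc, le_div_iff₀ hh0]
    have b1 : (1 + w / 2) * ((h + c₀) * (s * T)) ≤ (1 + w / 2) * ((1 - w + w / 8) * n) :=
      mul_le_mul_of_nonneg_left hh (by linarith)
    have b2 := mul_le_mul_of_nonneg_right h3 hn.le
    have b3 : s * ((1 + w / 2) * T * (h + c₀)) ≤ s * (J * (K * u)) := by nlinarith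
    exact le_of_mul_le_mul_left b3 hs
  have h5 : (1 + 3 * w / 8) * T ≤ J * q := by
    have := mul_le_mul_of_nonneg_left hq hJ
    nlinarith
  have h6 : (1 - w / 8) * (J * q) ≤ good * q := by
    have := mul_le_mul_of_nonneg_right hgood hq0
    linarith
  have h7 : 1 ≤ (1 - w / 8) * (1 + 3 * w / 8) := by nlinarith
  have h8 := mul_le_mul_of_nonneg_left h5 (show 0 ≤ 1 - w / 8 by linarith)
  have h9 := mul_le_mul_of_nonneg_right h7 hT.le
  linarith

set_option maxHeartbeats 4000000 in
/-- Lemma 3.8 (lem:rainbow_paths_tiling): a hypergraph collection with minimum `d`-degree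
above the Hamilton `𝒜`-cycle threshold contains `T` vertex-disjoint rainbow `𝒜`-chains,
with pairwise disjoint colour sets, covering all but at most `ω n` vertices. -/
theorem stmt_10 (k ℓ m d : ℕ) (hk : 1 ≤ k) (hd1 : 1 ≤ d) (hdk : d ≤ k - 1)
    (hℓ : 0 < ℓ) (hℓm : ℓ < m)
    (A : Finset (Finset ℕ)) (hA : IsHyperLink k ℓ m A)
    (δ : ℝ) (hδ : IsLeast {x : ℝ | HamThresholdProp k ℓ m d A x} δ) :
    ∀ ω α : ℝ, 0 < ω → 0 < α → ∃ T₀ : ℕ, ∀ T : ℕ, T₀ ≤ T → ∃ N : ℕ, ∀ n : ℕ, N ≤ n →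
      ∀ M : ℕ, (A.card - (linkStart ℓ A).card) * n ≤ (m - ℓ) * M →
        ∀ H : Fin M → Finset (Finset ℕ),
          (∀ i : Fin M, ∀ e ∈ H i, e ⊆ Finset.range n ∧ e.card = k) →
          (∀ i : Fin M, ∀ S ⊆ Finset.range n, S.card = d →
            (δ + α) * (n : ℝ) ^ (k - d) ≤ (((H i).filter (fun e => S ⊆ e)).card : ℝ)) →
          ∃ (t : Fin T → ℕ) (P : Fin T → Finset (Finset ℕ))
            (f : Fin T → ℕ → ℕ) (c : Fin T → Finset ℕ → Fin M),
            (∀ j, IsHyperAChain ℓ m (t j) A (P j)) ∧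
            (∀ j, Set.InjOn (f j) ↑(Finset.range ((m - ℓ) * t j + ℓ))) ∧
            (∀ j, (Finset.range ((m - ℓ) * t j + ℓ)).image (f j) ⊆ Finset.range n) ∧
            (∀ j j', j ≠ j' →
              Disjoint ((Finset.range ((m - ℓ) * t j + ℓ)).image (f j))
                ((Finset.range ((m - ℓ) * t j' + ℓ)).image (f j'))) ∧
            (∀ j, ∀ e ∈ P j, (e.image (f j)) ∈ H (c j e)) ∧
            (∀ j j' e e', e ∈ P j → e' ∈ P j' → c j e = c j' e' → j = j' ∧ e = e') ∧
            (n : ℝ) - ω * n ≤ ∑ j, (((m - ℓ) * t j + ℓ : ℕ) : ℝ) := by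
  classical
  intro ω α hω hα
  -- constants
  set w := min ω (1 / 2) with hwdef
  have hw : 0 < w := lt_min hω (by norm_num)
  have hw2 : w ≤ 1 / 2 := min_le_right _ _
  have hwω : w ≤ ω := min_le_left _ _
  have hε : 0 < w / 32 := by positivity
  obtain ⟨K, hK⟩ := exists_nat_ge (8 / w)
  obtain ⟨τ, s, hs, hτ, hsτ, hms, N₁, hN₁⟩ :=
    sampling hd1 hdk hℓm A hA δ hδ.1 α (w / 32) hα hε
  obtain ⟨D, hD⟩ := regularity (ι := Fin (s + 1)) (E := ℕ) K (w / 32) hε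
  set p := (K + 1) ^ D with hp
  have hp0 : 0 < p := by positivity
  have hAne := A_nonempty hδ
  have hlt := linkStart_lt hA hk hℓm hAne
  set a := A.card - (linkStart ℓ A).card with ha
  have ha0 : 0 < a := by omega
  set r := a * τ with hr
  have hr0 : 0 < r := Nat.mul_pos ha0 hτ
  set c₀ := A.card + 1 with hc₀
  set η : ℝ := 1 / (4 * (Fintype.card (Equiv.Perm (Fin s)) : ℝ)) with hη
  have hη0 : 0 < η := by
    have : 0 < Fintype.card (Equiv.Perm (Fin s)) := Fintype.card_pos
    rw [hη]; positivity
  have hs' : (0:ℝ) < s := by exact_mod_cast hs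
  have hs1 : (1:ℝ) ≤ s := by exact_mod_cast hs
  have hp' : (0:ℝ) < p := by exact_mod_cast hp0
  obtain ⟨T₁, hT₁⟩ := exists_nat_ge (8 * (s:ℝ) ^ 2 * p / η)
  obtain ⟨T₂, hT₂⟩ := exists_nat_ge (8 * (p:ℝ) / w)
  refine ⟨T₁ + T₂ + 1, ?_⟩
  intro T hT
  have hT0 : 0 < T := by omega
  have hT0' : (0:ℝ) < T := by exact_mod_cast hT0
  have hTη : 8 * (s:ℝ) ^ 2 * p ≤ η * T := by
    rw [div_le_iff₀ hη0] at hT₁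
    have : (T₁:ℝ) ≤ T := by exact_mod_cast (show T₁ ≤ T by omega)
    nlinarith
  have hTp : (p:ℝ) ≤ w / 8 * T := by
    rw [div_le_iff₀ hw] at hT₂
    have : (T₂:ℝ) ≤ T := by exact_mod_cast (show T₂ ≤ T by omega)
    nlinarith
  obtain ⟨N₂, hN₂⟩ := exists_nat_ge (8 * ((s:ℝ) * p) / w)
  obtain ⟨N₃, hN₃⟩ := exists_nat_ge (8 * ((1 + (c₀:ℝ)) * (s * T)) / w)
  refine ⟨N₁ + N₂ + N₃ + 1, ?_⟩
  intro n hn M hM H hH hdeg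
  have hn0 : 0 < n := by omega
  have hn0' : (0:ℝ) < n := by exact_mod_cast hn0
  have hn2 : (s:ℝ) * p ≤ w / 8 * n := by
    rw [div_le_iff₀ hw] at hN₂
    have : (N₂:ℝ) ≤ n := by exact_mod_cast (show N₂ ≤ n by omega)
    nlinarith
  have hn3 : (1 + (c₀:ℝ)) * (s * T) ≤ w / 8 * n := by
    rw [div_le_iff₀ hw] at hN₃
    have : (N₃:ℝ) ≤ n := by exact_mod_cast (show N₃ ≤ n by omega)
    nlinarith
  obtain ⟨hsn, hsamp⟩ := hN₁ n (by omega)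
  -- size of the initial box
  set z₀ := n / (s * p) with hz₀
  have hsp0 : 0 < s * p := Nat.mul_pos hs hp0
  have hszn : s * (z₀ * p) ≤ n := by
    have := Nat.div_mul_le_self n (s * p)
    calc s * (z₀ * p) = z₀ * (s * p) := by ring
      _ ≤ n := this
  have hzlow : (n:ℝ) * (1 - w / 8) ≤ s * (z₀ * p) := by
    have h1 : n < s * p * (z₀ + 1) := by
      rw [hz₀]; exact Nat.lt_mul_div_succ n hsp0
    have h1' : (n:ℝ) < s * p * (z₀ + 1) := by exact_mod_cast h1
    nlinarith
  have hz0pos : 0 < z₀ := by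
    rcases Nat.eq_zero_or_pos z₀ with h | h
    · rw [h] at hzlow
      have : 0 < (n:ℝ) * (1 - w / 8) := mul_pos hn0' (by linarith)
      simp at hzlow; linarith
    · exact h
  have hrM : r * (z₀ * p) ≤ M := by
    have h1 : a * (s * (z₀ * p)) ≤ (m - ℓ) * M := (Nat.mul_le_mul_left a hszn).trans hM
    have hg0 : 0 < m - ℓ := by omega
    refine Nat.le_of_mul_le_mul_left ?_ hg0
    calc (m - ℓ) * (r * (z₀ * p)) = a * (s * (z₀ * p)) := by rw [hr, hsτ]; ring
      _ ≤ _ := h1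
  set H' : ℕ → Finset (Finset ℕ) := fun c => if h : c < M then H ⟨c, h⟩ else ∅ with hH'
  have hH'v : ∀ c (h : c < M), H' c = H ⟨c, h⟩ := by
    intro c h; simp [hH', h]
  obtain ⟨X, hX0, hXs, hXd, hXdens⟩ := init_box (n := n) (s := s) (z := z₀ * p)
    (Nat.mul_pos hz0pos hp0) hszn (GStar s τ (m - ℓ) hs A H') (Finset.range (r * (z₀ * p)))
    (by rw [Finset.card_range]; exact Nat.mul_pos hr0 (Nat.mul_pos hz0pos hp0)) (w / 32) (by
      intro c hc Bad hBad
      have hcM : c < M := lt_of_lt_of_le (Finset.mem_range.1 hc) hrM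
      refine hsamp (H ⟨c, hcM⟩) (hH _) (hdeg _) Bad ?_
      intro x hx
      refine ⟨(hBad x hx).1, ?_⟩
      rintro ⟨f, hf⟩
      apply (hBad x hx).2
      refine ⟨f, ?_⟩
      rw [Fin.cons_zero, Fin.tail_cons, hH'v c hcM]
      exact hf)
  set wt : Fin (s + 1) → ℕ := Fin.cons r (fun _ => 1) with hwt
  have hwt0 : wt 0 = r := rfl
  have hwts : ∀ i : Fin s, wt i.succ = 1 := fun i => rfl
  obtain ⟨j, hjD, B, ⟨hB1, hB2⟩, hBgood⟩ := hD (GStar s τ (m - ℓ) hs A H') wt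
    (by intro i; refine Fin.cases ?_ (fun i => ?_) i
        · rw [hwt0]; exact hr0
        · rw [hwts]; exact one_pos) z₀ hz0pos X
    (by intro i; refine Fin.cases ?_ (fun i => ?_) i
        · rw [hX0, Finset.card_range, hwt0]
        · rw [(hXs i).1, hwts, one_mul]) hXdens
  set u := z₀ * (K + 1) ^ (D - j - 1) with hu
  have hu0 : 0 < u := by positivity
  obtain ⟨J, hJ⟩ : ∃ J, J = (K + 1) ^ j := ⟨_, rfl⟩
  have hJu : J * ((K + 1) * u) = z₀ * p := by
    have e : D = j + (1 + (D - j - 1)) := by omega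
    rw [hp, hJ, hu]
    conv_rhs => rw [e, pow_add, pow_add, pow_one]
    ring
  have hJp : J ≤ p := hJ ▸ Nat.pow_le_pow_right (by omega) hjD.le
  have hz₀u : z₀ ≤ u := Nat.le_mul_of_pos_right _ (by positivity)
  -- chain length
  set h := ⌈(1 - w) * n / (s * T)⌉₊ with hh
  have hsT : (0:ℝ) < s * T := by positivity
  have hhlow : (1 - w) * n ≤ h * (s * T) := by
    have := Nat.le_ceil ((1 - w) * n / (s * T))
    rw [div_le_iff₀ hsT] at this
    exact this
  have hhup : ((h:ℝ) + c₀) * (s * T) ≤ (1 - w + w / 8) * n := by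
    have h0 : 0 ≤ (1 - w) * n / (s * T) := div_nonneg (mul_nonneg (by linarith) hn0'.le) hsT.le
    have h1 := (Nat.ceil_lt_add_one h0).le
    rw [← hh] at h1
    have h2 := mul_le_mul_of_nonneg_right h1 hsT.le
    rw [add_mul, div_mul_cancel₀ _ hsT.ne'] at h2
    nlinarith
  have hc₀1 : (1:ℝ) ≤ c₀ := by rw [hc₀]; push_cast; linarith [(Nat.cast_nonneg A.card : (0:ℝ) ≤ _)]
  have hh0' : (0:ℝ) ≤ h := Nat.cast_nonneg _
  have hu0' : (0:ℝ) < u := by exact_mod_cast hu0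
  have hkey : 4 * (s:ℝ) ^ 2 * (h + c₀) ≤ η * u := by
    have h1 : ((h:ℝ) + c₀) * (s * T) ≤ n := by nlinarith
    have h2 : (n:ℝ) ≤ 2 * (s * (u * p)) := by
      have e1 : (z₀:ℝ) ≤ u := by exact_mod_cast hz₀u
      have e2 : (s:ℝ) * (z₀ * p) ≤ s * (u * p) := by gcongr
      nlinarith
    have h3 : ((h:ℝ) + c₀) * T ≤ 2 * (u * p) := by
      have : s * (((h:ℝ) + c₀) * T) ≤ s * (2 * (u * p)) := by linarith
      exact le_of_mul_le_mul_left this hs'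
    have h4 : (4 * (s:ℝ) ^ 2 * (h + c₀)) * T ≤ (η * u) * T := by
      calc (4 * (s:ℝ) ^ 2 * (h + c₀)) * T = 4 * (s:ℝ) ^ 2 * ((h + c₀) * T) := by ring
        _ ≤ 4 * (s:ℝ) ^ 2 * (2 * (u * p)) := by gcongr
        _ = (8 * (s:ℝ) ^ 2 * p) * u := by ring
        _ ≤ (η * T) * u := by gcongr
        _ = _ := by ring
    exact le_of_mul_le_mul_right h4 hT0'
  have hPcard : (chainP (m - ℓ) (τ * h) A).card ≤ r * (h + c₀) := by
    refine (chainP_card hA (τ * h)).trans ?_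
    rw [← ha]
    have e1 : (linkStart ℓ A).card ≤ r * c₀ := by
      have : 1 * c₀ ≤ r * c₀ := Nat.mul_le_mul_right _ hr0
      omega
    calc τ * h * a + (linkStart ℓ A).card ≤ τ * h * a + r * c₀ := by omega
      _ = r * (h + c₀) := by rw [hr]; ring
  set Q := K * u / (h + c₀) with hQ
  have hQle : Q * (h + c₀) ≤ K * u := Nat.div_mul_le_self _ _
  have hQlow : (K:ℝ) * u / (h + c₀) - 1 ≤ Q := by
    have hpos : 0 < h + c₀ := by omega
    have h1 : K * u < (h + c₀) * (Q + 1) := by rw [hQ]; exact Nat.lt_mul_div_succ _ hpos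
    have h1' : (K:ℝ) * u < (h + c₀) * (Q + 1) := by exact_mod_cast h1
    have hpos' : (0:ℝ) < h + c₀ := by exact_mod_cast hpos
    rw [sub_le_iff_le_add, div_le_iff₀ hpos']
    linarith
  set Good := Finset.univ.filter (fun b => ∀ U : Fin (s + 1) → Finset ℕ,
    (∀ i, U i ⊆ B b i ∧ (U i).card = wt i * u) →
    1 / 4 ≤ boxDens (GStar s τ (m - ℓ) hs A H') U) with hGood
  have hTQ : T ≤ Good.card * Q := by
    have := num_count (w := w) (n := n) (s := s) (T := T) (p := p) (K := K) (h := h) (c₀ := c₀)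
      (z₀ := z₀) (J := J) (u := u) (good := Good.card) hw hw2 hn0' hs' hT0' (Nat.cast_nonneg _)
      (by exact_mod_cast hJp) (by linarith) (by exact_mod_cast hJu) hzlow (by linarith) hhup hTp
      (by
        refine le_trans (le_of_eq ?_) hBgood
        rw [hJ]; push_cast; ring) Q hQlow (Nat.cast_nonneg _)
    exact_mod_cast this
  set P := chainP (m - ℓ) (τ * h) A with hP
  obtain ⟨φ, c, g1, g2, g3, g4, g5⟩ := assemble (L := s * h + ℓ) (n := n) (Q := Q) (T := T) hs P H' X B
    (fun b i => (hB1 b i).1) hB2 hXd (fun i => (hXs i).2) Good (by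
      intro b hb
      have hb' := (Finset.mem_filter.1 hb).2
      refine greedy (K := K) (u := u) (r := r) (c₀ := c₀) hs hsτ hms hℓm.le hr0 hu0 hτ (by omega) A
        (fun e he => (hA.2.1 e he).1) H' (B b) ?_ ?_ ?_ ?_ η hη ?_ ?_ hPcard Q hQle
      · rw [(hB1 b 0).2, hwt0]
      · intro i; rw [(hB1 b i.succ).2, hwts, one_mul]
      · intro i i' hii
        exact (hXd i i' hii).mono (hB1 b i.succ).1 (hB1 b i'.succ).1
      · intro U hU1 hU2 hU3
        refine hb' U (fun i => ⟨hU1 i, ?_⟩)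
        refine Fin.cases ?_ (fun i => ?_) i
        · rw [hU2, hwt0]
        · rw [hU3, hwts, one_mul]
      · rw [div_div, div_mul_eq_mul_div, le_div_iff₀ (by positivity)]
        have : (s:ℝ) ^ 2 * (h + 1) ≤ (s:ℝ) ^ 2 * (h + c₀) := by gcongr
        nlinarith
      · have e1 : (P.card : ℝ) ≤ r * (h + c₀) := by exact_mod_cast hPcard
        have e2 : (h:ℝ) + c₀ ≤ η / 2 * u := by
          have e3 : (1:ℝ) ≤ (s:ℝ) ^ 2 := one_le_pow₀ hs1
          have e4 : 1 * ((h:ℝ) + c₀) ≤ (s:ℝ) ^ 2 * (h + c₀) :=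
            mul_le_mul_of_nonneg_right e3 (by linarith)
          nlinarith
        have hr' : (0:ℝ) ≤ r := Nat.cast_nonneg _
        calc (P.card : ℝ) ≤ r * (h + c₀) := e1
          _ ≤ r * (η / 2 * u) := mul_le_mul_of_nonneg_left e2 hr'
          _ = _ := by ring) hTQ
  have hcM : ∀ j, ∀ e ∈ P, c j e < M := by
    intro j e he
    have := (g4 j e he).1
    rw [hX0] at this
    exact lt_of_lt_of_le (Finset.mem_range.1 this) hrM
  have hM0 : 0 < M := lt_of_lt_of_le (Nat.mul_pos hr0 (Nat.mul_pos hz0pos hp0)) hrM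
  have hlen : (m - ℓ) * (τ * h) + ℓ = s * h + ℓ := by rw [hsτ]; ring
  refine ⟨fun _ => τ * h, fun _ => P, φ, fun j e => if hc : c j e < M then ⟨c j e, hc⟩ else ⟨0, hM0⟩,
    fun j => chainP_isChain hA (τ * h), ?_, ?_, ?_, ?_, ?_, ?_⟩
  · intro j; simp only [hlen]; exact g1 j
  · intro j; simp only [hlen]; exact g2 j
  · intro j j' hjj; simp only [hlen]; exact g3 j j' hjj
  · intro j e he
    have h1 := hcM j e he
    simp only [h1, dif_pos]
    have := (g4 j e he).2
    rw [hH'v _ h1] at this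
    exact this
  · intro j j' e e' he he' hc
    have h1 := hcM j e he
    have h2 := hcM j' e' he'
    simp only [h1, h2, dif_pos, Fin.mk.injEq] at hc
    exact g5 j j' e e' he he' hc
  · simp only [hlen, Finset.sum_const, Finset.card_univ, Fintype.card_fin, nsmul_eq_mul]
    push_cast
    have e1 : w * (n:ℝ) ≤ ω * n := mul_le_mul_of_nonneg_right hwω hn0'.le
    have e2 : (0:ℝ) ≤ T * ℓ := by positivity
    nlinarith
end
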